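/- Let n ≥ 2, M ≥ 1, let A = (a^{αβ}_{rs}) be a constant complex coefficient tensor satisfying the Legendre–Hadamard ellipticity condition, with system L_A. Assume: (1) E = (E_{γβ}) : ℝⁿ∖{0} → ℂ^{M×M} is C^∞ with E(-x) = E(x), each first-order partial derivative ∂_r E_{γβ} is positively homogeneous of degree 1-n, and E is a fundamental solution of L_A in the sense that for all φ ∈ C_c^∞(ℝⁿ;ℂ^M) and each β, ∫_{ℝⁿ} Σ_{γ} E_{γβ}(x) (L_A^⊤φ)_γ(x) dx = φ_β(0), where (L_A^⊤φ)_γ = Σ_{α,r,s} a^{αγ}_{rs} ∂_r∂_s φ_α; (2) there exists k = (k_{γα}) : ℝⁿ∖{0} → ℂ^{M×M} such that Σ_{r,β} a^{βα}_{rs}(∂_r E_{γβ})(x) = x_s k_{γα}(x) for all x ∈ ℝⁿ∖{0}, all s ∈ {1,…,n}, and all γ,α; (3) the function P := 2k(·,1) : ℝ^{n-1} → ℂ^{M×M} satisfies |P(x')| ≤ c(1+|x'|²)^{-n/2} for some c > 0 and ∫_{ℝ^{n-1}} P(x') dx' = I_{M×M}. Fix p ∈ (1,∞), ℓ ∈ ℕ₀,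 κ > 0. Then there is a finite constant C > 0, independent of f, such that for every f ∈ L^p_ℓ(ℝ^{n-1};ℂ^M) the function u(x',t) := (P_t * f)(x') satisfies L_A u = 0 in ℝⁿ₊, the nontangential limit of u equals f almost everywhere on ℝ^{n-1}, N_κ(∇^k u) ∈ L^p(ℝ^{n-1}) for all 0 ≤ k ≤ ℓ, and Σ_{k=0}^ℓ ‖N_κ(∇^k u)‖_{L^p(ℝ^{n-1})} ≤ C ‖f‖_{L^p_ℓ(ℝ^{n-1})}. -/

import Mathlib

open MeasureTheory Filter Metric Real
open scoped ENNReal NNReal Topology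

noncomputable section

/-- The point `(x', t)` of `ℝⁿ`, where `x' ∈ ℝ^{n-1}` and `t ∈ ℝ` is the last coordinate. -/
def toUp {n : ℕ} (x' : EuclideanSpace ℝ (Fin (n - 1))) (t : ℝ) :
    EuclideanSpace ℝ (Fin n) :=
  (WithLp.equiv 2 (Fin n → ℝ)).symm
    (fun i => if h : (i : ℕ) < n - 1 then x' ⟨i, h⟩ else t)

/-- The first `n-1` coordinates of a point of `ℝⁿ`. -/
def xinit {n : ℕ} (x : EuclideanSpace ℝ (Fin n)) : EuclideanSpace ℝ (Fin (n - 1)) :=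
  (WithLp.equiv 2 (Fin (n - 1) → ℝ)).symm
    (fun i => x ⟨(i : ℕ), Nat.lt_of_lt_of_le i.isLt (Nat.sub_le n 1)⟩)

/-- The last coordinate of a point of `ℝⁿ`. -/
def xlast {n : ℕ} (x : EuclideanSpace ℝ (Fin n)) : ℝ :=
  if h : 0 < n then x ⟨n - 1, by omega⟩ else 0

/-- The upper half space `ℝⁿ₊`. -/
def upperHalfSpace (n : ℕ) : Set (EuclideanSpace ℝ (Fin n)) := {x | 0 < xlast x}

/-- The embedding `Fin (n-1) → Fin n`. -/
def finUp {n : ℕ} (i : Fin (n - 1)) : Fin n :=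
  ⟨(i : ℕ), Nat.lt_of_lt_of_le i.isLt (Nat.sub_le n 1)⟩

/-- The last index of `Fin n`. -/
def lastIdx (n : ℕ) (h : 0 < n) : Fin n := ⟨n - 1, by omega⟩

/-- Partial derivative along the `i`-th coordinate direction. -/
def pd {n : ℕ} {F : Type*} [NormedAddCommGroup F] [NormedSpace ℝ F]
    (i : Fin n) (u : EuclideanSpace ℝ (Fin n) → F) (x : EuclideanSpace ℝ (Fin n)) : F :=
  fderiv ℝ u x (EuclideanSpace.single i 1)

/-- Iterated mixed partial derivative along the string of coordinate directions `d`. -/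
def mpd {n : ℕ} {F : Type*} [NormedAddCommGroup F] [NormedSpace ℝ F]
    (k : ℕ) (d : Fin k → Fin n) (u : EuclideanSpace ℝ (Fin n) → F)
    (x : EuclideanSpace ℝ (Fin n)) : F :=
  iteratedFDeriv ℝ k u x (fun i => EuclideanSpace.single (d i) 1)

/-- The nontangential approach filter for the cone `Γ_κ(x')` (points written as `(y', t)`). -/
def ntFilter {n : ℕ} (κ : ℝ) (x' : EuclideanSpace ℝ (Fin (n - 1))) :
    Filter ((EuclideanSpace ℝ (Fin (n - 1))) × ℝ) :=
  (nhds (x', (0 : ℝ))) ⊓ Filter.principal {q | 0 < q.2 ∧ dist x' q.1 < κ * q.2}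

/-- The nontangential maximal function (aperture `κ`) of `u : ℝⁿ → F`,
as an `ℝ≥0∞`-valued function on `ℝ^{n-1}`. -/
def ntMax {n : ℕ} {F : Type*} [NormedAddCommGroup F] (κ : ℝ)
    (u : EuclideanSpace ℝ (Fin n) → F) (x' : EuclideanSpace ℝ (Fin (n - 1))) : ℝ≥0∞ :=
  ⨆ (y' : EuclideanSpace ℝ (Fin (n - 1))) (t : ℝ) (_ : 0 < t ∧ dist x' y' < κ * t),
    (‖u (toUp y' t)‖₊ : ℝ≥0∞)

/-- The `L^p` norm (`p ∈ (0,∞]`) of an `ℝ≥0∞`-valued function on `ℝ^m`. -/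
def lpNormE {m : ℕ} (g : EuclideanSpace ℝ (Fin m) → ℝ≥0∞) (p : ℝ≥0∞) : ℝ≥0∞ :=
  if p = ∞ then essSup g volume
  else (∫⁻ x', (g x') ^ p.toReal) ^ (1 / p.toReal)

/-- The Hardy–Littlewood maximal function. -/
def hlMax {m : ℕ} {F : Type*} [NormedAddCommGroup F]
    (f : EuclideanSpace ℝ (Fin m) → F) (x' : EuclideanSpace ℝ (Fin m)) : ℝ≥0∞ :=
  ⨆ (r : ℝ) (_ : 0 < r),
    (volume (ball x' r))⁻¹ * ∫⁻ y' in ball x' r, (‖f y'‖₊ : ℝ≥0∞)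

/-- The Legendre-Hadamard ellipticity condition for the coefficient tensor `A`,
where `A r s α β` stands for `a^{αβ}_{rs}`. -/
def LegendreHadamard {n M : ℕ} (A : Fin n → Fin n → Fin M → Fin M → ℂ) : Prop :=
  ∃ κ₀ : ℝ, 0 < κ₀ ∧ ∀ (ξ : Fin n → ℝ) (η : Fin M → ℂ),
    κ₀ * (∑ r, ξ r ^ 2) * (∑ a, ‖η a‖ ^ 2) ≤
      (∑ r, ∑ s, ∑ a, ∑ b, A r s a b * ξ r * ξ s * (starRingEnd ℂ) (η a) * η b).re

/-- `g` is the weak (distributional) mixed partial derivative of `f` of order `k`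
along the string of directions `d`. -/
def IsWeakDeriv {m : ℕ} {F : Type*} [NormedAddCommGroup F] [NormedSpace ℝ F]
    (k : ℕ) (d : Fin k → Fin m) (f g : EuclideanSpace ℝ (Fin m) → F) : Prop :=
  ∀ φ : EuclideanSpace ℝ (Fin m) → ℝ, ContDiff ℝ (⊤ : ℕ∞) φ → HasCompactSupport φ →
    ∫ x', (mpd k d φ x') • f x' = ((-1 : ℝ) ^ k) • ∫ x', φ x' • g x'

/-- The surface area `ω_{n-1}` of the unit sphere `S^{n-1}` in `ℝⁿ`. -/
def sphereArea (n : ℕ) : ℝ :=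
  (n : ℝ) * (volume (ball (0 : EuclideanSpace ℝ (Fin n)) (1 : ℝ))).toReal

/-- The parabolic dilation `F_t(x') = t^{1-n} F(x'/t)` of a matrix-valued kernel. -/
def matDil {n M : ℕ} (P : EuclideanSpace ℝ (Fin (n - 1)) → Matrix (Fin M) (Fin M) ℂ)
    (t : ℝ) (x' : EuclideanSpace ℝ (Fin (n - 1))) : Matrix (Fin M) (Fin M) ℂ :=
  (t ^ ((1 : ℤ) - (n : ℤ))) • P (t⁻¹ • x')

/-- The convolution `(P_t * f)(x')` of a dilated matrix kernel with a `ℂ^M`-valued function. -/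
def matConv {n M : ℕ} (P : EuclideanSpace ℝ (Fin (n - 1)) → Matrix (Fin M) (Fin M) ℂ)
    (f : EuclideanSpace ℝ (Fin (n - 1)) → EuclideanSpace ℂ (Fin M))
    (t : ℝ) (x' : EuclideanSpace ℝ (Fin (n - 1))) : EuclideanSpace ℂ (Fin M) :=
  (WithLp.equiv 2 (Fin M → ℂ)).symm
    (fun γ => ∫ y', ∑ α, matDil P t (x' - y') γ α * f y' α)

set_option linter.all false
local notation "ES" m:max => EuclideanSpace ℝ (Fin m)
local notation "oR" => ENNReal.ofReal

section HL
variable {E : Type*} [NormedAddCommGroup E] [NormedSpace ℝ E] [FiniteDimensional ℝ E]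
  [MeasurableSpace E] [BorelSpace E]

lemma layer_fin (q : ℝ) (hq : 0 < q) (b : ℝ) (hb : 0 ≤ b) :
    ∫⁻ t in Set.Ioo (0:ℝ) b, oR (q * t ^ (q - 1)) = oR b ^ q := by
  have hIn : IntervalIntegrable (fun t : ℝ => q * t ^ (q-1)) volume 0 b :=
    (intervalIntegral.intervalIntegrable_rpow' (by linarith)).const_mul q
  rw [← Measure.restrict_congr_set Ioo_ae_eq_Ioc.symm, ← ofReal_integral_eq_lintegral_ofReal,
    ← intervalIntegral.integral_of_le hb]
  · rw [intervalIntegral.integral_const_mul, integral_rpow (Or.inl (by linarith)),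
      ENNReal.ofReal_rpow_of_nonneg hb hq.le]
    congr 1
    rw [sub_add_cancel, Real.zero_rpow hq.ne']
    field_simp
    simp
  · exact (intervalIntegrable_iff_integrableOn_Ioc_of_le hb).1 hIn
  · refine (ae_restrict_iff' measurableSet_Ioc).2 (Eventually.of_forall ?_)
    intro t ht
    have := Real.rpow_nonneg ht.1.le (q-1)
    simp only [Pi.zero_apply]
    positivity

lemma layer (q : ℝ) (hq : 0 < q) (a : ℝ≥0∞) :
    ∫⁻ t in Set.Ioi (0:ℝ), (if oR t < a then oR (q * t ^ (q - 1)) else 0)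
      = a ^ q := by
  have key : ∀ b : ℝ, 0 ≤ b → oR b ≤ a → oR b ^ q ≤
    ∫⁻ t in Set.Ioi (0:ℝ), (if oR t < a then oR (q * t ^ (q - 1)) else 0) := by
    intro b hb hba
    rw [← layer_fin q hq b hb]
    calc _ = ∫⁻ t in Set.Ioo (0:ℝ) b,
        (if oR t < a then oR (q * t ^ (q - 1)) else 0) := by
          refine setLIntegral_congr_fun measurableSet_Ioo ?_
          intro t ht
          simp only
          rw [if_pos]
          exact lt_of_lt_of_le ((ENNReal.ofReal_lt_ofReal_iff (ht.1.trans ht.2)).2 ht.2) hba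
      _ ≤ _ := lintegral_mono_set (fun t ht => ht.1)
  by_cases ha : a = ∞
  · rw [ha, ENNReal.top_rpow_of_pos hq, ← top_le_iff]
    rw [ha] at key
    refine le_of_tendsto' (f := fun j : ℕ => (oR (j:ℝ)) ^ q) (x := atTop) ?_
      (fun j => key j (by positivity) le_top)
    have h1 : Tendsto (fun j : ℕ => (oR (j:ℝ))) atTop (𝓝 ∞) := by
      simpa using ENNReal.tendsto_nat_nhds_top
    have := (ENNReal.continuous_rpow_const (y := q)).tendsto ∞ |>.comp h1
    rwa [ENNReal.top_rpow_of_pos hq] at this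
  · apply le_antisymm
    · conv_rhs => rw [← ENNReal.ofReal_toReal ha, ← layer_fin q hq _ ENNReal.toReal_nonneg]
      rw [← lintegral_indicator measurableSet_Ioi, ← lintegral_indicator measurableSet_Ioo]
      apply lintegral_mono
      intro t
      simp only [Set.indicator_apply, Set.mem_Ioi, Set.mem_Ioo]
      by_cases h1 : 0 < t
      · by_cases h2 : oR t < a
        · have : t < a.toReal := by
            rwa [ENNReal.ofReal_lt_iff_lt_toReal h1.le ha] at h2
          simp [h1, h2, this]
        · simp [h2]
      · simp [h1]
    · have := key a.toReal ENNReal.toReal_nonneg (by rw [ENNReal.ofReal_toReal ha])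
      rwa [ENNReal.ofReal_toReal ha] at this

/-- HL maximal function -/
def HM (φ : E → ℝ≥0∞) (x : E) (μ : Measure E := by volume_tac) : ℝ≥0∞ := ⨆ (r : ℝ) (_ : 0 < r), (μ (ball x r))⁻¹ * ∫⁻ y in ball x r, φ y ∂μ

variable (μ : Measure E) [μ.IsAddHaarMeasure]

lemma vol_ball_dim (x : E) {r : ℝ} (hr : 0 < r) : μ (ball x r) =
    oR (r ^ Module.finrank ℝ E) * μ (ball (0:E) 1) :=
  Measure.addHaar_ball_of_pos μ x hr

lemma vol_ball_pos (x : E) {r : ℝ} (hr : 0 < r) : μ (ball x r) ≠ 0 :=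
  (measure_ball_pos μ x hr).ne'

lemma HM_ball_le (φ : E → ℝ≥0∞) (x : E) {r : ℝ} (hr : 0 < r) :
    ∫⁻ y in ball x r, φ y ∂μ ≤ μ (ball x r) * HM φ x μ := by
  have : (μ (ball x r))⁻¹ * ∫⁻ y in ball x r, φ y ∂μ ≤ HM φ x μ := by
    unfold HM
    exact le_iSup₂ (f := fun r (_ : 0 < r) => (μ (ball x r))⁻¹ * ∫⁻ y in ball x r, φ y ∂μ) r hr
  calc _ = μ (ball x r) * ((μ (ball x r))⁻¹ * ∫⁻ y in ball x r, φ y ∂μ) := by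
        rw [← mul_assoc, ENNReal.mul_inv_cancel (vol_ball_pos μ x hr) measure_ball_lt_top.ne, one_mul]
    _ ≤ _ := by gcongr

lemma lsc_ball (φ : E → ℝ≥0∞) (r : ℝ) :
    LowerSemicontinuous (fun x => ∫⁻ y in ball x r, φ y ∂μ) := by
  intro x a ha
  have hmono : Monotone (fun j : ℕ => ball x (r - 1/((j:ℝ)+1))) := by
    intro i j hij
    apply ball_subset_ball
    have : 1/((j:ℝ)+1) ≤ 1/((i:ℝ)+1) := by
      apply one_div_le_one_div_of_le (by positivity)
      have : (i:ℝ) ≤ j := by exact_mod_cast hij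
      linarith
    linarith
  have hU : ball x r = ⋃ j : ℕ, ball x (r - 1/((j:ℝ)+1)) := by
    ext y
    simp only [mem_ball, Set.mem_iUnion]
    constructor
    · intro h
      obtain ⟨j, hj⟩ := exists_nat_one_div_lt (sub_pos.2 h)
      exact ⟨j, by linarith⟩
    · rintro ⟨j, hj⟩
      have : 0 < 1/((j:ℝ)+1) := by positivity
      linarith
  have hsup : ∃ j : ℕ, a < ∫⁻ y in ball x (r - 1/((j:ℝ)+1)), φ y ∂μ := by
    have := setLIntegral_iUnion_of_directed (μ := μ) φ hmono.directed_le
    change a < _ at ha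
    simp only [hU, this] at ha
    exact lt_iSup_iff.1 ha
  obtain ⟨j, hj⟩ := hsup
  have hpos : 0 < 1/((j:ℝ)+1) := by positivity
  filter_upwards [ball_mem_nhds x hpos] with y hy
  refine hj.trans_le (lintegral_mono_set ?_)
  apply ball_subset_ball'
  rw [mem_ball, dist_comm] at hy
  linarith

lemma HM_lsc (φ : E → ℝ≥0∞) : LowerSemicontinuous (fun x => HM φ x μ) := by
  unfold HM
  apply lowerSemicontinuous_biSup
  intro r hr x a ha
  have hv : ∀ y : E, μ (ball y r) = μ (ball (0:E) r) := fun y => by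
    rw [vol_ball_dim μ y hr, vol_ball_dim μ 0 hr]
  simp_rw [hv] at ha ⊢
  have h0 := vol_ball_pos μ (0:E) hr
  have h1 : μ (ball (0:E) r) ≠ ∞ := measure_ball_lt_top.ne
  have := lsc_ball μ φ r x (a * μ (ball (0:E) r)) (by
    change _ < _
    change _ < _ at ha
    rwa [← ENNReal.lt_div_iff_mul_lt (Or.inl h0) (Or.inl h1), ENNReal.div_eq_inv_mul])
  filter_upwards [this] with y hy
  change _ < _
  change _ < _ at hy
  rwa [← ENNReal.lt_div_iff_mul_lt (Or.inl h0) (Or.inl h1), ENNReal.div_eq_inv_mul] at hy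

lemma HM_meas (φ : E → ℝ≥0∞) : Measurable (fun x => HM φ x μ) := (HM_lsc μ φ).measurable

lemma HM_weak (φ : E → ℝ≥0∞) (l : ℝ≥0∞) :
    l * μ {x | l < HM φ x μ} ≤ 5 ^ (Module.finrank ℝ E) * ∫⁻ y, φ y ∂μ := by
  have key : ∀ R : ℕ, l * μ {x | ∃ r : ℝ, 0 < r ∧ r ≤ R ∧ l * μ (ball x r) ≤ ∫⁻ y in ball x r, φ y ∂μ}
      ≤ 5 ^ (Module.finrank ℝ E) * ∫⁻ y, φ y ∂μ := by
    intro R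
    set S := {x | ∃ r : ℝ, 0 < r ∧ r ≤ R ∧ l * μ (ball x r) ≤ ∫⁻ y in ball x r, φ y ∂μ} with hS
    choose! r hr0 hrR hr using (fun x (hx : x ∈ S) => hx)
    obtain ⟨u, huS, hdisj, hcov⟩ := Vitali.exists_disjoint_subfamily_covering_enlargement_ball S
      (fun x => x) r R hrR 5 (by norm_num)
    have hcount : u.Countable := hdisj.countable_of_isOpen (fun _ _ => isOpen_ball)
      (fun x hx => ⟨x, mem_ball_self (hr0 x (huS hx))⟩)
    have hsub : S ⊆ ⋃ x ∈ u, ball x (5 * r x) := by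
      intro x hx
      obtain ⟨b, hb, hbs⟩ := hcov x hx
      exact Set.mem_biUnion hb (hbs (mem_ball_self (hr0 x hx)))
    haveI := hcount.to_subtype
    calc l * μ S ≤ l * μ (⋃ x ∈ u, ball x (5 * r x)) := by gcongr
      _ ≤ l * ∑' x : u, μ (ball (x:E) (5 * r x)) := by
        gcongr
        exact measure_biUnion_le μ hcount _
      _ = ∑' x : u, 5 ^ (Module.finrank ℝ E) * (l * μ (ball (x:E) (r x))) := by
        rw [← ENNReal.tsum_mul_left]
        congr 1; ext x
        have h0 := hr0 x (huS x.2)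
        rw [vol_ball_dim μ _ (by positivity), vol_ball_dim μ _ h0, mul_pow, ENNReal.ofReal_mul (by positivity),
          ENNReal.ofReal_pow (by norm_num)]
        simp only [ENNReal.ofReal_ofNat]
        ring
      _ ≤ ∑' x : u, 5 ^ (Module.finrank ℝ E) * ∫⁻ y in ball (x:E) (r x), φ y ∂μ := by
        gcongr with x
        exact hr x (huS x.2)
      _ = 5 ^ (Module.finrank ℝ E) * ∫⁻ y in ⋃ x ∈ u, ball (x:E) (r x), φ y ∂μ := by
        rw [ENNReal.tsum_mul_left, lintegral_biUnion hcount (fun _ _ => measurableSet_ball) hdisj]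
      _ ≤ _ := by
        exact mul_le_mul_right (setLIntegral_le_lintegral _ _) _
  have hsub : {x | l < HM φ x μ} ⊆ ⋃ R : ℕ, {x | ∃ r : ℝ, 0 < r ∧ r ≤ R ∧ l * μ (ball x r) ≤ ∫⁻ y in ball x r, φ y ∂μ} := by
    intro x hx
    simp only [Set.mem_ofPred_eq, HM, lt_iSup_iff] at hx
    obtain ⟨r, hr, h⟩ := hx
    obtain ⟨R, hR⟩ := exists_nat_ge r
    refine Set.mem_iUnion.2 ⟨R, r, hr, hR, ?_⟩
    rw [← ENNReal.div_eq_inv_mul, ENNReal.lt_div_iff_mul_lt (Or.inl (vol_ball_pos μ x hr)) (Or.inl measure_ball_lt_top.ne)] at h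
    exact h.le
  calc _ ≤ l * μ (⋃ R : ℕ, {x | ∃ r : ℝ, 0 < r ∧ r ≤ R ∧ l * μ (ball x r) ≤ ∫⁻ y in ball x r, φ y ∂μ}) := by gcongr
    _ = ⨆ R : ℕ, l * μ {x | ∃ r : ℝ, 0 < r ∧ r ≤ R ∧ l * μ (ball x r) ≤ ∫⁻ y in ball x r, φ y ∂μ} := by
      rw [Monotone.measure_iUnion, ENNReal.mul_iSup]
      intro i j hij x
      rintro ⟨r, h1, h2, h3⟩
      exact ⟨r, h1, h2.trans (by exact_mod_cast hij), h3⟩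
    _ ≤ _ := iSup_le key

lemma HM_add_le (φ ψ : E → ℝ≥0∞) (hφ : Measurable φ) (x : E) :
    HM (fun y => φ y + ψ y) x μ ≤ HM φ x μ + HM ψ x μ := by
  unfold HM
  refine iSup₂_le fun r hr => ?_
  rw [lintegral_add_left hφ, mul_add]
  gcongr
  · exact le_iSup₂ (f := fun r (_ : 0 < r) => (μ (ball x r))⁻¹ * ∫⁻ y in ball x r, φ y ∂μ) r hr
  · exact le_iSup₂ (f := fun r (_ : 0 < r) => (μ (ball x r))⁻¹ * ∫⁻ y in ball x r, ψ y ∂μ) r hr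

lemma HM_le_const (φ : E → ℝ≥0∞) (a : ℝ≥0∞) (h : ∀ y, φ y ≤ a) (x : E) : HM φ x μ ≤ a := by
  unfold HM
  refine iSup₂_le fun r hr => ?_
  calc _ ≤ (μ (ball x r))⁻¹ * ∫⁻ y in ball x r, a ∂μ := by gcongr; exact h _
    _ = (μ (ball x r))⁻¹ * μ (ball x r) * a := by rw [setLIntegral_const]; ring
    _ = a := by rw [ENNReal.inv_mul_cancel (vol_ball_pos μ x hr) measure_ball_lt_top.ne, one_mul]

lemma HM_strong_meas (p : ℝ) (hp : 1 < p) : ∃ C : ℝ≥0∞, C ≠ ∞ ∧ ∀ φ : E → ℝ≥0∞, Measurable φ →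
    ∫⁻ x, (HM φ x μ) ^ p ∂μ ≤ C * ∫⁻ x, (φ x) ^ p ∂μ := by
  set d := Module.finrank ℝ E
  refine ⟨oR (p / (p-1)) * 2 * 5 ^ d * 2 ^ (p-1), ?_, ?_⟩
  · refine ENNReal.mul_ne_top (ENNReal.mul_ne_top (ENNReal.mul_ne_top ?_ ?_) ?_) ?_
    · exact ENNReal.ofReal_ne_top
    · norm_num
    · exact ENNReal.pow_ne_top (by norm_num)
    · exact ENNReal.rpow_ne_top_of_nonneg (by linarith) (by norm_num)
  intro φ hφ
  have hstep : ∀ t : ℝ, 0 < t → μ {x | oR t < HM φ x μ} ≤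
     (oR t)⁻¹ * (2 * 5 ^ d) * ∫⁻ y, (if oR t < 2 * φ y then φ y else 0) ∂μ := by
    intro t ht
    set ψ : E → ℝ≥0∞ := fun y => if oR t < 2 * φ y then φ y else 0 with hψ
    set χ : E → ℝ≥0∞ := fun y => if oR t < 2 * φ y then 0 else φ y with hχ
    have hms : MeasurableSet {y | oR t < 2 * φ y} :=
      measurableSet_lt measurable_const (hφ.const_mul 2)
    have hψm : Measurable ψ := Measurable.ite hms hφ measurable_const
    have hsum : φ = fun y => ψ y + χ y := by
      ext y; simp only [hψ, hχ]; split_ifs <;> simp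
    have ht2 : oR t = oR (t/2) + oR (t/2) := by
      rw [← ENNReal.ofReal_add (by positivity) (by positivity)]; congr 1; ring
    have hχle : ∀ y, χ y ≤ oR (t/2) := by
      intro y
      simp only [hχ]
      split_ifs with h
      · simp
      · push Not at h
        rw [ht2, ← two_mul] at h
        exact (ENNReal.mul_le_mul_iff_right (by norm_num) (by norm_num)).1 h
    have hsub : {x | oR t < HM φ x μ} ⊆ {x | oR (t/2) < HM ψ x μ} := by
      intro x hx
      simp only [Set.mem_ofPred_eq] at hx ⊢
      have h1 : HM φ x μ ≤ HM ψ x μ + oR (t/2) := by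
        conv_lhs => rw [hsum]
        refine (HM_add_le μ ψ χ hψm x).trans ?_
        gcongr
        exact HM_le_const μ χ _ hχle x
      have h2 := hx.trans_le h1
      rw [ht2] at h2
      exact (ENNReal.add_lt_add_iff_right ENNReal.ofReal_ne_top).1 h2
    have hw := HM_weak μ ψ (oR (t/2))
    have ht0 : oR t ≠ 0 := by simpa using ht
    calc _ = (oR t)⁻¹ * (oR t * μ {x | oR t < HM φ x μ}) := by
          rw [← mul_assoc, ENNReal.inv_mul_cancel ht0 ENNReal.ofReal_ne_top, one_mul]
      _ ≤ (oR t)⁻¹ * (2 * (oR (t/2) * μ {x | oR (t/2) < HM ψ x μ})) := by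
          rw [← mul_assoc 2, two_mul, ← ht2]; gcongr
      _ ≤ (oR t)⁻¹ * (2 * (5 ^ d * ∫⁻ y, ψ y ∂μ)) := by gcongr
      _ = _ := by ring
  have hjm : Measurable (fun q : E × ℝ => if oR q.2 < HM φ q.1 μ then oR (p * q.2 ^ (p - 1)) else 0) := by
    refine Measurable.ite (measurableSet_lt (by fun_prop) ((HM_meas μ φ).comp measurable_fst)) ?_ measurable_const
    fun_prop
  have hjm2 : Measurable (fun q : ℝ × E => if oR q.1 < 2 * φ q.2 then oR ((p-1) * q.1 ^ (p - 1 - 1)) * φ q.2 else 0) := by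
    refine Measurable.ite (measurableSet_lt (by fun_prop) (by fun_prop)) (by fun_prop) measurable_const
  calc ∫⁻ x, (HM φ x μ) ^ p ∂μ = ∫⁻ x, (∫⁻ t in Set.Ioi (0:ℝ), (if oR t < HM φ x μ then oR (p * t ^ (p - 1)) else 0)) ∂μ := by
        simp_rw [layer p (by linarith)]
    _ = ∫⁻ t in Set.Ioi (0:ℝ), ∫⁻ x, (if oR t < HM φ x μ then oR (p * t ^ (p - 1)) else 0) ∂μ := by
        rw [lintegral_lintegral_swap]
        exact hjm.aemeasurable
    _ ≤ ∫⁻ t in Set.Ioi (0:ℝ), oR (p/(p-1)) * (2 * 5^d) * ∫⁻ y, (if oR t < 2 * φ y then oR ((p-1) * t ^ (p - 1 - 1)) * φ y else 0) ∂μ := by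
        refine setLIntegral_mono' measurableSet_Ioi ?_
        intro t ht
        have ht : 0 < t := ht
        have e1 : ∫⁻ x, (if oR t < HM φ x μ then oR (p * t ^ (p - 1)) else 0) ∂μ = oR (p * t ^ (p - 1)) * μ {x | oR t < HM φ x μ} := by
          rw [← setLIntegral_const, ← lintegral_indicator (measurableSet_lt measurable_const (HM_meas μ φ))]
          congr 1; ext x; simp [Set.indicator_apply]
        have e2 : ∫⁻ y, (if oR t < 2 * φ y then oR ((p-1) * t ^ (p - 1 - 1)) * φ y else 0) ∂μ = oR ((p-1) * t ^ (p - 1 - 1)) * ∫⁻ y, (if oR t < 2 * φ y then φ y else 0) ∂μ := by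
          rw [← lintegral_const_mul']
          · congr 1; ext y; split_ifs <;> simp
          · exact ENNReal.ofReal_ne_top
        rw [e1, e2]
        have hp1 : 0 < p - 1 := by linarith
        calc _ ≤ oR (p * t ^ (p - 1)) * ((oR t)⁻¹ * (2 * 5 ^ d) * ∫⁻ y, (if oR t < 2 * φ y then φ y else 0) ∂μ) := by
              gcongr
              exact hstep t ht
          _ = (oR (p * t ^ (p - 1)) * (oR t)⁻¹) * ((2 * 5 ^ d) * ∫⁻ y, (if oR t < 2 * φ y then φ y else 0) ∂μ) := by ring
          _ = (oR (p/(p-1)) * oR ((p-1) * t ^ (p - 1 - 1))) * ((2 * 5 ^ d) * ∫⁻ y, (if oR t < 2 * φ y then φ y else 0) ∂μ) := by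
              congr 1
              rw [← ENNReal.ofReal_inv_of_pos ht, ← ENNReal.ofReal_mul (by positivity), ← ENNReal.ofReal_mul (by positivity)]
              congr 1
              rw [Real.rpow_sub_one ht.ne' (p-1)]
              field_simp
          _ ≤ _ := le_of_eq (by ring)
    _ = oR (p/(p-1)) * (2 * 5^d) * ∫⁻ t in Set.Ioi (0:ℝ), ∫⁻ y, (if oR t < 2 * φ y then oR ((p-1) * t ^ (p - 1 - 1)) * φ y else 0) ∂μ := by
        rw [lintegral_const_mul]
        exact hjm2.lintegral_prod_right'
    _ = oR (p/(p-1)) * (2 * 5^d) * ∫⁻ y, (∫⁻ t in Set.Ioi (0:ℝ), (if oR t < 2 * φ y then oR ((p-1) * t ^ (p - 1 - 1)) * φ y else 0)) ∂μ := by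
        rw [lintegral_lintegral_swap]
        exact hjm2.aemeasurable
    _ = oR (p/(p-1)) * (2 * 5^d) * ∫⁻ y, 2 ^ (p-1) * (φ y) ^ p ∂μ := by
        congr 2; ext y
        have e3 : ∀ t : ℝ, (if oR t < 2 * φ y then oR ((p-1) * t ^ (p - 1 - 1)) * φ y else 0) = (if oR t < 2 * φ y then oR ((p-1) * t ^ (p - 1 - 1)) else 0) * φ y := by
          intro t; split_ifs <;> simp
        simp_rw [e3]
        rw [lintegral_mul_const, layer (p-1) (by linarith), ENNReal.mul_rpow_of_nonneg _ _ (by linarith), mul_assoc]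
        · congr 1
          conv_rhs => rw [show p = (p-1) + 1 by ring, ENNReal.rpow_add_of_nonneg _ _ (by linarith) (by norm_num), ENNReal.rpow_one]
        · refine Measurable.ite (measurableSet_lt (by fun_prop) (by fun_prop)) (by fun_prop) measurable_const
    _ = _ := by
        rw [lintegral_const_mul _ (by fun_prop)]
        ring

lemma HM_congr (φ ψ : E → ℝ≥0∞) (h : φ =ᵐ[μ] ψ) (x : E) : HM φ x μ = HM ψ x μ := by
  unfold HM
  congr 1; ext r; congr 1; ext hr
  congr 1
  exact lintegral_congr_ae (ae_restrict_of_ae h)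

lemma HM_mono (φ ψ : E → ℝ≥0∞) (h : ∀ y, φ y ≤ ψ y) (x : E) : HM φ x μ ≤ HM ψ x μ := by
  unfold HM
  gcongr
  exact h _

lemma HM_strong (p : ℝ) (hp : 1 < p) : ∃ C : ℝ≥0∞, C ≠ ∞ ∧ ∀ φ : E → ℝ≥0∞, AEMeasurable φ μ →
    ∫⁻ x, (HM φ x μ) ^ p ∂μ ≤ C * ∫⁻ x, (φ x) ^ p ∂μ := by
  obtain ⟨C, hC, h⟩ := HM_strong_meas μ p hp
  refine ⟨C, hC, fun φ hφ => ?_⟩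
  obtain ⟨ψ, hψ, he⟩ := hφ
  simp_rw [HM_congr μ φ ψ he]
  refine (h ψ hψ).trans (le_of_eq ?_)
  congr 1
  apply lintegral_congr_ae
  filter_upwards [he] with x hx
  rw [hx]
end HL

section HL2
variable {E : Type*} [NormedAddCommGroup E] [NormedSpace ℝ E] [FiniteDimensional ℝ E]
  [MeasurableSpace E] [BorelSpace E] (μ : Measure E) [μ.IsAddHaarMeasure]

/-- the Poisson-type kernel -/
def pk (d : ℕ) (t s : ℝ) : ℝ := t / (t + s) ^ (d+1)

lemma pk_nonneg (d : ℕ) {t s : ℝ} (ht : 0 < t) (hs : 0 ≤ s) : 0 ≤ pk d t s := by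
  unfold pk; positivity

lemma pk_dyadic (d : ℕ) {t s : ℝ} (ht : 0 < t) (hs : 0 ≤ s) :
    ∃ j : ℕ, s < 2^j * t ∧ pk d t s ≤ 2^(d+1) * ((2:ℝ)⁻¹)^j / (2^j*t)^d := by
  have hex : ∃ j : ℕ, s < 2^j * t := by
    obtain ⟨j, hj⟩ := pow_unbounded_of_one_lt (s/t) (one_lt_two)
    exact ⟨j, by rwa [div_lt_iff₀ ht] at hj⟩
  classical
  refine ⟨Nat.find hex, Nat.find_spec hex, ?_⟩
  have hle : 2^(Nat.find hex) * t ≤ 2 * (t + s) := by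
    rcases Nat.eq_zero_or_pos (Nat.find hex) with h | h
    · rw [h]; linarith
    · have := Nat.find_min hex (Nat.sub_one_lt_of_lt h)
      push Not at this
      have e : (2:ℝ)^(Nat.find hex) = 2 * 2^(Nat.find hex - 1) := by
        rw [← pow_succ']; congr 1; omega
      rw [e]; linarith
  set j := Nat.find hex
  unfold pk
  have e2 : (2:ℝ)^(d+1) * ((2:ℝ)⁻¹)^j / (2^j*t)^d = t * 2^(d+1) / (2^j*t)^(d+1) := by
    rw [inv_pow, pow_succ (2^j*t)]
    field_simp
  rw [e2, div_le_div_iff₀ (by positivity) (by positivity), mul_assoc, ← mul_pow]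
  gcongr

lemma pk_tsum_le {d : ℕ} (hd : d = Module.finrank ℝ E) {t : ℝ} (ht : 0 < t) (x : E) (φ : E → ℝ≥0∞) (hφ : AEMeasurable φ μ) :
    ∫⁻ y, oR (pk d t ‖x - y‖) * φ y ∂μ ≤
     ∑' j : ℕ, (2^(d+1) * μ (ball (0:E) 1)) * ((2:ℝ≥0∞)⁻¹)^j * ((μ (ball x (2^j*t)))⁻¹ * ∫⁻ y in ball x (2^j*t), φ y ∂μ) := by
  have h1 : ∀ y, oR (pk d t ‖x - y‖) * φ y ≤ ∑' j : ℕ, (ball x (2^j*t)).indicator (fun y => oR (2^(d+1) * ((2:ℝ)⁻¹)^j / (2^j*t)^d) * φ y) y := by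
    intro y
    obtain ⟨j, hj1, hj2⟩ := pk_dyadic d ht (norm_nonneg (x-y))
    refine le_trans ?_ (ENNReal.le_tsum j)
    rw [Set.indicator_of_mem (by rw [mem_ball, dist_comm, dist_eq_norm]; exact hj1)]
    gcongr
  calc _ ≤ ∫⁻ y, ∑' j : ℕ, (ball x (2^j*t)).indicator (fun y => oR (2^(d+1) * ((2:ℝ)⁻¹)^j / (2^j*t)^d) * φ y) y ∂μ := lintegral_mono h1
    _ = ∑' j : ℕ, ∫⁻ y, (ball x (2^j*t)).indicator (fun y => oR (2^(d+1) * ((2:ℝ)⁻¹)^j / (2^j*t)^d) * φ y) y ∂μ := by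
      rw [lintegral_tsum]
      intro j
      exact (hφ.const_mul _).indicator measurableSet_ball
    _ ≤ _ := by
      refine ENNReal.tsum_le_tsum fun j => ?_
      rw [lintegral_indicator measurableSet_ball, lintegral_const_mul' _ _ ENNReal.ofReal_ne_top, ← mul_assoc]
      gcongr
      have hpos : 0 < (2:ℝ)^j*t := by positivity
      rw [vol_ball_dim μ x hpos, ← hd]
      have hb0 := vol_ball_pos μ (0:E) one_pos
      have hb1 : μ (ball (0:E) 1) ≠ ∞ := measure_ball_lt_top.ne
      rw [ENNReal.mul_inv (Or.inr hb1) (Or.inr hb0)]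
      apply le_of_eq
      have e : oR (2^(d+1) * ((2:ℝ)⁻¹)^j / (2^j*t)^d) = 2^(d+1) * ((2:ℝ≥0∞)⁻¹)^j * (oR ((2^j*t)^d))⁻¹ := by
        rw [div_eq_mul_inv, ENNReal.ofReal_mul (by positivity), ENNReal.ofReal_mul (by positivity), ENNReal.ofReal_inv_of_pos (by positivity),
          ENNReal.ofReal_pow (by norm_num), ENNReal.ofReal_pow (by norm_num), ENNReal.ofReal_inv_of_pos (by norm_num)]
        simp
      rw [e]
      calc _ = 2^(d+1) * ((2:ℝ≥0∞)⁻¹)^j * (oR ((2^j*t)^d))⁻¹ * (μ (ball (0:E) 1) * (μ (ball (0:E) 1))⁻¹) := by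
            rw [ENNReal.mul_inv_cancel hb0 hb1, mul_one]
        _ = _ := by ring

lemma HM_avg_le (φ : E → ℝ≥0∞) (x : E) {r : ℝ} (hr : 0 < r) :
    (μ (ball x r))⁻¹ * ∫⁻ y in ball x r, φ y ∂μ ≤ HM φ x μ := by
  unfold HM
  exact le_iSup₂ (f := fun r (_ : 0 < r) => (μ (ball x r))⁻¹ * ∫⁻ y in ball x r, φ y ∂μ) r hr

lemma pk_HM_le {d : ℕ} (hd : d = Module.finrank ℝ E) {t : ℝ} (ht : 0 < t) (x : E) (φ : E → ℝ≥0∞) (hφ : AEMeasurable φ μ) :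
    ∫⁻ y, oR (pk d t ‖x - y‖) * φ y ∂μ ≤ (2^(d+1) * μ (ball (0:E) 1)) * 2 * HM φ x μ := by
  refine (pk_tsum_le μ hd ht x φ hφ).trans ?_
  calc _ ≤ ∑' j : ℕ, (2^(d+1) * μ (ball (0:E) 1)) * ((2:ℝ≥0∞)⁻¹)^j * HM φ x μ := by
        gcongr with j
        exact HM_avg_le μ φ x (by positivity)
    _ = _ := by
      rw [ENNReal.tsum_mul_right, ENNReal.tsum_mul_left, ENNReal.tsum_geometric]
      congr 2
      rw [ENNReal.one_sub_inv_two, inv_inv]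

lemma pk_const_ne_top (d : ℕ) : (2^(d+1) * μ (ball (0:E) 1)) * 2 ≠ ∞ := by
  refine ENNReal.mul_ne_top (ENNReal.mul_ne_top (ENNReal.pow_ne_top (by norm_num)) measure_ball_lt_top.ne) (by norm_num)

end HL2

lemma integrable_decay {p : ℝ} (hp : 1 < p) : Integrable (fun x : ℝ => (1 + ‖x‖) ^ (-p)) :=
  integrable_one_add_norm (by simpa using hp)

lemma abs_re_line (x t : ℝ) : ‖x‖ ≤ ‖((x:ℂ) + t * Complex.I)‖ := by
  have := Complex.abs_re_le_norm ((x:ℂ) + t * Complex.I)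
  simpa using this

lemma decay_mono {p a b C : ℝ} (hp : 1 < p) (hC : 0 ≤ C) (ha : 0 ≤ a) (hab : a ≤ b) : C * (1 + b) ^ (-p) ≤ C * (1 + a) ^ (-p) := by
  apply mul_le_mul_of_nonneg_left _ hC
  apply Real.rpow_le_rpow_of_nonpos (by linarith) (by linarith) (by linarith)

lemma line_integrable (G : ℂ → ℂ) (t : ℝ) (ht : 0 < t) (hG : DifferentiableOn ℂ G {z | 0 < z.im})
    (p C : ℝ) (hp : 1 < p) (hC : 0 ≤ C) (hb : ∀ z : ℂ, t ≤ z.im → ‖G z‖ ≤ C * (1 + ‖z‖) ^ (-p)) :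
    Integrable (fun x : ℝ => G (x + t * Complex.I)) := by
  refine Integrable.mono' ((integrable_decay hp).const_mul C) ?_ (Eventually.of_forall fun x => ?_)
  · apply Continuous.aestronglyMeasurable
    rw [← continuousOn_univ]
    refine hG.continuousOn.comp (by fun_prop) ?_
    intro x _
    simpa using ht
  · refine (hb _ (by simp)).trans (decay_mono hp hC (norm_nonneg _) (abs_re_line x t))

lemma cauchy_line (G : ℂ → ℂ) (t : ℝ) (ht : 0 < t) (hG : DifferentiableOn ℂ G {z | 0 < z.im})
    (p C : ℝ) (hp : 1 < p) (hC : 0 ≤ C) (hb : ∀ z : ℂ, t ≤ z.im → ‖G z‖ ≤ C * (1 + ‖z‖) ^ (-p)) :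
    ∫ x : ℝ, G (x + t * Complex.I) = 0 := by
  have hIn := line_integrable G t ht hG p C hp hC hb
  have hlim := intervalIntegral_tendsto_integral hIn tendsto_neg_atTop_atBot tendsto_id
  refine tendsto_nhds_unique hlim ?_
  have hrect : ∀ R : ℝ, 0 < R → ‖∫ x in (-R)..R, G (x + t * Complex.I)‖ ≤ 4 * C * R * (1 + R) ^ (-p) := by
    intro R hR
    have h := Complex.integral_boundary_rect_eq_zero_of_differentiableOn G (⟨-R, t⟩) (⟨R, t + R⟩) (by
      refine hG.mono ?_
      intro z hz
      rw [Complex.mem_reProdIm] at hz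
      simp only [Set.uIcc_of_le (show t ≤ t + R by linarith), Set.mem_Icc] at hz
      simp only [Set.mem_ofPred_eq]
      linarith [hz.2.1])
    simp only at h
    have b1 : ‖∫ x in (-R)..R, G (x + (t+R : ℝ) * Complex.I)‖ ≤ (C * (1 + R) ^ (-p)) * |R - (-R)| := by
      apply intervalIntegral.norm_integral_le_of_norm_le_const
      intro x _
      refine (hb _ (by simp; linarith)).trans (decay_mono hp hC hR.le ?_)
      have := Complex.abs_im_le_norm ((x:ℂ) + (t+R:ℝ) * Complex.I)
      simp at this
      rw [abs_of_pos (by linarith)] at this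
      push_cast
      linarith
    have b2 : ∀ a : ℝ, |a| = R → ‖∫ y in t..(t+R), G ((a:ℝ) + y * Complex.I)‖ ≤ (C * (1 + R) ^ (-p)) * |t + R - t| := by
      intro a ha
      apply intervalIntegral.norm_integral_le_of_norm_le_const
      intro y hy
      rw [Set.uIoc_of_le (by linarith)] at hy
      refine (hb _ (by simp; linarith [hy.1])).trans (decay_mono hp hC hR.le ?_)
      have := abs_re_line a y
      rwa [Real.norm_eq_abs, ha] at this
    have b3 := b2 R (abs_of_pos hR)
    have b4 := b2 (-R) (by rw [abs_neg, abs_of_pos hR])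
    have e1 : |R - (-R)| = 2 * R := by rw [abs_of_pos (by linarith)]; ring
    have e2 : |t + R - t| = R := by rw [abs_of_pos (by linarith)]; ring
    rw [e1] at b1; rw [e2] at b3 b4
    have h' : ∫ x in (-R)..R, G (x + t * Complex.I) = (∫ x in (-R)..R, G (x + (t+R : ℝ) * Complex.I)) - Complex.I • (∫ y in t..(t+R), G ((R:ℝ) + y * Complex.I)) + Complex.I • ∫ y in t..(t+R), G (((-R:ℝ):ℂ) + y * Complex.I) := by
      linear_combination h
    rw [h']
    calc _ ≤ ‖∫ x in (-R)..R, G (x + (t+R : ℝ) * Complex.I)‖ + ‖Complex.I • (∫ y in t..(t+R), G ((R:ℝ) + y * Complex.I))‖ + ‖Complex.I • ∫ y in t..(t+R), G (((-R:ℝ):ℂ) + y * Complex.I)‖ :=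
          (norm_add_le _ _).trans (by gcongr; exact norm_sub_le _ _)
      _ ≤ _ := by
        rw [norm_smul, norm_smul, Complex.norm_I, one_mul, one_mul]
        linarith
  have hz : Tendsto (fun R : ℝ => 4 * C * R * (1 + R) ^ (-p)) atTop (𝓝 0) := by
    have h1 : Tendsto (fun R : ℝ => 4 * C * (1 + R) ^ (-(p-1))) atTop (𝓝 0) := by
      have := (tendsto_rpow_neg_atTop (y := p-1) (by linarith)).comp (tendsto_atTop_add_const_left atTop (1:ℝ) tendsto_id)
      simpa using this.const_mul (4*C)
    refine squeeze_zero' ?_ ?_ h1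
    · filter_upwards [eventually_gt_atTop 0] with R hR
      positivity
    · filter_upwards [eventually_gt_atTop 0] with R hR
      have : (1 + R) ^ (-(p-1)) = (1+R) * (1+R)^(-p) := by
        rw [show -(p-1) = 1 + -p by ring, Real.rpow_add (by linarith), Real.rpow_one]
      rw [this, mul_assoc (4*C)]
      gcongr
      linarith
  refine squeeze_zero_norm' ?_ hz
  filter_upwards [eventually_gt_atTop 0] with R hR
  simpa using hrect R hR

/-- bounded, compactly supported measurable -/
def BC (h : ℝ → ℝ) : Prop := Measurable h ∧ ∃ B, (∀ s, |h s| ≤ B) ∧ ∃ R, 0 < R ∧ ∀ s, R < |s| → h s = 0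

lemma BC.integrable {h : ℝ → ℝ} (hh : BC h) : Integrable h := by
  obtain ⟨hm, B, hB, R, hR, hs⟩ := hh
  have : IntegrableOn h (Set.Icc (-R) R) := by
    refine Measure.integrableOn_of_bounded (M := B) (by simp) hm.aestronglyMeasurable ?_
    exact Eventually.of_forall hB
  rw [integrableOn_iff_integrable_of_support_subset] at this
  · exact this
  · intro s hs'
    by_contra hc
    apply hs'
    apply hs
    by_contra h2
    exact hc (abs_le.1 (not_lt.1 h2))

def FH (h : ℝ → ℝ) (z : ℂ) : ℂ := ∫ s : ℝ, (h s : ℂ) * (Complex.I / (z - s))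

lemma z_sub_norm (z : ℂ) (hz : 0 < z.im) (s : ℝ) : z.im ≤ ‖z - s‖ := by
  have := Complex.abs_im_le_norm (z - s)
  simp at this
  rwa [abs_of_pos hz] at this

lemma FH_integrable {h : ℝ → ℝ} (hh : BC h) (z : ℂ) (hz : 0 < z.im) :
    Integrable (fun s : ℝ => (h s : ℂ) * (Complex.I / (z - s))) := by
  refine Integrable.mono' (hh.integrable.norm.mul_const (1/z.im)) ?_ (Eventually.of_forall fun s => ?_)
  · have := hh.1
    exact (by fun_prop : Measurable (fun s : ℝ => (h s : ℂ) * (Complex.I / (z - s)))).aestronglyMeasurable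
  · rw [norm_mul, norm_div, Complex.norm_I, Complex.norm_real]
    gcongr
    exact z_sub_norm z hz s

lemma FH_diff {h : ℝ → ℝ} (hh : BC h) : DifferentiableOn ℂ (FH h) {z | 0 < z.im} := by
  intro z hz
  have hz : 0 < z.im := hz
  apply DifferentiableAt.differentiableWithinAt
  have hball : ∀ w ∈ ball z (z.im/2), z.im/2 ≤ w.im := by
    intro w hw
    rw [mem_ball, dist_eq_norm] at hw
    have := (Complex.abs_im_le_norm (w - z)).trans hw.le
    rw [Complex.sub_im, abs_le] at this
    linarith [this.1]
  have hm := hh.1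
  refine (hasDerivAt_integral_of_dominated_loc_of_deriv_le (F := fun z s => (h s : ℂ) * (Complex.I / (z - s)))
    (F' := fun z s => (h s : ℂ) * (-Complex.I / (z - s)^2)) (bound := fun s => ‖h s‖ * (1/(z.im/2)^2)) (s := ball z (z.im/2)) (ball_mem_nhds z (by linarith)) ?_ (FH_integrable hh z hz) ?_ ?_ ?_ ?_).2.differentiableAt
  · exact Eventually.of_forall fun w => (by fun_prop : Measurable (fun s : ℝ => (h s : ℂ) * (Complex.I / (w - s)))).aestronglyMeasurable
  · exact (by fun_prop : Measurable (fun s : ℝ => (h s : ℂ) * (-Complex.I / (z - s)^2))).aestronglyMeasurable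
  · refine Eventually.of_forall fun s w hw => ?_
    rw [norm_mul, norm_div, norm_neg, Complex.norm_I, Complex.norm_real, norm_pow]
    have h1 := hball w hw
    gcongr
    exact h1.trans (z_sub_norm w (by linarith) s)
  · exact hh.integrable.norm.mul_const _
  · refine Eventually.of_forall fun s w hw => ?_
    have h1 := hball w hw
    have hne : w - s ≠ 0 := by
      intro h0
      have := z_sub_norm w (by linarith) s
      rw [h0, norm_zero] at this
      linarith
    have := (((hasDerivAt_id w).sub_const (s:ℂ)).inv hne).const_mul ((h s:ℂ) * Complex.I)
    refine (this.congr_of_eventuallyEq (Eventually.of_forall fun y => ?_)).congr_deriv ?_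
    · simp only [Pi.inv_apply, id, div_eq_mul_inv]; ring
    · symm
      change _ = ↑(h s) * Complex.I * (-1 / (w - ↑s) ^ 2); ring

lemma FH_decay {h : ℝ → ℝ} (hh : BC h) (t : ℝ) (ht : 0 < t) : ∃ C, 0 ≤ C ∧ ∀ z : ℂ, t ≤ z.im → ‖FH h z‖ ≤ C * (1 + ‖z‖)⁻¹ := by
  obtain ⟨hm, B, hB, R, hR, hs⟩ := id hh
  set N := ∫ s, ‖h s‖ with hN
  have hN0 : 0 ≤ N := by positivity
  set c := t / (1 + t + R) with hc
  have hc0 : 0 < c := by positivity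
  have key : ∀ z : ℂ, t ≤ z.im → ∀ s : ℝ, |s| ≤ R → c * (1 + ‖z‖) ≤ ‖z - s‖ := by
    intro z hz s hs
    have h1 := z_sub_norm z (by linarith) s
    have h2 : ‖z‖ ≤ ‖z - s‖ + R := by
      calc ‖z‖ = ‖(z - s) + s‖ := by ring_nf
        _ ≤ ‖z - s‖ + ‖(s:ℂ)‖ := norm_add_le _ _
        _ ≤ _ := by rw [Complex.norm_real]; gcongr; exact hs
    rw [hc, div_mul_eq_mul_div, div_le_iff₀ (by positivity)]
    nlinarith
  refine ⟨N / c, by positivity, fun z hz => ?_⟩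
  calc ‖FH h z‖ ≤ ∫ s, ‖h s‖ * (1/(c * (1 + ‖z‖))) := by
        refine norm_integral_le_of_norm_le (hh.integrable.norm.mul_const _) (Eventually.of_forall fun s => ?_)
        rw [norm_mul, norm_div, Complex.norm_I, Complex.norm_real]
        by_cases hsR : |s| ≤ R
        · gcongr
          exact key z hz s hsR
        · rw [hs s (not_le.1 hsR)]; simp
    _ = _ := by
      rw [integral_mul_const, ← hN]
      field_simp

def QH (h : ℝ → ℝ) (t x : ℝ) : ℝ := ∫ s, h s * ((x - s) / ((x-s)^2 + t^2))
def PH (h : ℝ → ℝ) (t x : ℝ) : ℝ := ∫ s, h s * (t / ((x-s)^2 + t^2))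

lemma kern_eq (x t s : ℝ) (ht : 0 < t) : Complex.I / ((x:ℂ) + t * Complex.I - s) = (t / ((x-s)^2 + t^2) : ℝ) + ((x - s) / ((x-s)^2 + t^2) : ℝ) * Complex.I := by
  have h1 : ((x:ℂ) + t * Complex.I - s) ≠ 0 := by
    intro h
    have := congrArg Complex.im h
    simp at this
    linarith
  have h2 : (((x-s)^2 + t^2 : ℝ) : ℂ) ≠ 0 := by
    have : (0:ℝ) < (x-s)^2 + t^2 := by positivity
    exact_mod_cast this.ne'
  rw [div_eq_iff h1]
  push_cast at h2 ⊢
  field_simp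
  ring_nf
  simp
  ring

lemma FH_re {h : ℝ → ℝ} (hh : BC h) (t x : ℝ) (ht : 0 < t) : (FH h (x + t * Complex.I)).re = PH h t x := by
  have hi := FH_integrable hh (x + t * Complex.I) (by simpa using ht)
  unfold FH PH
  rw [show (∫ s : ℝ, (h s : ℂ) * (Complex.I / ((x + t * Complex.I) - s))).re = RCLike.re (∫ s : ℝ, (h s : ℂ) * (Complex.I / ((x + t * Complex.I) - s))) from rfl, ← integral_re hi]
  congr 1; ext s
  rw [kern_eq x t s ht]
  generalize t / ((x-s)^2 + t^2) = a
  generalize (x-s) / ((x-s)^2 + t^2) = b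
  simp

lemma FH_im {h : ℝ → ℝ} (hh : BC h) (t x : ℝ) (ht : 0 < t) : (FH h (x + t * Complex.I)).im = QH h t x := by
  have hi := FH_integrable hh (x + t * Complex.I) (by simpa using ht)
  unfold FH QH
  rw [show (∫ s : ℝ, (h s : ℂ) * (Complex.I / ((x + t * Complex.I) - s))).im = RCLike.im (∫ s : ℝ, (h s : ℂ) * (Complex.I / ((x + t * Complex.I) - s))) from rfl, ← integral_im hi]
  congr 1; ext s
  rw [kern_eq x t s ht]
  generalize t / ((x-s)^2 + t^2) = a
  generalize (x-s) / ((x-s)^2 + t^2) = b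
  simp

lemma cpow_ineq (p : ℝ) (hp : 1 < p) (hp2 : p ≤ 2) : ∃ A B : ℝ, 0 ≤ A ∧ 0 ≤ B ∧ ∀ w : ℂ, 0 < w.re →
    |w.im| ^ p ≤ A * w.re ^ p - B * (w ^ (p:ℂ)).re := by
  set θ0 := (π/2) * (1 + 1/p) / 2 with hθ0
  have hπ := Real.pi_pos
  have hp0 : 0 < p := by linarith
  have h1p : 1/p < 1 := by rw [div_lt_one hp0]; exact hp
  have h1p' : 0 < 1/p := by positivity
  have hlt : θ0 < π/2 := by rw [hθ0]; nlinarith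
  have h0 : 0 < θ0 := by positivity
  have hpθ : p * θ0 = (π/4) * (p + 1) := by rw [hθ0]; field_simp; ring
  set b := - Real.cos (p * θ0) with hb
  have hb0 : 0 < b := by
    rw [hb, neg_pos]
    apply Real.cos_neg_of_pi_div_two_lt_of_lt
    · rw [hpθ]; nlinarith
    · rw [hpθ]; nlinarith
  have hc0 : 0 < Real.cos θ0 := Real.cos_pos_of_mem_Ioo ⟨by linarith, hlt⟩
  refine ⟨(1 + 1/b) / (Real.cos θ0) ^ p, 1/b, by positivity, by positivity, ?_⟩
  intro w hw
  have harg : |w.arg| < π/2 := Complex.abs_arg_lt_pi_div_two_iff.2 (Or.inl hw)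
  have hn : 0 < ‖w‖ := by
    rw [norm_pos_iff]; rintro rfl; simp at hw
  have hcos : 0 < Real.cos w.arg := by
    apply Real.cos_pos_of_mem_Ioo
    exact abs_lt.1 harg
  have e1 : w.re = ‖w‖ * Real.cos w.arg := (Complex.norm_mul_cos_arg w).symm
  have e2 : w.im = ‖w‖ * Real.sin w.arg := (Complex.norm_mul_sin_arg w).symm
  rw [Complex.cpow_ofReal_re]
  conv_lhs => rw [e2]
  rw [e1, abs_mul, abs_of_pos hn, Real.mul_rpow hn.le (abs_nonneg _), Real.mul_rpow hn.le hcos.le]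
  have hnp : 0 < ‖w‖ ^ p := by positivity
  suffices hS : |Real.sin w.arg| ^ p ≤ (1 + 1/b) / (Real.cos θ0) ^ p * (Real.cos w.arg)^p - 1/b * Real.cos (w.arg * p) by
    calc _ ≤ ‖w‖ ^ p * ((1 + 1/b) / (Real.cos θ0) ^ p * (Real.cos w.arg)^p - 1/b * Real.cos (w.arg * p)) := by gcongr
      _ = _ := by ring
  have hs1 : |Real.sin w.arg| ^ p ≤ 1 := Real.rpow_le_one (abs_nonneg _) (Real.abs_sin_le_one _) hp0.le
  have ecos : Real.cos (w.arg * p) = Real.cos (p * |w.arg|) := by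
    rw [← Real.cos_abs (w.arg * p), abs_mul, abs_of_pos hp0, mul_comm]
  have ecos2 : Real.cos (w.arg) = Real.cos (|w.arg|) := (Real.cos_abs _).symm
  rcases le_or_gt θ0 |w.arg| with hc | hc
  · have : Real.cos (p * |w.arg|) ≤ Real.cos (p * θ0) := by
      apply Real.cos_le_cos_of_nonneg_of_le_pi
      · positivity
      · nlinarith
      · gcongr
    have h2 : 1 ≤ - (1/b * Real.cos (w.arg * p)) := by
      rw [ecos]
      have : Real.cos (p * |w.arg|) ≤ -b := by rw [hb]; linarith
      have : 1/b * Real.cos (p * |w.arg|) ≤ 1/b * (-b) := by gcongr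
      have e : 1/b * (-b) = -1 := by field_simp
      linarith
    have h3 : 0 ≤ (1 + 1/b) / (Real.cos θ0) ^ p * (Real.cos w.arg)^p := by positivity
    linarith
  · have h4 : Real.cos θ0 ≤ Real.cos w.arg := by
      rw [ecos2]
      apply Real.cos_le_cos_of_nonneg_of_le_pi (abs_nonneg _) (by linarith) hc.le
    have h5 : (1 + 1/b) ≤ (1 + 1/b) / (Real.cos θ0) ^ p * (Real.cos w.arg)^p := by
      rw [div_mul_eq_mul_div, le_div_iff₀ (by positivity)]
      gcongr
    have h6 : 1/b * Real.cos (w.arg * p) ≤ 1/b := by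
      have := Real.cos_le_one (w.arg * p)
      have : 1/b * Real.cos (w.arg * p) ≤ 1/b * 1 := by gcongr
      linarith
    linarith

lemma pk1_bound (t a : ℝ) (ht : 0 < t) : t / (a^2 + t^2) ≤ 2 * pk 1 t |a| := by
  unfold pk
  rw [← mul_div_assoc, div_le_div_iff₀ (by positivity) (by positivity)]
  have : (t + |a|)^2 ≤ 2 * (a^2 + t^2) := by
    have := sq_abs a
    nlinarith [sq_nonneg (t - |a|)]
  have h2 := mul_le_mul_of_nonneg_left this ht.le
  norm_num
  linarith

lemma PK_HM : ∃ C : ℝ≥0∞, C ≠ ∞ ∧ ∀ (h : ℝ → ℝ≥0∞) (t x : ℝ), AEMeasurable h → 0 < t →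
   ∫⁻ s, h s * oR (t / ((x-s)^2+t^2)) ≤ C * HM h x volume := by
  refine ⟨2 * ((2^(1+1) * volume (ball (0:ℝ) 1)) * 2), ENNReal.mul_ne_top (by norm_num) (pk_const_ne_top volume 1), ?_⟩
  intro h t x hh ht
  calc _ ≤ ∫⁻ s, 2 * (oR (pk 1 t ‖x - s‖) * h s) := by
        apply lintegral_mono
        intro s
        simp only
        rw [mul_comm, ← mul_assoc]
        gcongr
        rw [← ENNReal.ofReal_ofNat, ← ENNReal.ofReal_mul (by norm_num)]
        apply ENNReal.ofReal_le_ofReal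
        exact pk1_bound t (x-s) ht
    _ = 2 * ∫⁻ s, (oR (pk 1 t ‖x - s‖) * h s) := lintegral_const_mul' _ _ (by norm_num)
    _ ≤ _ := by
      rw [mul_assoc 2]
      gcongr
      exact pk_HM_le volume (by simp) ht x h hh

lemma ofReal_PH_le (h : ℝ → ℝ) (t x : ℝ) (ht : 0 < t) : ‖PH h t x‖ₑ ≤ ∫⁻ s, ‖h s‖ₑ * oR (t / ((x-s)^2+t^2)) := by
  unfold PH
  refine (enorm_integral_le_lintegral_enorm _).trans (le_of_eq ?_)
  congr 1; ext s
  rw [enorm_mul]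
  congr 1
  rw [Real.enorm_eq_ofReal (by positivity)]

lemma PH_strong (p : ℝ) (hp : 1 < p) : ∃ C : ℝ≥0∞, C ≠ ∞ ∧ ∀ (h : ℝ → ℝ) (t : ℝ), Measurable h → 0 < t →
   ∫⁻ x, ‖PH h t x‖ₑ ^ p ≤ C * ∫⁻ x, ‖h x‖ₑ ^ p := by
  obtain ⟨C1, hC1, h1⟩ := PK_HM
  obtain ⟨C2, hC2, h2⟩ := HM_strong (volume : Measure ℝ) p hp
  refine ⟨C1 ^ p * C2, ENNReal.mul_ne_top (ENNReal.rpow_ne_top_of_nonneg (by linarith) hC1) hC2, ?_⟩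
  intro h t hm ht
  calc _ ≤ ∫⁻ x, C1 ^ p * (HM (fun s => ‖h s‖ₑ) x volume) ^ p := by
        apply lintegral_mono; intro x; simp only
        rw [← ENNReal.mul_rpow_of_nonneg _ _ (by linarith)]
        gcongr
        exact (ofReal_PH_le h t x ht).trans (h1 _ t x hm.enorm.aemeasurable ht)
    _ = C1 ^ p * ∫⁻ x, (HM (fun s => ‖h s‖ₑ) x volume) ^ p := lintegral_const_mul' _ _ (ENNReal.rpow_ne_top_of_nonneg (by linarith) hC1)
    _ ≤ _ := by
      rw [mul_assoc]
      gcongr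
      exact h2 _ hm.enorm.aemeasurable

lemma FH_line_int {h : ℝ → ℝ} (hh : BC h) (t : ℝ) (ht : 0 < t) (p : ℝ) (hp : 1 < p) (f : ℝ → ℝ) (hf : ∀ x, |f x| ≤ ‖FH h (x + t * Complex.I)‖) (hfm : Measurable f) :
   Integrable (fun x => |f x| ^ p) := by
  obtain ⟨C, hC, hb⟩ := FH_decay hh t ht
  refine Integrable.mono' ((integrable_decay hp).const_mul (C^p)) (hfm.abs.pow_const p).aestronglyMeasurable (Eventually.of_forall fun x => ?_)
  rw [Real.norm_eq_abs, abs_of_nonneg (by positivity)]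
  have h1 := hb (x + t * Complex.I) (by simp)
  have h2 : |f x| ≤ C * (1 + ‖x‖)⁻¹ := by
    refine (hf x).trans (h1.trans ?_)
    gcongr
    exact abs_re_line x t
  calc _ ≤ (C * (1 + ‖x‖)⁻¹) ^ p := by gcongr
    _ = _ := by
      rw [Real.mul_rpow hC (by positivity), Real.rpow_neg (by positivity), Real.inv_rpow (by positivity)]

lemma FH_line_cont {h : ℝ → ℝ} (hh : BC h) (t : ℝ) (ht : 0 < t) : Continuous (fun x : ℝ => FH h (x + t * Complex.I)) := by
  rw [← continuousOn_univ]
  refine (FH_diff hh).continuousOn.comp (by fun_prop) ?_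
  intro x _
  simpa using ht

lemma QH_cont {h : ℝ → ℝ} (hh : BC h) (t : ℝ) (ht : 0 < t) : Continuous (fun x : ℝ => QH h t x) := by
  simp_rw [← fun x => FH_im hh t x ht]
  exact Complex.continuous_im.comp (FH_line_cont hh t ht)

lemma PH_cont {h : ℝ → ℝ} (hh : BC h) (t : ℝ) (ht : 0 < t) : Continuous (fun x : ℝ => PH h t x) := by
  simp_rw [← fun x => FH_re hh t x ht]
  exact Complex.continuous_re.comp (FH_line_cont hh t ht)

lemma QH_pow_int {h : ℝ → ℝ} (hh : BC h) (t : ℝ) (ht : 0 < t) (p : ℝ) (hp : 1 < p) : Integrable (fun x => |QH h t x| ^ p) := by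
  apply FH_line_int hh t ht p hp _ _ (QH_cont hh t ht).measurable
  intro x
  rw [← FH_im hh t x ht]
  exact Complex.abs_im_le_norm _

lemma PH_pow_int {h : ℝ → ℝ} (hh : BC h) (t : ℝ) (ht : 0 < t) (p : ℝ) (hp : 1 < p) : Integrable (fun x => |PH h t x| ^ p) := by
  apply FH_line_int hh t ht p hp _ _ (PH_cont hh t ht).measurable
  intro x
  rw [← FH_re hh t x ht]
  exact Complex.abs_re_le_norm _

lemma PK_integrable {h : ℝ → ℝ} (hh : BC h) (t x : ℝ) (ht : 0 < t) : Integrable (fun s => h s * (t / ((x-s)^2 + t^2))) := by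
  have := (FH_integrable hh (x + t * Complex.I) (by simpa using ht)).re
  convert this using 2 with s
  rw [kern_eq x t s ht]
  generalize t / ((x-s)^2 + t^2) = a
  generalize (x-s) / ((x-s)^2 + t^2) = b
  simp

lemma PH_pos {h : ℝ → ℝ} (hh : BC h) (h0 : ∀ s, 0 ≤ h s) (hne : ¬ (h =ᵐ[volume] 0)) (t x : ℝ) (ht : 0 < t) : 0 < PH h t x := by
  unfold PH
  rw [integral_pos_iff_support_of_nonneg (fun s => mul_nonneg (h0 s) (by positivity)) (PK_integrable hh t x ht)]
  have : Function.support (fun s => h s * (t / ((x-s)^2 + t^2))) = Function.support h := by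
    ext s
    have : t / ((x-s)^2 + t^2) ≠ 0 := by positivity
    rw [Function.mem_support, Function.mem_support]
    exact ⟨fun h h' => h (by rw [h', zero_mul]), fun h => mul_ne_zero h this⟩
  rw [this, pos_iff_ne_zero]
  intro hc
  apply hne
  exact measure_eq_zero_iff_ae_notMem.1 hc |>.mono (fun s hs => by simpa using hs)

lemma QH_nonneg_le (p : ℝ) (hp : 1 < p) (hp2 : p ≤ 2) : ∃ A : ℝ, 0 ≤ A ∧ ∀ (h : ℝ → ℝ) (t : ℝ), BC h → (∀ s, 0 ≤ h s) → 0 < t →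
    ∫ x, |QH h t x| ^ p ≤ A * ∫ x, |PH h t x| ^ p := by
  obtain ⟨A, B, hA, hB, hAB⟩ := cpow_ineq p hp hp2
  refine ⟨A, hA, ?_⟩
  intro h t hh h0 ht
  by_cases hne : h =ᵐ[volume] 0
  · have : ∀ x, QH h t x = 0 := by
      intro x
      unfold QH
      apply integral_eq_zero_of_ae
      filter_upwards [hne] with s hs
      simp [hs]
    simp_rw [this]
    rw [abs_zero, Real.zero_rpow (by linarith)]
    simp only [integral_zero]
    positivity
  have hpos : ∀ z : ℂ, 0 < z.im → 0 < (FH h z).re := by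
    intro z hz
    have := FH_re hh z.im z.re hz
    rw [Complex.re_add_im] at this
    rw [this]
    exact PH_pos hh h0 hne _ _ hz
  set G : ℂ → ℂ := fun z => (FH h z) ^ (p:ℂ) with hG
  have hGd : DifferentiableOn ℂ G {z | 0 < z.im} := by
    apply (FH_diff hh).cpow_const
    intro z hz
    exact Or.inl (hpos z hz)
  obtain ⟨C, hC, hb⟩ := FH_decay hh t ht
  have hGb : ∀ z : ℂ, t ≤ z.im → ‖G z‖ ≤ C^p * (1 + ‖z‖) ^ (-p) := by
    intro z hz
    rw [hG]; simp only
    have hnz : FH h z ≠ 0 := by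
      intro hc
      have := hpos z (by linarith)
      rw [hc] at this; simp at this
    rw [Complex.norm_cpow_real]
    calc _ ≤ (C * (1 + ‖z‖)⁻¹) ^ p := by gcongr; exact hb z hz
      _ = _ := by
        rw [Real.mul_rpow hC (by positivity), Real.rpow_neg (by positivity), Real.inv_rpow (by positivity)]
  have hz := cauchy_line G t ht hGd p _ hp (by positivity) hGb
  have hi := line_integrable G t ht hGd p _ hp (by positivity) hGb
  have hre : ∫ x : ℝ, (G (x + t * Complex.I)).re = 0 := by
    have := integral_re hi
    rw [hz] at this
    simpa using this
  have hire : Integrable (fun x:ℝ => (G (x + t*Complex.I)).re) := hi.re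
  calc _ ≤ ∫ x : ℝ, (A * |PH h t x| ^ p - B * (G (x + t * Complex.I)).re) := by
        apply integral_mono (QH_pow_int hh t ht p hp)
        · exact ((PH_pow_int hh t ht p hp).const_mul A).sub (hire.const_mul B)
        intro x
        have := hAB (FH h (x + t * Complex.I)) (hpos _ (by simpa using ht))
        rw [FH_re hh t x ht, FH_im hh t x ht] at this
        simp only
        rw [abs_of_pos (PH_pos hh h0 hne t x ht)]
        exact this
    _ = _ := by
      rw [integral_sub ((PH_pow_int hh t ht p hp).const_mul A) (hire.const_mul B), integral_const_mul, integral_const_mul, hre]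
      ring

lemma lint_abs_pow (f : ℝ → ℝ) (p : ℝ) (hp : 1 < p) (hf : Integrable (fun x => |f x| ^ p)) : ∫⁻ x, ‖f x‖ₑ ^ p = oR (∫ x, |f x| ^ p) := by
  rw [ofReal_integral_eq_lintegral_ofReal hf (Eventually.of_forall fun x => by positivity)]
  congr 1; ext x
  rw [Real.enorm_eq_ofReal_abs, ENNReal.ofReal_rpow_of_nonneg (abs_nonneg _) (by linarith)]

lemma BC_pos {h : ℝ → ℝ} (hh : BC h) : BC (fun s => max (h s) 0) := by
  obtain ⟨hm, B, hB, R, hR, hs⟩ := hh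
  refine ⟨by fun_prop, B, fun s => ?_, R, hR, fun s hsr => by simp [hs s hsr]⟩
  have := hB s
  rw [abs_le] at this ⊢
  have hB0 : 0 ≤ B := by linarith
  constructor
  · have := le_max_right (h s) 0; linarith
  · exact max_le this.2 hB0

lemma BC_neg {h : ℝ → ℝ} (hh : BC h) : BC (fun s => - h s) := by
  obtain ⟨hm, B, hB, R, hR, hs⟩ := hh
  exact ⟨by fun_prop, B, fun s => by rw [abs_neg]; exact hB s, R, hR, fun s hsr => by simp [hs s hsr]⟩

lemma QK_integrable {h : ℝ → ℝ} (hh : BC h) (t x : ℝ) (ht : 0 < t) : Integrable (fun s => h s * ((x-s) / ((x-s)^2 + t^2))) := by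
  have := (FH_integrable hh (x + t * Complex.I) (by simpa using ht)).im
  convert this using 2 with s
  rw [kern_eq x t s ht]
  generalize t / ((x-s)^2 + t^2) = a
  generalize (x-s) / ((x-s)^2 + t^2) = b
  simp

lemma QH_strong_le2 (p : ℝ) (hp : 1 < p) (hp2 : p ≤ 2) : ∃ C : ℝ≥0∞, C ≠ ∞ ∧ ∀ (h : ℝ → ℝ) (t : ℝ), BC h → 0 < t →
    ∫⁻ x, ‖QH h t x‖ₑ ^ p ≤ C * ∫⁻ x, ‖h x‖ₑ ^ p := by
  obtain ⟨A, hA, h1⟩ := QH_nonneg_le p hp hp2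
  obtain ⟨C, hC, h2⟩ := PH_strong p hp
  have hnn : ∀ (h : ℝ → ℝ) (t : ℝ), BC h → (∀ s, 0 ≤ h s) → 0 < t →
    ∫⁻ x, ‖QH h t x‖ₑ ^ p ≤ oR A * (C * ∫⁻ x, ‖h x‖ₑ ^ p) := by
    intro h t hh h0 ht
    refine le_trans ?_ (mul_le_mul_right (h2 h t hh.1 ht) _)
    rw [lint_abs_pow _ p hp (QH_pow_int hh t ht p hp), lint_abs_pow _ p hp (PH_pow_int hh t ht p hp), ← ENNReal.ofReal_mul hA]
    exact ENNReal.ofReal_le_ofReal (h1 h t hh h0 ht)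
  refine ⟨2^(p-1) * (oR A * C + oR A * C), ?_, ?_⟩
  · exact ENNReal.mul_ne_top (ENNReal.rpow_ne_top_of_nonneg (by linarith) (by norm_num)) (ENNReal.add_ne_top.2 ⟨ENNReal.mul_ne_top ENNReal.ofReal_ne_top hC, ENNReal.mul_ne_top ENNReal.ofReal_ne_top hC⟩)
  intro h t hh ht
  have hp' := BC_pos hh
  have hn' := BC_pos (BC_neg hh)
  have hsplit : ∀ x, QH h t x = QH (fun s => max (h s) 0) t x - QH (fun s => max (-h s) 0) t x := by
    intro x
    unfold QH
    rw [← integral_sub (QK_integrable hp' t x ht) (QK_integrable hn' t x ht)]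
    congr 1; ext s
    rw [← sub_mul]
    congr 1
    rcases le_total 0 (h s) with h' | h'
    · rw [max_eq_left h', max_eq_right (by linarith)]; ring
    · rw [max_eq_right h', max_eq_left (by linarith)]; ring
  have e1 : ∫⁻ x, ‖max (h x) 0‖ₑ ^ p ≤ ∫⁻ x, ‖h x‖ₑ ^ p := by
    gcongr with x
    rw [enorm_le_iff_norm_le, Real.norm_eq_abs, Real.norm_eq_abs, abs_of_nonneg (le_max_right _ _)]
    exact max_le (le_abs_self _) (abs_nonneg _)
  have e2 : ∫⁻ x, ‖max (-h x) 0‖ₑ ^ p ≤ ∫⁻ x, ‖h x‖ₑ ^ p := by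
    gcongr with x
    rw [enorm_le_iff_norm_le, Real.norm_eq_abs, Real.norm_eq_abs, abs_of_nonneg (le_max_right _ _)]
    exact max_le (neg_le_abs _) (abs_nonneg _)
  calc _ ≤ ∫⁻ x, 2^(p-1) * (‖QH (fun s => max (h s) 0) t x‖ₑ ^ p + ‖QH (fun s => max (-h s) 0) t x‖ₑ ^ p) := by
        apply lintegral_mono
        intro x
        simp only
        rw [hsplit]
        refine le_trans ?_ (ENNReal.rpow_add_le_mul_rpow_add_rpow _ _ hp.le)
        gcongr
        exact enorm_sub_le
    _ = 2^(p-1) * ((∫⁻ x, ‖QH (fun s => max (h s) 0) t x‖ₑ ^ p) + ∫⁻ x, ‖QH (fun s => max (-h s) 0) t x‖ₑ ^ p) := by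
        rw [lintegral_const_mul', lintegral_add_left]
        · have := (QH_cont hp' t ht).measurable
          fun_prop
        · exact (ENNReal.rpow_ne_top_of_nonneg (by linarith) (by norm_num))
    _ ≤ 2^(p-1) * (oR A * (C * ∫⁻ x, ‖h x‖ₑ ^ p) + oR A * (C * ∫⁻ x, ‖h x‖ₑ ^ p)) := by
        gcongr
        · refine (hnn _ t hp' (fun s => le_max_right _ _) ht).trans ?_
          gcongr
        · refine (hnn _ t hn' (fun s => le_max_right _ _) ht).trans ?_
          gcongr
    _ = _ := by ring

lemma QH_dual {h ψ : ℝ → ℝ} (hh : BC h) (hψ : BC ψ) (t : ℝ) (ht : 0 < t) :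
    ∫ x, QH h t x * ψ x = - ∫ s, h s * QH ψ t s := by
  have hIn : Integrable (fun z : ℝ × ℝ => (ψ z.1 * h z.2) * ((z.1-z.2)/((z.1-z.2)^2+t^2))) (volume.prod volume) := by
    refine (hψ.integrable.mul_prod hh.integrable).mul_bdd (c := 1/t) (Measurable.aestronglyMeasurable (by fun_prop)) (Eventually.of_forall fun z => ?_)
    rw [Real.norm_eq_abs, abs_div, abs_of_pos (by positivity : 0 < (z.1-z.2)^2+t^2), div_le_div_iff₀ (by positivity) ht]
    have := sq_abs (z.1-z.2)
    nlinarith [sq_nonneg (|z.1-z.2| - t), abs_nonneg (z.1-z.2)]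
  have := integral_integral_swap (f := fun x s : ℝ => (ψ x * h s) * ((x-s)/((x-s)^2+t^2))) hIn
  unfold QH
  calc _ = ∫ x, ∫ s, (ψ x * h s) * ((x-s)/((x-s)^2+t^2)) := by
        congr 1; ext x; rw [mul_comm, ← integral_const_mul]; congr 1; ext s; ring
    _ = _ := this
    _ = _ := by
        rw [← integral_neg]
        congr 1; ext s
        rw [← mul_neg, ← integral_neg, ← integral_const_mul]
        congr 1; ext x
        have : (x - s)^2 = (s-x)^2 := by ring
        rw [this]
        ring

lemma QH_strong_gt2 (p : ℝ) (hp2 : 2 < p) : ∃ C : ℝ≥0∞, C ≠ ∞ ∧ ∀ (h : ℝ → ℝ) (t : ℝ), BC h → 0 < t →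
    ∫⁻ x, ‖QH h t x‖ₑ ^ p ≤ C * ∫⁻ x, ‖h x‖ₑ ^ p := by
  have hp : 1 < p := by linarith
  set q := p / (p-1) with hq
  have hpq : p.HolderConjugate q := Real.HolderConjugate.conjExponent hp
  have hq1 : 1 < q := hpq.symm.lt
  have hq0 : 0 < q := by linarith
  have hqp : (p-1)*q = p := by rw [hq]; field_simp [show p - 1 ≠ 0 by linarith]
  have hq2 : q ≤ 2 := by rw [hq, div_le_iff₀ (by linarith)]; linarith
  obtain ⟨C, hC, hCb⟩ := QH_strong_le2 q hq1 hq2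
  refine ⟨C ^ (p/q), ENNReal.rpow_ne_top_of_nonneg (by positivity) hC, ?_⟩
  intro h t hh ht
  set v := QH h t with hv
  have hvc : Continuous v := QH_cont hh t ht
  have key : ∀ N : ℕ, ∫⁻ x in Set.Icc (-(N:ℝ)) N, ‖v x‖ₑ ^ p ≤ C ^ (p/q) * ∫⁻ x, ‖h x‖ₑ ^ p := by
    intro N
    set S := Set.Icc (-(N:ℝ)) N with hS
    have hSm : MeasurableSet S := measurableSet_Icc
    set ψ := S.indicator (fun x => |v x| ^ (p-2) * v x) with hψ
    have hcont : Continuous (fun x => |v x| ^ (p-2) * v x) :=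
      (hvc.abs.rpow_const (fun x => Or.inr (by linarith))).mul hvc
    have hψBC : BC ψ := by
      refine ⟨hcont.measurable.indicator hSm, ?_⟩
      obtain ⟨B, hB⟩ := (isCompact_Icc (a := -(N:ℝ)) (b := N)).exists_bound_of_continuousOn hcont.continuousOn
      refine ⟨max B 0, fun s => ?_, N+1, by positivity, fun s hs => ?_⟩
      · rw [hψ]
        by_cases hs : s ∈ S
        · rw [Set.indicator_of_mem hs]; exact (hB s hs).trans (le_max_left _ _)
        · rw [Set.indicator_of_notMem hs]; simp
      · rw [hψ, Set.indicator_of_notMem]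
        intro hs'
        have := abs_le.2 hs'
        linarith
    have hab : ∀ x, |v x| ^ (p-2) * v x * v x = |v x| ^ p := by
      intro x
      by_cases h0 : v x = 0
      · rw [h0]; simp [Real.zero_rpow (by linarith : p ≠ 0)]
      · have : 0 < |v x| := abs_pos.2 h0
        rw [mul_assoc, ← abs_mul_abs_self, ← pow_two, ← Real.rpow_natCast, ← Real.rpow_add this]; norm_num
    have e1 : ∫⁻ x in S, ‖v x‖ₑ ^ p = oR (∫ x, v x * ψ x) := by
      have : ∀ x, v x * ψ x = S.indicator (fun x => |v x| ^ p) x := by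
        intro x; rw [hψ]
        by_cases hs : x ∈ S
        · rw [Set.indicator_of_mem hs, Set.indicator_of_mem hs, ← hab]; ring
        · simp [Set.indicator_of_notMem hs]
      simp_rw [this]
      rw [integral_indicator hSm, ofReal_integral_eq_lintegral_ofReal (QH_pow_int hh t ht p hp).integrableOn (Eventually.of_forall fun x => by positivity)]
      congr 1; ext x
      rw [Real.enorm_eq_ofReal_abs, ENNReal.ofReal_rpow_of_nonneg (abs_nonneg _) (by linarith)]
    have e2 : ∫⁻ x, ‖ψ x‖ₑ ^ q = ∫⁻ x in S, ‖v x‖ₑ ^ p := by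
      rw [← lintegral_indicator hSm]
      congr 1; ext x
      rw [hψ]
      by_cases hs : x ∈ S
      · rw [Set.indicator_of_mem hs, Set.indicator_of_mem hs]
        by_cases h0 : v x = 0
        · rw [h0]; simp [hq0, (by linarith : 0 < p)]
        · have : 0 < |v x| := abs_pos.2 h0
          rw [Real.enorm_eq_ofReal_abs, Real.enorm_eq_ofReal_abs, abs_mul, abs_of_nonneg (by positivity : 0 ≤ |v x| ^ (p-2)), ENNReal.ofReal_rpow_of_nonneg (by positivity) hq0.le, ENNReal.ofReal_rpow_of_nonneg (by positivity) (by linarith)]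
          congr 1
          nth_rewrite 2 [← Real.rpow_one |v x|]
          rw [← Real.rpow_add this, ← Real.rpow_mul this.le]
          congr 1; linarith
      · simp [Set.indicator_of_notMem hs, hq0]
    set J := ∫⁻ x in S, ‖v x‖ₑ ^ p with hJ
    have hJt : J ≠ ∞ := by rw [e1]; exact ENNReal.ofReal_ne_top
    have e3 : J ≤ (∫⁻ x, ‖h x‖ₑ ^ p) ^ (1/p) * (C * J) ^ (1/q) := by
      calc J = oR (∫ x, v x * ψ x) := e1
        _ ≤ ‖∫ x, v x * ψ x‖ₑ := Real.ofReal_le_enorm _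
        _ = ‖∫ s, h s * QH ψ t s‖ₑ := by rw [hv, QH_dual hh hψBC t ht, enorm_neg]
        _ ≤ ∫⁻ s, ‖h s * QH ψ t s‖ₑ := enorm_integral_le_lintegral_enorm _
        _ = ∫⁻ s, ((fun s => ‖h s‖ₑ) * (fun s => ‖QH ψ t s‖ₑ)) s := by simp [enorm_mul]
        _ ≤ (∫⁻ x, ‖h x‖ₑ ^ p) ^ (1/p) * (∫⁻ x, ‖QH ψ t x‖ₑ ^ q) ^ (1/q) :=
            ENNReal.lintegral_mul_le_Lp_mul_Lq volume hpq hh.1.enorm.aemeasurable (QH_cont hψBC t ht).measurable.enorm.aemeasurable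
        _ ≤ _ := by
          gcongr
          rw [← e2]
          exact hCb ψ t hψBC ht
    by_cases hJ0 : J = 0
    · rw [hJ0]; exact zero_le
    have hJq0 : J ^ (1/q) ≠ 0 := by simp [ENNReal.rpow_eq_zero_iff, hJ0, hJt]
    have hJqt : J ^ (1/q) ≠ ∞ := ENNReal.rpow_ne_top_of_nonneg (by positivity) hJt
    have hsum : 1/p + 1/q = 1 := by simpa using hpq.inv_add_inv_eq_one
    have e4 : J ^ (1/p) ≤ (∫⁻ x, ‖h x‖ₑ ^ p) ^ (1/p) * C ^ (1/q) := by
      rw [← ENNReal.mul_le_mul_iff_left hJq0 hJqt, ← ENNReal.rpow_add _ _ hJ0 hJt, hsum, ENNReal.rpow_one, mul_assoc, ← ENNReal.mul_rpow_of_nonneg _ _ (by positivity)]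
      exact e3
    have e5 := ENNReal.rpow_le_rpow e4 (by linarith : 0 ≤ p)
    rw [ENNReal.mul_rpow_of_nonneg _ _ (by linarith), ← ENNReal.rpow_mul, ← ENNReal.rpow_mul, ← ENNReal.rpow_mul, one_div_mul_cancel (by linarith), ENNReal.rpow_one, ENNReal.rpow_one, mul_comm] at e5
    refine e5.trans (le_of_eq ?_)
    congr 2; ring
  have hcov : AECover (volume : Measure ℝ) atTop (fun N : ℕ => Set.Icc (-(N:ℝ)) N) :=
    aecover_Icc (tendsto_neg_atTop_atBot.comp tendsto_natCast_atTop_atTop) tendsto_natCast_atTop_atTop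
  exact le_of_tendsto' (hcov.lintegral_tendsto_of_nat (hvc.measurable.enorm.pow_const p).aemeasurable) key

lemma QH_strong (p : ℝ) (hp : 1 < p) : ∃ C : ℝ≥0∞, C ≠ ∞ ∧ ∀ (h : ℝ → ℝ) (t : ℝ), BC h → 0 < t →
    ∫⁻ x, ‖QH h t x‖ₑ ^ p ≤ C * ∫⁻ x, ‖h x‖ₑ ^ p := by
  rcases le_or_gt p 2 with h | h
  · exact QH_strong_le2 p hp h
  · exact QH_strong_gt2 p h

lemma lower_K (ε s : ℝ) (hε : 0 < ε) : ∃ K : ℝ, 0 < K ∧ ∀ (z : ℂ) (a : ℝ), ε ≤ z.im → 0 ≤ a → 1 + ‖z‖ ≤ K * ‖z + a * Complex.I - s‖ := by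
  refine ⟨1 + (|s|+1)/ε, by positivity, ?_⟩
  intro z a hz ha
  have h1 : ε ≤ ‖z + a * Complex.I - s‖ := by
    have := z_sub_norm (z + a * Complex.I) (by simp; linarith) s
    simp at this
    linarith
  have h2 : ‖z‖ ≤ ‖z + a * Complex.I‖ := by
    rw [← abs_norm z, ← abs_norm (z + a * Complex.I), ← sq_le_sq, ← Complex.normSq_eq_norm_sq, ← Complex.normSq_eq_norm_sq, Complex.normSq_apply, Complex.normSq_apply]
    simp
    nlinarith
  have h3 : ‖z + a * Complex.I‖ ≤ ‖z + a * Complex.I - s‖ + |s| := by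
    have := norm_add_le (z + a * Complex.I - s) (s:ℂ)
    rw [Complex.norm_real] at this
    simpa using this
  have h4 : (|s|+1) ≤ (|s|+1)/ε * ‖z + a * Complex.I - s‖ := by
    rw [div_mul_eq_mul_div, le_div_iff₀ hε]
    gcongr
  linarith

lemma two_pole (δ τ s x : ℝ) (hδ : 0 < δ) (hτ : 0 < τ) :
    ∫ y : ℝ, 1 / (((y:ℂ) + δ * Complex.I - s) * ((y:ℂ) + τ * Complex.I - x)) = 0 := by
  set ε := min δ τ with hε
  have hε0 : 0 < ε := lt_min hδ hτ
  have h1 : ε ≤ δ := min_le_left _ _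
  have h2 : ε ≤ τ := min_le_right _ _
  obtain ⟨K1, hK1, hb1⟩ := lower_K ε s hε0
  obtain ⟨K2, hK2, hb2⟩ := lower_K ε x hε0
  have hnz : ∀ (z : ℂ) (a b : ℝ), 0 < z.im → 0 ≤ a → z + a * Complex.I - b ≠ 0 := by
    intro z a b hz ha hc
    have := congrArg Complex.im hc
    simp at this
    linarith
  have := cauchy_line (fun z => 1 / ((z + (δ-ε:ℝ) * Complex.I - s) * (z + (τ-ε:ℝ) * Complex.I - x))) ε hε0 ?_ 2 (K1*K2) (by norm_num) (by positivity) ?_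
  · rw [← this]
    congr 1; ext y
    push_cast
    congr 2 <;> ring
  · intro z hz
    have hz : 0 < z.im := hz
    apply DifferentiableAt.differentiableWithinAt
    apply DifferentiableAt.div (by fun_prop) (by fun_prop)
    exact mul_ne_zero (hnz z _ _ hz (by linarith)) (hnz z _ _ hz (by linarith))
  · intro z hz
    have e1 := hb1 z (δ-ε) hz (by linarith)
    have e2 := hb2 z (τ-ε) hz (by linarith)
    have hz0 : 0 < z.im := by linarith
    have n1 := norm_pos_iff.2 (hnz z (δ-ε) s hz0 (by linarith))
    have n2 := norm_pos_iff.2 (hnz z (τ-ε) x hz0 (by linarith))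
    rw [norm_div, norm_one, norm_mul, Real.rpow_neg (by positivity), Real.rpow_two, ← div_eq_mul_inv, div_le_div_iff₀ (by positivity) (by positivity), one_mul]
    calc (1+‖z‖)^2 = (1+‖z‖)*(1+‖z‖) := by ring
      _ ≤ _ * _ := mul_le_mul e1 e2 (by positivity) (by positivity)
      _ = _ := by ring

lemma pois_int (τ x : ℝ) (hτ : 0 < τ) : Integrable (fun s => τ / ((x-s)^2+τ^2)) ∧ ∫ s, τ / ((x-s)^2+τ^2) = π := by
  have e : ∀ s, τ / ((x-s)^2+τ^2) = τ⁻¹ * (fun y : ℝ => (1 + y^2)⁻¹) ((x - s) / τ) := by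
    intro s; simp only; field_simp; ring
  simp_rw [e]
  constructor
  · exact ((integrable_inv_one_add_sq.comp_div hτ.ne').comp_sub_left x).const_mul _
  · rw [integral_const_mul, integral_sub_left_eq_self (fun y => (fun y : ℝ => (1 + y^2)⁻¹) (y / τ)), Measure.integral_comp_div (fun y : ℝ => (1 + y^2)⁻¹) τ, integral_univ_inv_one_add_sq, abs_of_pos hτ, smul_eq_mul]
    field_simp

lemma pois_kernel (δ τ s x : ℝ) (hδ : 0 < δ) (hτ : 0 < τ) :
    ∫ y : ℝ, ((τ / ((x-y)^2+τ^2) : ℝ) : ℂ) * (Complex.I / ((y:ℂ) + δ * Complex.I - s)) = π * (Complex.I / ((x:ℂ) + (τ+δ:ℝ) * Complex.I - s)) := by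
  have hnz : ∀ (y a b : ℝ), a ≠ 0 → (y:ℂ) + a * Complex.I - b ≠ 0 := by
    intro y a b ha hc
    have := congrArg Complex.im hc
    simp at this
    exact ha this
  have key : ∀ y : ℝ, ((τ / ((x-y)^2+τ^2) : ℝ) : ℂ) * (Complex.I / ((y:ℂ) + δ * Complex.I - s)) = ((τ / ((x-y)^2+τ^2) : ℝ) : ℂ) * (Complex.I / ((x:ℂ) + (τ+δ:ℝ) * Complex.I - s)) + (- τ * Complex.I / ((x:ℂ) + (τ+δ:ℝ) * Complex.I - s)) * (1 / (((y:ℂ) + δ * Complex.I - s) * ((y:ℂ) + τ * Complex.I - x))) := by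
    intro y
    have n1 := hnz y δ s hδ.ne'
    have n2 := hnz y τ x hτ.ne'
    have n3 := hnz x (τ+δ) s (by positivity)
    have n4 : (y:ℂ) - τ * Complex.I - x ≠ 0 := by
      have := hnz y (-τ) x (by linarith)
      push_cast at this
      convert this using 2
      ring
    have e : (((x-y)^2+τ^2 : ℝ) : ℂ) = ((y:ℂ) + τ * Complex.I - x) * ((y:ℂ) - τ * Complex.I - x) := by
      push_cast
      ring_nf
      rw [Complex.I_sq]; ring
    rw [Complex.ofReal_div, e]
    push_cast at n3
    rw [div_mul_div_comm, div_mul_div_comm, div_mul_div_comm, div_add_div _ _ (by simp [n2, n3, n4]) (by simp [n1, n2, n3]), div_eq_div_iff (by simp [n1,n2,n4]) (by simp [n1,n2,n3,n4])]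
    push_cast
    ring
  simp_rw [key]
  have hi2 : Integrable (fun y : ℝ => (1 / (((y:ℂ) + δ * Complex.I - s) * ((y:ℂ) + τ * Complex.I - x)))) := by
    by_contra hc
    obtain ⟨K1, hK1, hb1⟩ := lower_K (min δ τ) s (lt_min hδ hτ)
    obtain ⟨K2, hK2, hb2⟩ := lower_K (min δ τ) x (lt_min hδ hτ)
    apply hc
    refine Integrable.mono' ((integrable_decay (p := 2) (by norm_num)).const_mul (K1*K2)) (Measurable.aestronglyMeasurable (by fun_prop)) (Eventually.of_forall fun y => ?_)
    have b1 := hb1 (y + (min δ τ:ℝ) * Complex.I) (δ - min δ τ) (by simp) (by linarith [min_le_left δ τ])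
    have b2 := hb2 (y + (min δ τ:ℝ) * Complex.I) (τ - min δ τ) (by simp) (by linarith [min_le_right δ τ])
    have e1 : (y:ℂ) + (min δ τ:ℝ) * Complex.I + (δ - min δ τ:ℝ) * Complex.I - s = y + δ * Complex.I - s := by push_cast; ring
    have e2 : (y:ℂ) + (min δ τ:ℝ) * Complex.I + (τ - min δ τ:ℝ) * Complex.I - x = y + τ * Complex.I - x := by push_cast; ring
    rw [e1] at b1
    rw [e2] at b2
    have hy := abs_re_line y (min δ τ)
    have n1 := norm_pos_iff.2 (hnz y δ s hδ.ne')
    have n2 := norm_pos_iff.2 (hnz y τ x hτ.ne')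
    rw [norm_div, norm_one, norm_mul, Real.rpow_neg (by positivity), Real.rpow_two, ← div_eq_mul_inv, div_le_div_iff₀ (by positivity) (by positivity), one_mul]
    calc (1+‖y‖)^2 = (1+‖y‖)*(1+‖y‖) := by ring
      _ ≤ (K1 * ‖(y:ℂ) + δ * Complex.I - s‖) * (K2 * ‖(y:ℂ) + τ * Complex.I - x‖) := mul_le_mul (by linarith) (by linarith) (by positivity) (by positivity)
      _ = _ := by ring
  have hi1 : Integrable (fun y : ℝ => ((τ / ((x-y)^2+τ^2) : ℝ) : ℂ)) := (pois_int τ x hτ).1.ofReal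
  rw [integral_add (hi1.mul_const _) (hi2.const_mul _), integral_mul_const, integral_const_mul, two_pole δ τ s x hδ hτ, mul_zero, add_zero]
  congr 1
  have := integral_ofReal (𝕜 := ℂ) (μ := volume) (f := fun y => τ / ((x-y)^2+τ^2))
  rw [(pois_int τ x hτ).2] at this
  exact this

lemma QH_semi {h : ℝ → ℝ} (hh : BC h) (δ τ x : ℝ) (hδ : 0 < δ) (hτ : 0 < τ) :
    ∫ y : ℝ, ((τ / ((x-y)^2+τ^2) : ℝ) : ℂ) * FH h (y + δ * Complex.I) = π * FH h (x + (τ+δ:ℝ) * Complex.I) := by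
  unfold FH
  have hIn : Integrable (fun z : ℝ × ℝ => (((τ / ((x-z.1)^2+τ^2) : ℝ) : ℂ) * (h z.2 : ℂ)) * (Complex.I / ((z.1:ℂ) + δ * Complex.I - z.2))) (volume.prod volume) := by
    refine ((pois_int τ x hτ).1.ofReal.mul_prod hh.integrable.ofReal).mul_bdd (c := 1/δ) (Measurable.aestronglyMeasurable (by fun_prop)) (Eventually.of_forall fun z => ?_)
    rw [norm_div, Complex.norm_I]
    gcongr
    have := z_sub_norm (z.1 + δ * Complex.I) (by simpa using hδ) z.2
    simpa using this
  calc _ = ∫ y : ℝ, ∫ s : ℝ, (((τ / ((x-y)^2+τ^2) : ℝ) : ℂ) * (h s : ℂ)) * (Complex.I / ((y:ℂ) + δ * Complex.I - s)) := by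
        congr 1; ext y; rw [← integral_const_mul]; congr 1; ext s; ring
    _ = _ := integral_integral_swap (f := fun y s : ℝ => (((τ / ((x-y)^2+τ^2) : ℝ) : ℂ) * (h s : ℂ)) * (Complex.I / ((y:ℂ) + δ * Complex.I - s))) hIn
    _ = _ := by
      rw [← integral_const_mul]
      congr 1; ext s
      have := pois_kernel δ τ s x hδ hτ
      calc _ = h s * ∫ y : ℝ, ((τ / ((x-y)^2+τ^2) : ℝ) : ℂ) * (Complex.I / ((y:ℂ) + δ * Complex.I - s)) := by
            rw [← integral_const_mul]; congr 1; ext y; ring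
        _ = _ := by rw [this]; ring

lemma QH_HM : ∃ C : ℝ≥0∞, C ≠ ∞ ∧ ∀ (h : ℝ → ℝ) (δ t x : ℝ), BC h → 0 < δ → δ < t →
    ‖QH h t x‖ₑ ≤ C * HM (fun s => ‖QH h δ s‖ₑ) x volume := by
  obtain ⟨C, hC, hb⟩ := PK_HM
  refine ⟨C, hC, ?_⟩
  intro h δ t x hh hδ ht
  have hτ : 0 < t - δ := by linarith
  have := QH_semi hh δ (t-δ) x hδ hτ
  have hF : Integrable (fun y : ℝ => (((t-δ) / ((x-y)^2+(t-δ)^2) : ℝ) : ℂ) * FH h (y + δ * Complex.I)) := by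
    obtain ⟨B, hB, hBb⟩ := FH_decay hh δ hδ
    refine (pois_int (t-δ) x hτ).1.ofReal.mul_bdd (c := B) (FH_line_cont hh δ hδ).aestronglyMeasurable (Eventually.of_forall fun y => ?_)
    refine (hBb _ (by simp)).trans ?_
    refine mul_le_of_le_one_right hB (inv_le_one_of_one_le₀ ?_)
    linarith [norm_nonneg ((y:ℂ) + δ * Complex.I)]
  have him := integral_im hF
  rw [this] at him
  simp only [sub_add_cancel] at him
  have e1 : π * QH h t x = ∫ y, ((t-δ) / ((x-y)^2+(t-δ)^2)) * QH h δ y := by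
    rw [← FH_im hh t x (by linarith)]
    simp_rw [← fun y => FH_im hh δ y hδ]
    have e2 : (RCLike.im ((π:ℂ) * FH h (x + t * Complex.I))) = π * (FH h (x + t * Complex.I)).im := Complex.im_ofReal_mul _ _
    rw [← e2, ← him]
    congr 1; ext y
    exact Complex.im_ofReal_mul _ _
  calc ‖QH h t x‖ₑ ≤ ‖π * QH h t x‖ₑ := by
        rw [enorm_le_iff_norm_le, norm_mul, Real.norm_of_nonneg Real.pi_pos.le]
        exact le_mul_of_one_le_left (norm_nonneg _) (by linarith [Real.pi_gt_three])
    _ ≤ ∫⁻ y, ‖QH h δ y‖ₑ * oR ((t-δ) / ((x-y)^2+(t-δ)^2)) := by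
        rw [e1]
        refine (enorm_integral_le_lintegral_enorm _).trans (le_of_eq ?_)
        congr 1; ext y
        rw [enorm_mul, mul_comm, Real.enorm_eq_ofReal (r := (t-δ) / ((x-y)^2+(t-δ)^2)) (by positivity)]
    _ ≤ _ := hb _ (t-δ) x (QH_cont hh δ hδ).measurable.enorm.aemeasurable hτ

lemma QH_max (p : ℝ) (hp : 1 < p) : ∃ C : ℝ≥0∞, C ≠ ∞ ∧ ∀ (h : ℝ → ℝ), BC h →
    ∫⁻ x, (⨆ j : ℤ, ‖QH h ((2:ℝ)^j) x‖ₑ) ^ p ≤ C * ∫⁻ x, ‖h x‖ₑ ^ p := by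
  obtain ⟨C1, hC1, h1⟩ := QH_HM
  obtain ⟨C2, hC2, h2⟩ := HM_strong (volume : Measure ℝ) p hp
  obtain ⟨C3, hC3, h3⟩ := QH_strong p hp
  have hp0 : 0 < p := by linarith
  refine ⟨C1 ^ p * (C2 * C3), ENNReal.mul_ne_top (ENNReal.rpow_ne_top_of_nonneg hp0.le hC1) (ENNReal.mul_ne_top hC2 hC3), ?_⟩
  intro h hh
  set S : ℕ → ℝ → ℝ≥0∞ := fun N x => ⨆ j : ℤ, ⨆ _ : -(N:ℤ) ≤ j, ‖QH h ((2:ℝ)^j) x‖ₑ with hS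
  have hSm : ∀ N, Measurable (S N) := by
    intro N
    refine Measurable.iSup fun j => Measurable.iSup fun _ => ?_
    exact (QH_cont hh _ (by positivity)).measurable.enorm
  have hmono : Monotone S := by
    intro a b hab x
    exact iSup_mono fun j => iSup_mono' fun hj => ⟨by omega, le_rfl⟩
  have e : ∀ x, (⨆ j : ℤ, ‖QH h ((2:ℝ)^j) x‖ₑ) ^ p = ⨆ N, (S N x) ^ p := by
    intro x
    have : (⨆ j : ℤ, ‖QH h ((2:ℝ)^j) x‖ₑ) = ⨆ N, S N x := by
      apply le_antisymm
      · refine iSup_le fun j => ?_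
        refine le_iSup_of_le j.natAbs ?_
        exact le_iSup_of_le j (le_iSup_of_le (by omega) le_rfl)
      · exact iSup_le fun N => iSup_le fun j => iSup_le fun _ => le_iSup (fun j : ℤ => ‖QH h ((2:ℝ)^j) x‖ₑ) j
    rw [this]
    exact (ENNReal.orderIsoRpow p hp0).map_iSup _
  simp_rw [e]
  rw [lintegral_iSup (fun N => (hSm N).pow_const p) (fun a b hab x => ENNReal.rpow_le_rpow (hmono hab x) hp0.le)]
  refine iSup_le fun N => ?_
  set δ := (2:ℝ) ^ (-(N:ℤ) - 1) with hδ
  have hδ0 : 0 < δ := by positivity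
  calc ∫⁻ x, (S N x) ^ p ≤ ∫⁻ x, C1 ^ p * (HM (fun s => ‖QH h δ s‖ₑ) x volume) ^ p := by
        apply lintegral_mono; intro x; simp only
        rw [← ENNReal.mul_rpow_of_nonneg _ _ hp0.le]
        gcongr
        refine iSup_le fun j => iSup_le fun hj => ?_
        refine h1 h δ _ x hh hδ0 ?_
        exact zpow_lt_zpow_right₀ (by norm_num) (by omega)
    _ = C1 ^ p * ∫⁻ x, (HM (fun s => ‖QH h δ s‖ₑ) x volume) ^ p := lintegral_const_mul' _ _ (ENNReal.rpow_ne_top_of_nonneg hp0.le hC1)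
    _ ≤ C1 ^ p * (C2 * (C3 * ∫⁻ x, ‖h x‖ₑ ^ p)) := by
      gcongr
      exact (h2 _ (QH_cont hh δ hδ0).measurable.enorm.aemeasurable).trans (by gcongr; exact h3 h δ hh hδ0)
    _ = _ := by ring

def trunc (τ r : ℝ) : ℝ := if τ < |r| then 1 / r else 0

lemma trunc_meas : Measurable (fun q : ℝ × ℝ => trunc q.1 q.2) := by
  unfold trunc
  refine Measurable.ite (measurableSet_lt (by fun_prop) (by fun_prop)) (by fun_prop) (by fun_prop)

lemma trunc_meas' (τ : ℝ) : Measurable (trunc τ) := trunc_meas.comp (by fun_prop : Measurable fun r : ℝ => (τ, r))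

lemma trunc_bound (τ r : ℝ) (hτ : 0 < τ) : |trunc τ r| ≤ 1/τ := by
  unfold trunc
  split_ifs with h
  · rw [abs_div, abs_one]
    gcongr
  · simp; positivity

lemma trunc_diff (τ r : ℝ) (hτ : 0 < τ) : |trunc τ r - r / (r^2 + τ^2)| ≤ τ / (r^2+τ^2) := by
  have h2 : 0 < r^2 + τ^2 := by positivity
  unfold trunc
  split_ifs with h
  · have hr0 : 0 < |r| := hτ.trans h
    have hr : r ≠ 0 := abs_pos.1 hr0
    have : 1 / r - r/(r^2+τ^2) = τ^2 / (r * (r^2+τ^2)) := by field_simp; ring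
    rw [this, abs_div, abs_mul, abs_of_pos h2, abs_of_pos (by positivity : 0 < τ^2), div_le_div_iff₀ (by positivity) h2]
    have : 0 ≤ τ * (r^2+τ^2) := by positivity
    nlinarith
  · rw [zero_sub, abs_neg, abs_div, abs_of_pos h2]
    gcongr
    exact not_lt.1 h

def TH (h : ℝ → ℝ) (τ x : ℝ) : ℝ := ∫ r, h (x - r) * trunc τ r

lemma TH_le {h : ℝ → ℝ} (hh : BC h) (τ x : ℝ) (hτ : 0 < τ) :
    ‖TH h τ x‖ₑ ≤ ‖QH h τ x‖ₑ + ∫⁻ s, ‖h s‖ₑ * oR (τ / ((x-s)^2+τ^2)) := by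
  have e : TH h τ x = ∫ s, h s * trunc τ (x - s) := by
    unfold TH
    rw [← integral_sub_left_eq_self (fun r => h (x - r) * trunc τ r) volume x]
    simp
  have hi : Integrable (fun s => h s * trunc τ (x - s)) := by
    refine hh.integrable.mul_bdd (c := 1/τ) ((trunc_meas' τ).comp (by fun_prop)).aestronglyMeasurable (Eventually.of_forall fun s => trunc_bound τ _ hτ)
  have e2 : TH h τ x = QH h τ x + ∫ s, h s * (trunc τ (x - s) - (x-s)/((x-s)^2+τ^2)) := by
    rw [e]; unfold QH
    rw [← integral_add (QK_integrable hh τ x hτ)]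
    · congr 1; ext s; ring
    · simp_rw [mul_sub]
      exact hi.sub (QK_integrable hh τ x hτ)
  rw [e2]
  refine (enorm_add_le _ _).trans ?_
  gcongr
  refine (enorm_integral_le_lintegral_enorm _).trans ?_
  gcongr with s
  rw [enorm_mul]
  gcongr
  rw [Real.enorm_eq_ofReal_abs]
  exact ENNReal.ofReal_le_ofReal (trunc_diff τ _ hτ)

lemma TH_max (p : ℝ) (hp : 1 < p) : ∃ C : ℝ≥0∞, C ≠ ∞ ∧ ∀ (h : ℝ → ℝ), BC h →
    ∫⁻ x, (⨆ j : ℤ, ‖TH h ((2:ℝ)^j) x‖ₑ) ^ p ≤ C * ∫⁻ x, ‖h x‖ₑ ^ p := by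
  obtain ⟨C1, hC1, h1⟩ := PK_HM
  obtain ⟨C2, hC2, h2⟩ := HM_strong (volume : Measure ℝ) p hp
  obtain ⟨C3, hC3, h3⟩ := QH_max p hp
  have hp0 : 0 < p := by linarith
  have ht : (2:ℝ≥0∞)^(p-1) ≠ ∞ := ENNReal.rpow_ne_top_of_nonneg (by linarith) (by norm_num)
  have hC1p : C1 ^ p ≠ ∞ := ENNReal.rpow_ne_top_of_nonneg hp0.le hC1
  refine ⟨2^(p-1) * (C3 + C1 ^ p * C2), ENNReal.mul_ne_top ht (ENNReal.add_ne_top.2 ⟨hC3, ENNReal.mul_ne_top hC1p hC2⟩), ?_⟩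
  intro h hh
  have hmeas : Measurable (fun x => (⨆ j : ℤ, ‖QH h ((2:ℝ)^j) x‖ₑ) ^ p) :=
    (Measurable.iSup fun j => (QH_cont hh _ (by positivity)).measurable.enorm).pow_const p
  calc _ ≤ ∫⁻ x, 2^(p-1) * ((⨆ j : ℤ, ‖QH h ((2:ℝ)^j) x‖ₑ) ^ p + C1 ^ p * (HM (fun s => ‖h s‖ₑ) x volume) ^ p) := by
        apply lintegral_mono; intro x; simp only
        rw [← ENNReal.mul_rpow_of_nonneg _ _ hp0.le]
        refine le_trans ?_ (ENNReal.rpow_add_le_mul_rpow_add_rpow _ _ hp.le)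
        gcongr
        refine iSup_le fun j => ?_
        refine (TH_le hh _ x (by positivity)).trans ?_
        gcongr
        · exact le_iSup (fun j : ℤ => ‖QH h ((2:ℝ)^j) x‖ₑ) j
        · exact h1 _ _ x hh.1.enorm.aemeasurable (by positivity)
    _ = 2^(p-1) * ((∫⁻ x, (⨆ j : ℤ, ‖QH h ((2:ℝ)^j) x‖ₑ) ^ p) + C1 ^ p * ∫⁻ x, (HM (fun s => ‖h s‖ₑ) x volume) ^ p) := by
        rw [lintegral_const_mul' _ _ ht, lintegral_add_left hmeas, lintegral_const_mul' _ _ hC1p]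
    _ ≤ 2^(p-1) * (C3 * (∫⁻ x, ‖h x‖ₑ ^ p) + C1 ^ p * (C2 * ∫⁻ x, ‖h x‖ₑ ^ p)) := by
        gcongr
        · exact h3 h hh
        · exact h2 _ hh.1.enorm.aemeasurable
    _ = _ := by ring

section rot
variable {V : Type*} [NormedAddCommGroup V] [InnerProductSpace ℝ V] [FiniteDimensional ℝ V] [MeasurableSpace V] [BorelSpace V]

lemma slab (μ : Measure V) [μ.IsAddHaarMeasure] (w : V) (hw : w ≠ 0) (G : V → ℝ≥0∞) (hG : Measurable G) :
    ∫⁻ x, G x ∂μ = ∫⁻ x, (Set.Ico (0:ℝ) 1).indicator 1 (inner ℝ x w / ‖w‖^2) * (∫⁻ a : ℝ, G (x + a • w)) ∂μ := by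
  set I : ℝ → ℝ≥0∞ := (Set.Ico (0:ℝ) 1).indicator 1 with hI
  have hIm : Measurable I := measurable_one.indicator measurableSet_Ico
  have hwn : ‖w‖^2 ≠ 0 := by positivity
  have e : ∀ (x : V) (a : ℝ), inner ℝ (x - a • w) w / ‖w‖^2 = inner ℝ x w / ‖w‖^2 - a := by
    intro x a
    rw [inner_sub_left, real_inner_smul_left, real_inner_self_eq_norm_sq]
    field_simp
  have h1 : ∀ c : ℝ, ∫⁻ a : ℝ, I (c - a) = 1 := by
    intro c
    rw [lintegral_sub_left_eq_self I c, hI, lintegral_indicator_one measurableSet_Ico]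
    simp
  calc _ = ∫⁻ x, (∫⁻ a : ℝ, G x * I (inner ℝ (x - a • w) w / ‖w‖^2)) ∂μ := by
        congr 1; ext x
        simp_rw [e]
        rw [lintegral_const_mul, h1, mul_one]
        fun_prop
    _ = ∫⁻ a : ℝ, (∫⁻ x, G x * I (inner ℝ (x - a • w) w / ‖w‖^2) ∂μ) := by
        apply lintegral_lintegral_swap
        refine Measurable.aemeasurable ?_
        unfold Function.uncurry
        fun_prop
    _ = ∫⁻ a : ℝ, (∫⁻ x, I (inner ℝ x w / ‖w‖^2) * G (x + a • w) ∂μ) := by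
        congr 1; ext a
        rw [← lintegral_add_right_eq_self _ (a • w)]
        simp only [add_sub_cancel_right]
        congr 1; ext x; rw [mul_comm]
    _ = ∫⁻ x, (∫⁻ a : ℝ, I (inner ℝ x w / ‖w‖^2) * G (x + a • w)) ∂μ := by
        apply lintegral_lintegral_swap
        refine Measurable.aemeasurable ?_
        unfold Function.uncurry
        fun_prop
    _ = _ := by
        congr 1; ext x
        rw [lintegral_const_mul]
        fun_prop

def TD (g : V → ℝ) (τ : ℝ) (x w : V) : ℝ := ∫ r : ℝ, g (x - r • w) * trunc τ r

lemma TD_meas (g : V → ℝ) (hg : Measurable g) (τ : ℝ) : Measurable (fun q : V × V => TD g τ q.1 q.2) := by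
  unfold TD
  have := trunc_meas' τ
  have h : StronglyMeasurable (fun z : (V × V) × ℝ => g (z.1.1 - z.2 • z.1.2) * trunc τ z.2) := by
    apply Measurable.stronglyMeasurable
    fun_prop
  exact h.integral_prod_right.measurable

lemma TD_max (μ : Measure V) [μ.IsAddHaarMeasure] (p : ℝ) (hp : 1 < p) : ∃ C : ℝ≥0∞, C ≠ ∞ ∧ ∀ (g : V → ℝ) (w : V), Continuous g → HasCompactSupport g → w ≠ 0 →
    ∫⁻ x, (⨆ j : ℤ, ‖TD g ((2:ℝ)^j) x w‖ₑ) ^ p ∂μ ≤ C * ∫⁻ x, ‖g x‖ₑ ^ p ∂μ := by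
  obtain ⟨C, hC, hb⟩ := TH_max p hp
  refine ⟨C, hC, ?_⟩
  intro g w hg hgs hw
  have hwn : 0 < ‖w‖ := norm_pos_iff.2 hw
  have hm : Measurable (fun x => (⨆ j : ℤ, ‖TD g ((2:ℝ)^j) x w‖ₑ) ^ p) :=
    (Measurable.iSup fun j => ((TD_meas g hg.measurable ((2:ℝ)^j)).comp (by fun_prop : Measurable fun x : V => (x, w))).enorm).pow_const p
  rw [slab μ w hw _ hm, slab μ w hw _ (hg.measurable.enorm.pow_const p), ← lintegral_const_mul' _ _ hC]
  apply lintegral_mono; intro x; simp only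
  rw [← mul_assoc, mul_comm C, mul_assoc]
  gcongr
  have hBC : BC (fun a => g (x + a • w)) := by
    refine ⟨(by fun_prop : Continuous fun a : ℝ => g (x + a • w)).measurable, ?_⟩
    obtain ⟨B, hB⟩ := hgs.exists_bound_of_continuous hg
    obtain ⟨R, hR⟩ := hgs.isCompact.isBounded.subset_closedBall (0:V)
    refine ⟨B, fun s => hB _, (|R| + ‖x‖ + 1)/‖w‖, by positivity, fun s hs => ?_⟩
    by_contra hc
    have := hR (subset_tsupport g hc)
    rw [mem_closedBall_zero_iff] at this
    rw [div_lt_iff₀ hwn] at hs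
    have h2 : ‖s • w‖ ≤ ‖x + s • w‖ + ‖x‖ := by
      have := norm_sub_le (x + s • w) x
      simpa using this
    rw [norm_smul, Real.norm_eq_abs] at h2
    linarith [le_abs_self R]
  refine le_trans (le_of_eq ?_) (hb _ hBC)
  congr 1; ext a
  congr 2; ext j
  unfold TD TH
  congr 2; ext r
  simp only [sub_smul]
  congr 2; abel
end rot

lemma integrable_of_box {α β F : Type*} [MeasurableSpace α] [MeasurableSpace β] [NormedAddCommGroup F] (μ : Measure α) (ν : Measure β) [SFinite μ] [SFinite ν]
    (f : α × β → F) (hf : AEStronglyMeasurable f (μ.prod ν)) (K : ℝ) (S : Set α) (T : Set β) (hS : MeasurableSet S) (hT : MeasurableSet T)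
    (hSf : μ S ≠ ∞) (hTf : ν T ≠ ∞) (hb : ∀ z, ‖f z‖ ≤ K) (h0 : ∀ z, ¬ (z.1 ∈ S ∧ z.2 ∈ T) → f z = 0) : Integrable f (μ.prod ν) := by
  have : Integrable (S ×ˢ T |>.indicator (fun _ => K)) (μ.prod ν) := by
    rw [integrable_indicator_iff (hS.prod hT)]
    refine integrableOn_const ?_ enorm_ne_top
    rw [Measure.prod_prod]
    exact ENNReal.mul_ne_top hSf hTf
  refine this.mono' hf (Eventually.of_forall fun z => ?_)
  by_cases hz : z ∈ S ×ˢ T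
  · rw [Set.indicator_of_mem hz]; exact hb z
  · rw [Set.indicator_of_notMem hz, h0 z hz]; simp

section rot
variable {V : Type*} [NormedAddCommGroup V] [InnerProductSpace ℝ V] [FiniteDimensional ℝ V] [MeasurableSpace V] [BorelSpace V]

structure OddKer (θ : V → ℂ) (B : ℝ) : Prop where
  meas : Measurable θ
  odd : ∀ z, θ (-z) = - θ z
  hom : ∀ (l : ℝ) (z : V), 0 < l → θ (l • z) = ((l ^ Module.finrank ℝ V)⁻¹ : ℝ) * θ z
  bdd : ∀ z, ‖θ z‖ * ‖z‖ ^ Module.finrank ℝ V ≤ B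

def ann (V : Type*) [NormedAddCommGroup V] : Set V := {w | 1 < ‖w‖ ∧ ‖w‖ < 2}

lemma ann_meas : MeasurableSet (ann V) :=
  (measurableSet_lt measurable_const measurable_norm).inter (measurableSet_lt measurable_norm measurable_const)

lemma ann_fin (μ : Measure V) [μ.IsAddHaarMeasure] : μ (ann V) ≠ ∞ := by
  refine ne_top_of_le_ne_top (measure_ball_lt_top (μ := μ) (x := (0:V)) (r := 2)).ne (measure_mono fun w hw => ?_)
  simpa using hw.2

open scoped Classical in
def Wf (t : ℝ) (z : V) : ℝ := ∫ r : ℝ, if t < |r| ∧ r⁻¹ • z ∈ ann V then |r|⁻¹ else 0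

def Uf (μ : Measure V) (θ : V → ℂ) (g : V → ℝ) (t : ℝ) (x : V) : ℂ := ∫ w in ann V, (TD g t x w : ℂ) * θ w ∂μ

lemma mem_ann_iff (r : ℝ) (z : V) (hr : r ≠ 0) : r⁻¹ • z ∈ ann V ↔ |r| < ‖z‖ ∧ ‖z‖ < 2 * |r| := by
  have : 0 < |r| := abs_pos.2 hr
  unfold ann
  rw [Set.mem_ofPred_eq, norm_smul, norm_inv, Real.norm_eq_abs, inv_mul_eq_div, one_lt_div this, div_lt_iff₀ this]

open scoped Classical in
lemma Uf_eq (μ : Measure V) [μ.IsAddHaarMeasure] (θ : V → ℂ) (B : ℝ) (hθ : OddKer θ B) (g : V → ℝ) (hg : Continuous g) (hgs : HasCompactSupport g) (t : ℝ) (ht : 0 < t) (x : V) :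
    Uf μ θ g t x = ∫ z, (g (x - z) : ℂ) * θ z * (Wf t z : ℂ) ∂μ := by
  have htr := trunc_meas' t
  have hθm := hθ.meas
  have hgm := hg.measurable
  set m := Module.finrank ℝ V with hm
  obtain ⟨Bg, hBg⟩ := hgs.exists_bound_of_continuous hg
  obtain ⟨R, hR⟩ := hgs.isCompact.isBounded.subset_closedBall (0:V)
  set R' := |R| + ‖x‖ with hR'
  have hBg0 : 0 ≤ Bg := (norm_nonneg _).trans (hBg 0)
  have hB0 : 0 ≤ B := le_trans (by positivity) (hθ.bdd 0)
  have hsupp : ∀ z, R' < ‖z‖ → g (x - z) = 0 := by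
    intro z hz
    by_contra hc
    have := hR (subset_tsupport g hc)
    rw [mem_closedBall_zero_iff] at this
    have h2 : ‖z‖ ≤ ‖x - z‖ + ‖x‖ := by
      have := norm_sub_le x (x - z); simp at this; linarith
    linarith [le_abs_self R]
  have hθ1 : ∀ (a : ℝ) (z : V), 0 < a → a ≤ ‖z‖ → ‖θ z‖ ≤ B / a ^ m := by
    intro a z ha hz
    rw [le_div_iff₀ (by positivity)]
    refine le_trans ?_ (hθ.bdd z)
    gcongr
  have hsgn : ∀ (r : ℝ) (z : V), r ≠ 0 → (1 / r : ℂ) * (|(r ^ m)⁻¹| : ℝ) * θ (r⁻¹ • z) = (|r|⁻¹ : ℝ) * θ z := by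
    intro r z hr
    rcases lt_or_gt_of_ne hr with h | h
    · have : r⁻¹ • z = (-r)⁻¹ • (-z) := by rw [inv_neg, neg_smul, smul_neg, neg_neg]
      rw [this, hθ.hom _ _ (by rw [inv_pos]; linarith), hθ.odd, abs_inv, abs_pow, abs_of_neg h]
      have h' : (r:ℂ) ≠ 0 := by exact_mod_cast hr
      have h'' : ((-r:ℝ):ℂ) ^ m ≠ 0 := by push_cast; exact pow_ne_zero _ (neg_ne_zero.2 h')
      push_cast at h'' ⊢
      rw [← hm]
      have : ((-r:ℂ)⁻¹ ^ m)⁻¹ = (-r:ℂ)^m := by rw [inv_pow, inv_inv]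
      rw [this]
      field_simp
    · rw [hθ.hom _ _ (by positivity), abs_inv, abs_pow, abs_of_pos h]
      have h' : (r:ℂ) ≠ 0 := by exact_mod_cast hr
      rw [← hm]
      push_cast
      rw [inv_pow, inv_inv]
      field_simp
  have hF1 : Integrable (fun q : V × ℝ => (ann V).indicator (fun w => θ w) q.1 * ((g (x - q.2 • q.1) * trunc t q.2 : ℝ):ℂ)) (μ.prod volume) := by
    refine integrable_of_box μ volume _ ?_ (B / 1 ^ m * (Bg * (1/t))) (ann V) (Set.Icc (-R') R') ann_meas measurableSet_Icc (ann_fin μ) (by simp) ?_ ?_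
    · have := hθm.indicator (ann_meas (V := V))
      exact Measurable.aestronglyMeasurable (by fun_prop)
    · intro q
      rw [norm_mul]
      by_cases hq : q.1 ∈ ann V
      · rw [Set.indicator_of_mem hq, Complex.norm_real, norm_mul]
        gcongr
        · exact hθ1 1 _ one_pos hq.1.le
        · exact hBg _
        · exact trunc_bound t _ ht
      · rw [Set.indicator_of_notMem hq]; simp; positivity
    · intro q hq
      by_cases hq1 : q.1 ∈ ann V
      · have : q.2 ∉ Set.Icc (-R') R' := fun h => hq ⟨hq1, h⟩
        rw [hsupp, zero_mul]; simp
        rw [norm_smul, Real.norm_eq_abs]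
        have h3 : R' < |q.2| := by
          by_contra hc
          exact this (abs_le.1 (not_lt.1 hc))
        have := hq1.1
        nlinarith [abs_nonneg q.2]
      · rw [Set.indicator_of_notMem hq1]; simp
  have hF2 : Integrable (fun q : ℝ × V => (if t < |q.1| ∧ q.1⁻¹ • q.2 ∈ ann V then |q.1|⁻¹ else 0 : ℝ) * ((g (x - q.2) : ℂ) * θ q.2)) (volume.prod μ) := by
    refine integrable_of_box volume μ _ ?_ (1/t * (Bg * (B/t^m))) (Set.Icc (-R') R') (closedBall 0 R') measurableSet_Icc measurableSet_closedBall (by simp) measure_closedBall_lt_top.ne ?_ ?_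
    · have : Measurable (fun q : ℝ × V => (if t < |q.1| ∧ q.1⁻¹ • q.2 ∈ ann V then |q.1|⁻¹ else 0 : ℝ)) := by
        refine Measurable.ite ?_ (by fun_prop) (by fun_prop)
        refine MeasurableSet.inter (measurableSet_lt (measurable_const (a := t)) (by fun_prop : Measurable fun q : ℝ × V => |q.1|)) ?_
        exact (by fun_prop : Measurable fun q : ℝ × V => q.1⁻¹ • q.2) ann_meas
      exact Measurable.aestronglyMeasurable (by fun_prop)
    · intro q
      split_ifs with hq
      · have h0 : q.1 ≠ 0 := abs_pos.1 (ht.trans hq.1)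
        have h1 := (mem_ann_iff _ _ h0).1 hq.2
        rw [norm_mul, norm_mul, Complex.norm_real, Complex.norm_real, norm_inv, Real.norm_eq_abs |q.1|, abs_abs, one_div]
        have := hq.1
        gcongr
        · exact hBg _
        · exact hθ1 t _ ht (by linarith)
      · simp; positivity
    · intro q hq
      split_ifs with h
      · have h0 : q.1 ≠ 0 := abs_pos.1 (ht.trans h.1)
        have h1 := (mem_ann_iff _ _ h0).1 h.2
        rw [hsupp]; simp
        by_contra hc
        push Not at hc
        exact hq ⟨abs_le.1 (by linarith), by simpa using hc⟩
      · simp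
  calc Uf μ θ g t x = ∫ w, (∫ r : ℝ, (ann V).indicator (fun w => θ w) w * ((g (x - r • w) * trunc t r : ℝ):ℂ)) ∂μ := by
        unfold Uf TD
        rw [← integral_indicator ann_meas]
        congr 1; ext w
        rw [integral_const_mul]
        by_cases hw : w ∈ ann V
        · rw [Set.indicator_of_mem hw, Set.indicator_of_mem hw, integral_complex_ofReal, mul_comm]
        · simp [Set.indicator_of_notMem hw]
    _ = ∫ r : ℝ, ∫ w, (ann V).indicator (fun w => θ w) w * ((g (x - r • w) * trunc t r : ℝ):ℂ) ∂μ :=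
        integral_integral_swap (f := fun w (r : ℝ) => (ann V).indicator (fun w => θ w) w * ((g (x - r • w) * trunc t r : ℝ):ℂ)) hF1
    _ = ∫ r : ℝ, ∫ z, (if t < |r| ∧ r⁻¹ • z ∈ ann V then |r|⁻¹ else 0 : ℝ) * ((g (x - z) : ℂ) * θ z) ∂μ := by
        congr 1; ext r
        by_cases hr : t < |r|
        · have h0 : r ≠ 0 := abs_pos.1 (ht.trans hr)
          have := Measure.integral_comp_smul μ (fun z => (ann V).indicator (fun w => θ w) (r⁻¹ • z) * ((g (x - z) * trunc t r : ℝ):ℂ)) r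
          simp only [inv_smul_smul₀ h0] at this
          rw [this, ← integral_smul]
          congr 1; ext z
          by_cases hz : r⁻¹ • z ∈ ann V
          · rw [Set.indicator_of_mem hz, if_pos ⟨hr, hz⟩]
            have hs := hsgn r z h0
            have : trunc t r = 1 / r := by unfold trunc; rw [if_pos hr]
            rw [this, Complex.real_smul]
            push_cast at hs ⊢
            linear_combination (g (x - z) : ℂ) * hs
          · rw [Set.indicator_of_notMem hz, if_neg (fun h => hz h.2)]; simp
        · have : trunc t r = 0 := by unfold trunc; rw [if_neg hr]
          simp [this, hr]
    _ = ∫ z, (∫ r : ℝ, (if t < |r| ∧ r⁻¹ • z ∈ ann V then |r|⁻¹ else 0 : ℝ) * ((g (x - z) : ℂ) * θ z)) ∂μ :=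
        integral_integral_swap (f := fun (r : ℝ) (z : V) => (if t < |r| ∧ r⁻¹ • z ∈ ann V then |r|⁻¹ else 0 : ℝ) * ((g (x - z) : ℂ) * θ z)) hF2
    _ = _ := by
        congr 1; ext z
        rw [integral_mul_const, mul_comm]
        congr 1
        unfold Wf
        exact integral_complex_ofReal
end rot

def phi0 (u : ℝ) : ℝ := if |u| < 1 ∧ 1 < 2 * |u| then |u|⁻¹ else 0
def c00 : ℝ := ∫ u, phi0 u

lemma phi0_meas : Measurable phi0 := by
  unfold phi0
  refine Measurable.ite ?_ (by fun_prop) (by fun_prop)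
  exact (measurableSet_lt (by fun_prop : Measurable fun u:ℝ => |u|) measurable_const).inter (measurableSet_lt measurable_const (by fun_prop : Measurable fun u:ℝ => 2*|u|))

lemma phi0_nonneg (u : ℝ) : 0 ≤ phi0 u := by unfold phi0; split_ifs <;> positivity

lemma phi0_int : Integrable phi0 := by
  have : Integrable ((Set.Icc (-1:ℝ) 1).indicator (fun _ => (2:ℝ))) := by
    rw [integrable_indicator_iff measurableSet_Icc]
    exact integrableOn_const (by simp) enorm_ne_top
  refine this.mono' phi0_meas.aestronglyMeasurable (Eventually.of_forall fun u => ?_)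
  rw [Real.norm_of_nonneg (phi0_nonneg u)]
  unfold phi0
  split_ifs with h
  · have hu : u ∈ Set.Icc (-1:ℝ) 1 := abs_le.1 h.1.le
    rw [Set.indicator_of_mem hu]
    rw [inv_le_comm₀ (by linarith) (by norm_num)]
    linarith
  · exact Set.indicator_nonneg (fun _ _ => by norm_num) _

lemma c00_pos : 0 < c00 := by
  unfold c00
  rw [integral_pos_iff_support_of_nonneg phi0_nonneg phi0_int]
  refine lt_of_lt_of_le ?_ (measure_mono (show Set.Ioo (1/2:ℝ) 1 ⊆ Function.support phi0 from ?_))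
  · simp; norm_num
  · intro u hu
    have h0 : 0 < u := by linarith [hu.1]
    rw [Function.mem_support]; unfold phi0
    rw [abs_of_pos h0, if_pos ⟨hu.2, by linarith [hu.1]⟩]
    positivity

section rot
variable {V : Type*} [NormedAddCommGroup V] [InnerProductSpace ℝ V] [FiniteDimensional ℝ V] [MeasurableSpace V] [BorelSpace V]

open scoped Classical in
lemma Wf_integrand (t : ℝ) (ht : 0 < t) (z : V) (hz : z ≠ 0) (r : ℝ) : (if t < |r| ∧ r⁻¹ • z ∈ ann V then |r|⁻¹ else 0) = if t < |r| then ‖z‖⁻¹ * phi0 (r / ‖z‖) else 0 := by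
  have hz' : 0 < ‖z‖ := norm_pos_iff.2 hz
  by_cases h : t < |r|
  · have h0 : r ≠ 0 := abs_pos.1 (ht.trans h)
    have := mem_ann_iff r z h0
    unfold phi0
    simp only [abs_div, abs_norm, div_lt_one hz', ← mul_div_assoc, one_lt_div hz']
    simp only [h, true_and, this, if_true]
    split_ifs
    · rw [inv_div]; field_simp
    · simp
  · simp [h]

lemma phi0_scale (a : ℝ) (ha : 0 < a) : Integrable (fun r => a⁻¹ * phi0 (r/a)) ∧ ∫ r, a⁻¹ * phi0 (r/a) = c00 := by
  constructor
  · exact (phi0_int.comp_div ha.ne').const_mul _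
  · rw [integral_const_mul, Measure.integral_comp_div, abs_of_pos ha, smul_eq_mul]
    unfold c00; field_simp

lemma Wf_zero (t : ℝ) (ht : 0 < t) (z : V) (hz : ‖z‖ ≤ t) : Wf t z = 0 := by
  classical
  unfold Wf
  apply integral_eq_zero_of_ae
  refine Eventually.of_forall fun r => ?_
  simp only [Pi.zero_apply, ite_eq_right_iff, and_imp]
  intro h h2
  have := (mem_ann_iff r z (abs_pos.1 (ht.trans h))).1 h2
  linarith

lemma Wf_c (t : ℝ) (ht : 0 < t) (z : V) (hz : 2 * t ≤ ‖z‖) : Wf t z = c00 := by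
  classical
  have hz' : 0 < ‖z‖ := by linarith
  unfold Wf
  simp_rw [Wf_integrand t ht z (norm_pos_iff.1 hz')]
  rw [← (phi0_scale ‖z‖ hz').2]
  congr 1; ext r
  split_ifs with h
  · rfl
  · unfold phi0
    rw [if_neg, mul_zero]
    rw [abs_div, abs_norm, ← mul_div_assoc, one_lt_div hz']
    rintro ⟨_, h2⟩
    linarith

lemma Wf_bd (t : ℝ) (ht : 0 < t) (z : V) : |Wf t z| ≤ c00 := by
  classical
  by_cases hz : z = 0
  · rw [hz, Wf_zero t ht 0 (by simpa using ht.le), abs_zero]; exact c00_pos.le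
  have hz' : 0 < ‖z‖ := norm_pos_iff.2 hz
  unfold Wf
  simp_rw [Wf_integrand t ht z hz]
  rw [← Real.norm_eq_abs]
  refine (norm_integral_le_of_norm_le (phi0_scale ‖z‖ hz').1 (Eventually.of_forall fun r => ?_)).trans_eq (phi0_scale ‖z‖ hz').2
  have := phi0_nonneg (r/‖z‖)
  split_ifs
  · rw [Real.norm_of_nonneg (by positivity)]
  · rw [norm_zero]; positivity

set_option maxHeartbeats 2000000 in
lemma Uf_max (μ : Measure V) [μ.IsAddHaarMeasure] (p : ℝ) (hp : 1 < p) (B : ℝ) (θ : V → ℂ) (hθ : OddKer θ B) : ∃ C : ℝ≥0∞, C ≠ ∞ ∧ ∀ (g : V → ℝ), Continuous g → HasCompactSupport g →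
    ∫⁻ x, (⨆ j : ℤ, ‖Uf μ θ g ((2:ℝ)^j) x‖ₑ) ^ p ∂μ ≤ C * ∫⁻ x, ‖g x‖ₑ ^ p ∂μ := by
  obtain ⟨C, hC, hb⟩ := TD_max μ p hp
  obtain ⟨q, hpq⟩ : ∃ q : ℝ, p.HolderConjugate q := ⟨_, Real.HolderConjugate.conjExponent hp⟩
  have hp0 : 0 < p := by linarith
  have hq0 : 0 < q := by linarith [hpq.symm.lt]
  obtain ⟨b, hbb⟩ : ∃ b, b = oR B := ⟨_, rfl⟩
  have hbt : b ≠ ∞ := by rw [hbb]; exact ENNReal.ofReal_ne_top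
  have hbp : b ^ p ≠ ∞ := ENNReal.rpow_ne_top_of_nonneg hp0.le hbt
  obtain ⟨a, ha⟩ : ∃ a, a = (μ (ann V)) ^ (1/q) := ⟨_, rfl⟩
  have hap : a ^ p ≠ ∞ := by
    rw [ha]
    exact ENNReal.rpow_ne_top_of_nonneg hp0.le (ENNReal.rpow_ne_top_of_nonneg (by positivity) (ann_fin μ))
  refine ⟨b ^ p * (a ^ p * (C * μ (ann V))), ENNReal.mul_ne_top hbp (ENNReal.mul_ne_top hap (ENNReal.mul_ne_top hC (ann_fin μ))), ?_⟩
  intro g hg hgs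
  set D : V → V → ℝ≥0∞ := fun x w => ⨆ j : ℤ, ‖TD g ((2:ℝ)^j) x w‖ₑ with hD
  have hDm : Measurable (fun q : V × V => D q.1 q.2) :=
    Measurable.iSup fun j => (TD_meas g hg.measurable ((2:ℝ)^j)).enorm
  have hDm1 : ∀ x, Measurable (D x) := fun x => hDm.comp (by fun_prop : Measurable fun w : V => (x, w))
  have h1 : ∀ x, (⨆ j : ℤ, ‖Uf μ θ g ((2:ℝ)^j) x‖ₑ) ≤ b * ∫⁻ w in ann V, D x w ∂μ := by
    intro x
    refine iSup_le fun j => ?_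
    unfold Uf
    refine (enorm_integral_le_lintegral_enorm _).trans ?_
    rw [← lintegral_const_mul' _ _ hbt]
    refine setLIntegral_mono' ann_meas fun w hw => ?_
    rw [enorm_mul, mul_comm]
    gcongr
    · rw [← ofReal_norm_eq_enorm, hbb]
      apply ENNReal.ofReal_le_ofReal
      refine le_trans ?_ (hθ.bdd w)
      exact le_mul_of_one_le_right (norm_nonneg _) (one_le_pow₀ hw.1.le)
    · refine le_trans (le_of_eq ?_) (le_iSup (fun j : ℤ => ‖TD g ((2:ℝ)^j) x w‖ₑ) j)
      rw [← ofReal_norm_eq_enorm, Complex.norm_real, ofReal_norm_eq_enorm]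
  have h2 : ∀ x, (∫⁻ w in ann V, D x w ∂μ) ^ p ≤ a ^ p * ∫⁻ w in ann V, (D x w)^p ∂μ := by
    intro x
    have := ENNReal.lintegral_mul_le_Lp_mul_Lq (μ.restrict (ann V)) hpq (hDm1 x).aemeasurable (measurable_const (a := (1:ℝ≥0∞))).aemeasurable
    simp only [Pi.mul_apply, mul_one, ENNReal.one_rpow, lintegral_const, one_mul, Measure.restrict_apply, MeasurableSet.univ, Set.univ_inter] at this
    refine (ENNReal.rpow_le_rpow this hp0.le).trans (le_of_eq ?_)
    rw [ENNReal.mul_rpow_of_nonneg _ _ hp0.le, ← ENNReal.rpow_mul, one_div_mul_cancel hp0.ne', ENNReal.rpow_one, mul_comm, ha]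
  calc _ ≤ ∫⁻ x, b ^ p * (a ^ p * ∫⁻ w in ann V, (D x w)^p ∂μ) ∂μ := by
        apply lintegral_mono; intro x
        refine (ENNReal.rpow_le_rpow (h1 x) hp0.le).trans ?_
        rw [ENNReal.mul_rpow_of_nonneg _ _ hp0.le]
        exact mul_le_mul_right (h2 x) _
    _ = b ^ p * (a ^ p * ∫⁻ x, (∫⁻ w in ann V, (D x w)^p ∂μ) ∂μ) := by
        rw [lintegral_const_mul' _ _ hbp, lintegral_const_mul' _ _ hap]
    _ = b ^ p * (a ^ p * ∫⁻ w in ann V, (∫⁻ x, (D x w)^p ∂μ) ∂μ) := by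
        rw [lintegral_lintegral_swap]
        exact (hDm.pow_const p).aemeasurable
    _ ≤ b ^ p * (a ^ p * ∫⁻ w in ann V, (C * ∫⁻ x, ‖g x‖ₑ ^ p ∂μ) ∂μ) := by
        gcongr 2
        refine setLIntegral_mono' ann_meas fun w hw => ?_
        refine hb g w hg hgs ?_
        rintro rfl
        have := hw.1
        rw [norm_zero] at this
        linarith
    _ = _ := by
        rw [setLIntegral_const]; ring

structure CZK (Φ : V → ℝ → ℂ) (C : ℝ) : Prop where
  meas : ∀ t, Measurable fun y => Φ y t
  size : ∀ y t, 0 < t → ‖Φ y t‖ * (‖y‖ + t) ^ Module.finrank ℝ V ≤ C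
  reg : ∀ y h t, 0 < t → 2 * (‖h‖ + t) ≤ ‖y‖ → ‖Φ (y+h) t - Φ y 0‖ * ‖y‖ ^ (Module.finrank ℝ V + 1) ≤ C * (‖h‖ + t)
  odd : OddKer (fun y => Φ y 0) C

lemma CZ_kernel (Φ : V → ℝ → ℂ) (C : ℝ) (h : CZK Φ C) (κ : ℝ) (hκ : 0 < κ) :
    ∃ K : ℝ, 0 ≤ K ∧ ∀ (y x : V) (t t' : ℝ) (z : V), 0 < t' → t' ≤ t → t ≤ 2 * t' → ‖y - x‖ < κ * t →
     ‖Φ (y - z) t - Φ (x - z) 0 * ((Wf t' (x - z) / c00 : ℝ) : ℂ)‖ ≤ K * pk (Module.finrank ℝ V) t ‖x - z‖ := by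
  set m := Module.finrank ℝ V with hm
  set Λ := 2 * (κ + 1) with hΛ
  have hC : 0 ≤ C := le_trans (by positivity) (h.size 0 1 one_pos)
  have hc := c00_pos
  refine ⟨C * (κ+1) * 2^(m+1) + (C + C * 2^m) * (1+Λ)^(m+1), by positivity, ?_⟩
  intro y x t t' z ht' htt ht2 hyx
  have ht : 0 < t := by linarith
  set s := ‖x - z‖ with hs
  have hs0 : 0 ≤ s := norm_nonneg _
  have hp0 := pk_nonneg m ht hs0
  rcases le_or_gt (Λ * t) s with hc1 | hc1
  · have hspos : 0 < s := by nlinarith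
    rw [Wf_c t' ht' (x - z) (by rw [← hs]; nlinarith), div_self hc.ne']
    have := h.reg (x - z) (y - x) t ht (by rw [← hs]; nlinarith)
    rw [show x - z + (y - x) = y - z by abel, ← hs, ← hm] at this
    simp only [Complex.ofReal_one, mul_one]
    have h1 : ‖Φ (y - z) t - Φ (x - z) 0‖ ≤ C * (κ+1) * t / s^(m+1) := by
      rw [le_div_iff₀ (by positivity)]
      refine this.trans ?_
      rw [mul_assoc]
      gcongr
      nlinarith
    have h2 : C * (κ+1) * t / s^(m+1) ≤ C * (κ+1) * 2^(m+1) * pk m t s := by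
      unfold pk
      rw [← mul_div_assoc, div_le_div_iff₀ (by positivity) (by positivity)]
      have : (t+s)^(m+1) ≤ (2 * s)^(m+1) := by
        gcongr
        nlinarith
      rw [mul_pow] at this
      have h3 : 0 ≤ C * (κ+1) * t := by positivity
      nlinarith
    have h3 : 0 ≤ (C + C * 2^m) * (1+Λ)^(m+1) * pk m t s := by positivity
    nlinarith
  · have h1 : ‖Φ (y - z) t‖ ≤ C / t^m := by
      rw [le_div_iff₀ (by positivity)]
      refine le_trans ?_ (h.size (y - z) t ht)
      gcongr
      linarith [norm_nonneg (y - z)]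
    have h2 : ‖Φ (x - z) 0 * ((Wf t' (x - z) / c00 : ℝ) : ℂ)‖ ≤ C * 2^m / t^m := by
      rcases le_or_gt s t' with h4 | h4
      · rw [Wf_zero t' ht' _ h4]; simp; positivity
      · have hspos : 0 < s := by linarith
        rw [norm_mul, Complex.norm_real, norm_div, Real.norm_eq_abs, Real.norm_of_nonneg hc.le]
        have e1 : |Wf t' (x - z)| / c00 ≤ 1 := by rw [div_le_one hc]; exact Wf_bd t' ht' _
        have e2 := h.odd.bdd (x - z)
        rw [← hs, ← hm] at e2
        rw [le_div_iff₀ (by positivity)]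
        calc _ ≤ ‖Φ (x - z) 0‖ * 1 * (2 * s) ^ m := by
              gcongr
              linarith
          _ = (‖Φ (x - z) 0‖ * s^m) * 2^m := by rw [mul_pow]; ring
          _ ≤ _ := by gcongr
    have h3 : 1 / t^m ≤ (1+Λ)^(m+1) * pk m t s := by
      unfold pk
      rw [← mul_div_assoc, div_le_div_iff₀ (by positivity) (by positivity)]
      have : (t+s)^(m+1) ≤ ((1+Λ) * t)^(m+1) := by
        gcongr
        nlinarith
      rw [mul_pow] at this
      calc 1 * (t+s)^(m+1) ≤ (1+Λ)^(m+1) * t^(m+1) := by linarith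
        _ = _ := by ring
    calc _ ≤ C / t^m + C * 2^m / t^m := (norm_sub_le _ _).trans (add_le_add h1 h2)
      _ = (C + C * 2^m) * (1 / t^m) := by ring
      _ ≤ (C + C * 2^m) * ((1+Λ)^(m+1) * pk m t s) := by gcongr
      _ ≤ _ := by
        have : 0 ≤ C * (κ+1) * 2^(m+1) * pk m t s := by positivity
        nlinarith
end rot

section rot
variable {V : Type*} [NormedAddCommGroup V] [InnerProductSpace ℝ V] [FiniteDimensional ℝ V] [MeasurableSpace V] [BorelSpace V]

lemma Wf_meas (t : ℝ) : Measurable (fun z : V => Wf t z) := by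
  classical
  have : Measurable (fun q : V × ℝ => (if t < |q.2| ∧ q.2⁻¹ • q.1 ∈ ann V then |q.2|⁻¹ else 0 : ℝ)) := by
    refine Measurable.ite ?_ (by fun_prop) (by fun_prop)
    refine MeasurableSet.inter (measurableSet_lt (measurable_const (a := t)) (by fun_prop : Measurable fun q : V × ℝ => |q.2|)) ?_
    exact (by fun_prop : Measurable fun q : V × ℝ => q.2⁻¹ • q.1) ann_meas
  unfold Wf
  convert (this.stronglyMeasurable.integral_prod_right' (ν := (volume : Measure ℝ))).measurable using 5

lemma pk_le (d : ℕ) {t s : ℝ} (ht : 0 < t) (hs : 0 ≤ s) : pk d t s ≤ 1 / t^d := by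
  unfold pk
  rw [div_le_div_iff₀ (by positivity) (by positivity), one_mul, pow_succ]
  calc t * t^d = t^d * t := by ring
    _ ≤ (t+s)^d * (t+s) := by gcongr <;> linarith

lemma CZ_pt (μ : Measure V) [μ.IsAddHaarMeasure] (Φ : V → ℝ → ℂ) (C : ℝ) (h : CZK Φ C) (κ : ℝ) (hκ : 0 < κ) :
    ∃ K : ℝ≥0∞, K ≠ ∞ ∧ ∀ (g : V → ℝ), Continuous g → HasCompactSupport g → ∀ (y x : V) (t : ℝ), 0 < t → ‖y - x‖ < κ * t →
    ‖∫ z, Φ (y - z) t * (g z : ℂ) ∂μ‖ₑ ≤ K * (⨆ j : ℤ, ‖Uf μ (fun y => Φ y 0) g ((2:ℝ)^j) x‖ₑ) + K * HM (fun z => ‖g z‖ₑ) x μ := by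
  obtain ⟨K, hK0, hK⟩ := CZ_kernel Φ C h κ hκ
  obtain ⟨m, hm⟩ : ∃ m, m = Module.finrank ℝ V := ⟨_, rfl⟩
  rw [← hm] at hK
  have hc := c00_pos
  refine ⟨oR c00⁻¹ + oR K * ((2^(m+1) * μ (ball (0:V) 1)) * 2), ?_, ?_⟩
  · exact ENNReal.add_ne_top.2 ⟨ENNReal.ofReal_ne_top, ENNReal.mul_ne_top ENNReal.ofReal_ne_top (pk_const_ne_top μ m)⟩
  intro g hg hgs y x t ht hyx
  obtain ⟨t', ht', j, hj⟩ : ∃ t' : ℝ, 0 < t' ∧ ∃ j : ℤ, t' = (2:ℝ)^j ∧ t' ≤ t ∧ t ≤ 2 * t' := by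
    refine ⟨(2:ℝ)^(Int.log 2 t), by positivity, _, rfl, ?_, ?_⟩
    · exact_mod_cast Int.zpow_log_le_self (b := 2) (by norm_num) ht
    · have := (Int.lt_zpow_succ_log_self (b := 2) (by norm_num) t).le
      push_cast at this
      rwa [zpow_add_one₀ (by norm_num), mul_comm] at this
  obtain ⟨hj, h1, h2⟩ := hj
  have hgi : Integrable (fun z => (g z : ℂ)) μ := (hg.integrable_of_hasCompactSupport hgs).ofReal
  have hΦm := h.meas
  have hWm := Wf_meas (V := V) t'
  have hb := fun z => hK y x t t' z ht' h1 h2 hyx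
  have hi1 : Integrable (fun z => (Φ (y - z) t - Φ (x - z) 0 * ((Wf t' (x - z) / c00 : ℝ) : ℂ)) * (g z : ℂ)) μ := by
    refine hgi.bdd_mul (c := K * (1 / t^m)) ?_ (Eventually.of_forall fun z => (hb z).trans ?_)
    · have e1 := (hΦm t).comp (by fun_prop : Measurable fun z : V => y - z)
      have e2 := (hΦm 0).comp (by fun_prop : Measurable fun z : V => x - z)
      have e3 := hWm.comp (by fun_prop : Measurable fun z : V => x - z)
      exact (e1.sub (e2.mul (Complex.measurable_ofReal.comp (e3.div_const _)))).aestronglyMeasurable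
    · gcongr; exact pk_le m ht (norm_nonneg _)
  have hi0 : Integrable (fun z => Φ (y - z) t * (g z : ℂ)) μ := by
    refine hgi.bdd_mul (c := C / t^m) ((hΦm t).comp (by fun_prop : Measurable fun z : V => y - z)).aestronglyMeasurable (Eventually.of_forall fun z => ?_)
    rw [le_div_iff₀ (by positivity), hm]
    refine le_trans ?_ (h.size (y - z) t ht)
    gcongr
    linarith [norm_nonneg (y - z)]
  have hi2 : Integrable (fun z => (Φ (x - z) 0 * ((Wf t' (x - z) / c00 : ℝ) : ℂ)) * (g z : ℂ)) μ := by
    refine (hi0.sub hi1).congr (Eventually.of_forall fun z => ?_)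
    simp only [Pi.sub_apply]; ring
  have e0 : ∫ z, Φ (y - z) t * (g z : ℂ) ∂μ = (∫ z, (Φ (y - z) t - Φ (x - z) 0 * ((Wf t' (x - z) / c00 : ℝ) : ℂ)) * (g z : ℂ) ∂μ) + ∫ z, (Φ (x - z) 0 * ((Wf t' (x - z) / c00 : ℝ) : ℂ)) * (g z : ℂ) ∂μ := by
    rw [← integral_add hi1 hi2]
    congr 1; ext z; ring
  have e2 : ∫ z, (Φ (x - z) 0 * ((Wf t' (x - z) / c00 : ℝ) : ℂ)) * (g z : ℂ) ∂μ = (c00⁻¹ : ℝ) * Uf μ (fun y => Φ y 0) g ((2:ℝ)^j) x := by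
    rw [← hj, Uf_eq μ _ C h.odd g hg hgs t' ht' x, ← integral_const_mul]
    rw [← integral_sub_left_eq_self _ μ x]
    congr 1; ext z
    simp only [sub_sub_cancel]
    push_cast
    ring
  rw [e0, e2]
  refine (enorm_add_le _ _).trans ?_
  rw [add_comm]
  refine add_le_add ?_ ?_
  · rw [enorm_mul]
    refine mul_le_mul' ?_ (le_iSup (fun j : ℤ => ‖Uf μ (fun y => Φ y 0) g ((2:ℝ)^j) x‖ₑ) j)
    refine le_trans (le_of_eq ?_) le_self_add
    rw [← ofReal_norm_eq_enorm, Complex.norm_real, Real.norm_of_nonneg (by positivity)]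
  · refine (enorm_integral_le_lintegral_enorm _).trans ?_
    calc _ ≤ ∫⁻ z, oR K * (oR (pk m t ‖x - z‖) * ‖g z‖ₑ) ∂μ := by
          refine lintegral_mono fun z => ?_
          rw [enorm_mul, ← mul_assoc]
          refine mul_le_mul' ?_ (le_of_eq ?_)
          · rw [← ENNReal.ofReal_mul hK0, ← ofReal_norm_eq_enorm]
            exact ENNReal.ofReal_le_ofReal (hb z)
          · rw [← ofReal_norm_eq_enorm, Complex.norm_real, ofReal_norm_eq_enorm]
      _ = oR K * ∫⁻ z, (oR (pk m t ‖x - z‖) * ‖g z‖ₑ) ∂μ := by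
          rw [lintegral_const_mul' _ _ ENNReal.ofReal_ne_top]
      _ ≤ oR K * ((2^(m+1) * μ (ball (0:V) 1)) * 2 * HM (fun z => ‖g z‖ₑ) x μ) := by
          refine mul_le_mul_right ?_ _
          exact pk_HM_le μ hm ht x _ hg.measurable.enorm.aemeasurable
      _ ≤ _ := by
          rw [← mul_assoc]
          exact mul_le_mul_left le_add_self _
end rot

section rot
variable {V : Type*} [NormedAddCommGroup V] [InnerProductSpace ℝ V] [FiniteDimensional ℝ V] [MeasurableSpace V] [BorelSpace V]

def CN (κ : ℝ) (F : V → ℝ → ℂ) (x : V) : ℝ≥0∞ := ⨆ (y : V) (t : ℝ) (_ : 0 < t ∧ dist x y < κ * t), ‖F y t‖ₑ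

lemma CN_meas (κ : ℝ) (F : V → ℝ → ℂ) : Measurable (CN κ F) := by
  apply LowerSemicontinuous.measurable
  unfold CN
  refine lowerSemicontinuous_iSup fun y => lowerSemicontinuous_iSup fun t => ?_
  by_cases ht : 0 < t
  · intro x a ha
    by_cases hx : dist x y < κ * t
    · have : ∀ᶠ x' in 𝓝 x, dist x' y < κ * t :=
        (continuous_id.dist continuous_const).continuousAt.eventually_lt continuousAt_const hx
      filter_upwards [this] with x' hx'
      simp only [ht, hx, and_self, iSup_pos] at ha
      simpa only [ht, hx', and_self, iSup_pos] using ha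
    · simp [hx] at ha
  · simp only [ht, false_and, iSup_false]
    exact lowerSemicontinuous_const

lemma le_CN (κ : ℝ) (F : V → ℝ → ℂ) (x y : V) (t : ℝ) (ht : 0 < t) (h : dist x y < κ * t) : ‖F y t‖ₑ ≤ CN κ F x := by
  unfold CN
  exact le_iSup_of_le y (le_iSup_of_le t (le_iSup_of_le ⟨ht, h⟩ le_rfl))

lemma CN_le (κ : ℝ) (F : V → ℝ → ℂ) (x : V) (a : ℝ≥0∞) (h : ∀ y t, 0 < t → dist x y < κ * t → ‖F y t‖ₑ ≤ a) : CN κ F x ≤ a :=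
  iSup_le fun y => iSup_le fun t => iSup_le fun hh => h y t hh.1 hh.2

lemma eLpNorm_rp {F : Type*} [NormedAddCommGroup F] (μ : Measure V) (p : ℝ) (hp : 1 < p) (g : V → F) : eLpNorm g (oR p) μ ^ p = ∫⁻ x, ‖g x‖ₑ^p ∂μ := by
  have hp0 : 0 < p := by linarith
  rw [eLpNorm_eq_lintegral_rpow_enorm_toReal (by simpa using hp0) ENNReal.ofReal_ne_top, ENNReal.toReal_ofReal hp0.le, ← ENNReal.rpow_mul, one_div_mul_cancel hp0.ne', ENNReal.rpow_one]

lemma two_rp (p : ℝ) (hp : 1 < p) (a b : ℝ≥0∞) : (a+b)^p ≤ (2:ℝ≥0∞)^(p-1) * (a^p + b^p) := ENNReal.rpow_add_le_mul_rpow_add_rpow a b hp.le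

/-- the potential -/
def Pot (μ : Measure V) (Φ : V → ℝ → ℂ) (g : V → ℂ) (y : V) (t : ℝ) : ℂ := ∫ z, Φ (y - z) t * g z ∂μ

lemma CZ_real (μ : Measure V) [μ.IsAddHaarMeasure] (p : ℝ) (hp : 1 < p) (Φ : V → ℝ → ℂ) (C : ℝ) (h : CZK Φ C) (κ : ℝ) (hκ : 0 < κ) :
    ∃ K : ℝ≥0∞, K ≠ ∞ ∧ ∀ (g : V → ℝ), Continuous g → HasCompactSupport g →
      ∫⁻ x, (CN κ (Pot μ Φ (fun z => (g z : ℂ))) x)^p ∂μ ≤ K * ∫⁻ x, ‖g x‖ₑ^p ∂μ := by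
  obtain ⟨K, hK, h1⟩ := CZ_pt μ Φ C h κ hκ
  obtain ⟨C1, hC1, h2⟩ := Uf_max μ p hp C _ h.odd
  obtain ⟨C2, hC2, h3⟩ := HM_strong μ p hp
  have hp0 : 0 < p := by linarith
  have hKp : K ^ p ≠ ∞ := ENNReal.rpow_ne_top_of_nonneg hp0.le hK
  have h2p : (2:ℝ≥0∞) ^ (p-1) ≠ ∞ := ENNReal.rpow_ne_top_of_nonneg (by linarith) (by simp)
  refine ⟨(2:ℝ≥0∞)^(p-1) * (K^p * C1 + K^p * C2), ?_, ?_⟩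
  · exact ENNReal.mul_ne_top h2p (ENNReal.add_ne_top.2 ⟨ENNReal.mul_ne_top hKp hC1, ENNReal.mul_ne_top hKp hC2⟩)
  intro g hg hgs
  calc _ ≤ ∫⁻ x, (2:ℝ≥0∞)^(p-1) * (K^p * (⨆ j : ℤ, ‖Uf μ (fun y => Φ y 0) g ((2:ℝ)^j) x‖ₑ)^p + K^p * (HM (fun z => ‖g z‖ₑ) x μ)^p) ∂μ := by
        refine lintegral_mono fun x => ?_
        rw [← ENNReal.mul_rpow_of_nonneg _ _ hp0.le, ← ENNReal.mul_rpow_of_nonneg _ _ hp0.le]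
        refine le_trans (ENNReal.rpow_le_rpow ?_ hp0.le) (two_rp p hp _ _)
        refine CN_le _ _ _ _ fun y t ht hy => h1 g hg hgs y x t ht ?_
        rwa [← dist_eq_norm, dist_comm]
    _ = (2:ℝ≥0∞)^(p-1) * (K^p * (∫⁻ x, (⨆ j : ℤ, ‖Uf μ (fun y => Φ y 0) g ((2:ℝ)^j) x‖ₑ)^p ∂μ) + K^p * ∫⁻ x, (HM (fun z => ‖g z‖ₑ) x μ)^p ∂μ) := by
        rw [lintegral_const_mul' _ _ h2p, lintegral_add_right, lintegral_const_mul' _ _ hKp, lintegral_const_mul' _ _ hKp]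
        exact ((HM_meas μ _).pow_const p).const_mul _
    _ ≤ (2:ℝ≥0∞)^(p-1) * (K^p * (C1 * ∫⁻ x, ‖g x‖ₑ^p ∂μ) + K^p * (C2 * ∫⁻ x, ‖g x‖ₑ^p ∂μ)) :=
        mul_le_mul_right (add_le_add (mul_le_mul_right (h2 g hg hgs) _) (mul_le_mul_right (h3 _ hg.measurable.enorm.aemeasurable) _)) _
    _ = _ := by ring

lemma ker_Lq (μ : Measure V) [μ.IsAddHaarMeasure] (q : ℝ) (hq : 1 < q) (K : V → ℂ) (hK : Measurable K) (C : ℝ) (hb : ∀ z, ‖K z‖ * (1 + ‖z‖)^(Module.finrank ℝ V) ≤ C) (hV : 0 < Module.finrank ℝ V) :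
    MemLp K (oR q) μ := by
  set m := Module.finrank ℝ V with hm
  have hq0 : 0 < q := by linarith
  have h1 : MemLp (fun z : V => C * ((1 + ‖z‖)^m)⁻¹) (oR q) μ := by
    refine MemLp.const_mul ?_ C
    rw [← integrable_norm_rpow_iff (Measurable.aestronglyMeasurable (by fun_prop)) (by simpa using hq0) ENNReal.ofReal_ne_top, ENNReal.toReal_ofReal hq0.le]
    have : (Module.finrank ℝ V : ℝ) < m * q := by
      rw [← hm]
      have : (0:ℝ) < m := by exact_mod_cast hV
      nlinarith
    refine (integrable_one_add_norm (μ := μ) this).congr (Eventually.of_forall fun z => ?_)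
    simp only
    have : 0 < 1 + ‖z‖ := by positivity
    rw [Real.norm_of_nonneg (by positivity), Real.inv_rpow (by positivity), Real.rpow_neg this.le, Real.rpow_mul this.le, Real.rpow_natCast]
  refine h1.mono hK.aestronglyMeasurable (Eventually.of_forall fun z => ?_)
  have : 0 < 1 + ‖z‖ := by positivity
  have hC : 0 ≤ C := le_trans (by positivity) (hb z)
  rw [Real.norm_of_nonneg (by positivity), ← div_eq_mul_inv, le_div_iff₀ (by positivity)]
  exact hb z

lemma CZK.size1 {Φ : V → ℝ → ℂ} {C : ℝ} (h : CZK Φ C) (t : ℝ) (ht : 0 < t) (z : V) : ‖Φ z t‖ * (1 + ‖z‖)^(Module.finrank ℝ V) ≤ C * (1 + t⁻¹)^(Module.finrank ℝ V) := by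
  set m := Module.finrank ℝ V with hm
  have h1 : 1 + ‖z‖ ≤ (‖z‖ + t) * (1 + t⁻¹) := by
    have : (‖z‖ + t) * (1 + t⁻¹) = ‖z‖ + t + ‖z‖ * t⁻¹ + 1 := by field_simp; ring
    rw [this]
    have : 0 ≤ ‖z‖ * t⁻¹ := by positivity
    linarith
  calc _ ≤ ‖Φ z t‖ * ((‖z‖ + t) * (1 + t⁻¹))^m := by gcongr
    _ = (‖Φ z t‖ * (‖z‖ + t)^m) * (1+t⁻¹)^m := by rw [mul_pow]; ring
    _ ≤ _ := by
      gcongr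
      exact h.size z t ht

lemma HC_of (p : ℝ) (hp : 1 < p) : ∃ q : ℝ, 1 < q ∧ ENNReal.HolderConjugate (oR q) (oR p) := by
  have := Real.HolderConjugate.conjExponent hp
  exact ⟨_, this.symm.lt, this.symm.ennrealOfReal⟩

lemma Pot_int (μ : Measure V) [μ.IsAddHaarMeasure] (p : ℝ) (hp : 1 < p) (K : V → ℂ) (hK : Measurable K) (C : ℝ) (hb : ∀ z, ‖K z‖ * (1 + ‖z‖)^(Module.finrank ℝ V) ≤ C) (hV : 0 < Module.finrank ℝ V) :
    (∀ (g : V → ℂ), MemLp g (oR p) μ → ∀ y, Integrable (fun z => K (y - z) * g z) μ) ∧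
    ∃ B : ℝ≥0∞, B ≠ ∞ ∧ ∀ (g : V → ℂ), MemLp g (oR p) μ → ∀ y, ∫⁻ z, ‖K (y - z) * g z‖ₑ ∂μ ≤ B * eLpNorm g (oR p) μ := by
  obtain ⟨q, hq, hpq⟩ := HC_of p hp
  have h1 := ker_Lq μ q hq K hK C hb hV
  have h2 : ∀ y, MemLp (fun z => K (y - z)) (oR q) μ ∧ eLpNorm (fun z => K (y - z)) (oR q) μ = eLpNorm K (oR q) μ := by
    intro y
    have := Measure.measurePreserving_sub_left μ y
    exact ⟨h1.comp_measurePreserving this, eLpNorm_comp_measurePreserving h1.1 this⟩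
  refine ⟨fun g hg y => (h2 y).1.integrable_mul hg, eLpNorm K (oR q) μ, h1.2.ne, fun g hg y => ?_⟩
  rw [← (h2 y).2, ← eLpNorm_one_eq_lintegral_enorm]
  have h3 := eLpNorm_smul_le_mul_eLpNorm (p := oR q) (q := oR p) (r := 1) hg.1 (h2 y).1.1
  have h4 : (fun z => K (y - z) * g z) = (fun z => K (y - z)) • g := by
    ext z; simp
  rw [h4]
  exact h3

end rot

section rot
variable {V : Type*} [NormedAddCommGroup V] [InnerProductSpace ℝ V] [FiniteDimensional ℝ V] [MeasurableSpace V] [BorelSpace V]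

lemma CZ_cplx (μ : Measure V) [μ.IsAddHaarMeasure] (hV : 0 < Module.finrank ℝ V) (p : ℝ) (hp : 1 < p) (Φ : V → ℝ → ℂ) (C : ℝ) (h : CZK Φ C) (κ : ℝ) (hκ : 0 < κ) :
    ∃ K : ℝ≥0∞, K ≠ ∞ ∧ ∀ (g : V → ℂ), Continuous g → HasCompactSupport g →
      ∫⁻ x, (CN κ (Pot μ Φ g) x)^p ∂μ ≤ K * ∫⁻ x, ‖g x‖ₑ^p ∂μ := by
  obtain ⟨K, hK, h1⟩ := CZ_real μ p hp Φ C h κ hκ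
  have hp0 : 0 < p := by linarith
  have h2p : (2:ℝ≥0∞) ^ (p-1) ≠ ∞ := ENNReal.rpow_ne_top_of_nonneg (by linarith) (by simp)
  refine ⟨(2:ℝ≥0∞)^(p-1) * (K + K), ENNReal.mul_ne_top h2p (ENNReal.add_ne_top.2 ⟨hK, hK⟩), ?_⟩
  intro g hg hgs
  have hre : Continuous fun z => (g z).re := Complex.continuous_re.comp hg
  have him : Continuous fun z => (g z).im := Complex.continuous_im.comp hg
  have hres : HasCompactSupport fun z => (g z).re := hgs.comp_left (g := Complex.re) rfl
  have hims : HasCompactSupport fun z => (g z).im := hgs.comp_left (g := Complex.im) rfl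
  have e1 := h1 _ hre hres
  have e2 := h1 _ him hims
  have f1 : ∫⁻ x, ‖(g x).re‖ₑ^p ∂μ ≤ ∫⁻ x, ‖g x‖ₑ^p ∂μ := by
    refine lintegral_mono fun x => ENNReal.rpow_le_rpow ?_ hp0.le
    rw [← ofReal_norm_eq_enorm, ← ofReal_norm_eq_enorm]
    exact ENNReal.ofReal_le_ofReal (Complex.abs_re_le_norm _)
  have f2 : ∫⁻ x, ‖(g x).im‖ₑ^p ∂μ ≤ ∫⁻ x, ‖g x‖ₑ^p ∂μ := by
    refine lintegral_mono fun x => ENNReal.rpow_le_rpow ?_ hp0.le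
    rw [← ofReal_norm_eq_enorm, ← ofReal_norm_eq_enorm]
    exact ENNReal.ofReal_le_ofReal (Complex.abs_im_le_norm _)
  have hL : ∀ (f : V → ℝ), Continuous f → HasCompactSupport f → MemLp (fun z => (f z : ℂ)) (oR p) μ := by
    intro f hf hfs
    exact (Complex.continuous_ofReal.comp hf).memLp_of_hasCompactSupport (hfs.comp_left (g := Complex.ofReal) rfl)
  calc _ ≤ ∫⁻ x, (2:ℝ≥0∞)^(p-1) * ((CN κ (Pot μ Φ (fun z => ((g z).re : ℂ))) x)^p + (CN κ (Pot μ Φ (fun z => ((g z).im : ℂ))) x)^p) ∂μ := by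
        refine lintegral_mono fun x => ?_
        refine le_trans (ENNReal.rpow_le_rpow ?_ hp0.le) (two_rp p hp _ _)
        refine CN_le _ _ _ _ fun y t ht hy => ?_
        refine le_trans ?_ (add_le_add (le_CN κ _ x y t ht hy) (le_CN κ _ x y t ht hy))
        have := (Pot_int μ p hp (fun z => Φ z t) (h.meas t) _ (h.size1 t ht) hV).1
        have i1 := this _ (hL _ hre hres) y
        have i2 := this _ (hL _ him hims) y
        have : Pot μ Φ g y t = Pot μ Φ (fun z => ((g z).re : ℂ)) y t + Pot μ Φ (fun z => ((g z).im : ℂ)) y t * Complex.I := by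
          unfold Pot
          rw [← integral_mul_const, ← integral_add i1 (i2.mul_const _)]
          congr 1; ext z
          rw [mul_assoc, ← mul_add, Complex.re_add_im]
        rw [this]
        refine (enorm_add_le _ _).trans (le_of_eq ?_)
        rw [enorm_mul]
        congr 1
        rw [← ofReal_norm_eq_enorm Complex.I]; simp
    _ = (2:ℝ≥0∞)^(p-1) * ((∫⁻ x, (CN κ (Pot μ Φ (fun z => ((g z).re : ℂ))) x)^p ∂μ) + ∫⁻ x, (CN κ (Pot μ Φ (fun z => ((g z).im : ℂ))) x)^p ∂μ) := by
        rw [lintegral_const_mul' _ _ h2p, lintegral_add_right]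
        exact (CN_meas κ _).pow_const p
    _ ≤ (2:ℝ≥0∞)^(p-1) * ((K * ∫⁻ x, ‖g x‖ₑ^p ∂μ) + K * ∫⁻ x, ‖g x‖ₑ^p ∂μ) :=
        mul_le_mul_right (add_le_add (e1.trans (mul_le_mul_right f1 _)) (e2.trans (mul_le_mul_right f2 _))) _
    _ = _ := by ring

lemma CZ_Lp (μ : Measure V) [μ.IsAddHaarMeasure] (hV : 0 < Module.finrank ℝ V) (p : ℝ) (hp : 1 < p) (Φ : V → ℝ → ℂ) (C : ℝ) (h : CZK Φ C) (κ : ℝ) (hκ : 0 < κ) :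
    ∃ K : ℝ≥0∞, K ≠ ∞ ∧ ∀ (g : V → ℂ), MemLp g (oR p) μ →
      ∫⁻ x, (CN κ (Pot μ Φ g) x)^p ∂μ ≤ K * (eLpNorm g (oR p) μ)^p := by
  obtain ⟨K, hK, h1⟩ := CZ_cplx μ hV p hp Φ C h κ hκ
  have hp0 : 0 < p := by linarith
  have hp1 : 1 ≤ oR p := by rw [← ENNReal.ofReal_one]; exact ENNReal.ofReal_le_ofReal hp.le
  refine ⟨K, hK, ?_⟩
  intro g hg
  have : ∀ i : ℕ, ∃ f : V → ℂ, HasCompactSupport f ∧ eLpNorm (g - f) (oR p) μ ≤ ((i:ℝ≥0∞)+1)⁻¹ ∧ Continuous f ∧ MemLp f (oR p) μ := by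
    intro i
    exact hg.exists_hasCompactSupport_eLpNorm_sub_le ENNReal.ofReal_ne_top (by simp)
  choose f hfs hfd hfc hfL using this
  have h0 : Tendsto (fun i : ℕ => ((i:ℝ≥0∞)+1)⁻¹) atTop (𝓝 0) := by
    have := ENNReal.tendsto_inv_nat_nhds_zero.comp (tendsto_add_atTop_nat 1)
    refine this.congr fun i => ?_
    simp
  have hpt : ∀ y t, 0 < t → Tendsto (fun i => Pot μ Φ (f i) y t) atTop (𝓝 (Pot μ Φ g y t)) := by
    intro y t ht
    obtain ⟨hIn, B, hB, hb⟩ := Pot_int μ p hp (fun z => Φ z t) (h.meas t) _ (h.size1 t ht) hV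
    rw [tendsto_iff_edist_tendsto_0]
    refine tendsto_of_tendsto_of_tendsto_of_le_of_le (g := fun _ => 0) (h := fun i : ℕ => B * ((i:ℝ≥0∞)+1)⁻¹) tendsto_const_nhds ?_ (fun _ => zero_le) ?_
    · simpa using ENNReal.Tendsto.const_mul h0 (Or.inr hB)
    · intro i
      simp only
      rw [edist_comm, edist_eq_enorm_sub]
      unfold Pot
      rw [← integral_sub (hIn g hg y) (hIn _ (hfL i) y)]
      refine (enorm_integral_le_lintegral_enorm _).trans ?_
      refine le_trans ?_ (mul_le_mul_right (hfd i) B)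
      refine le_trans (le_of_eq ?_) (hb (g - f i) (hg.sub (hfL i)) y)
      congr 1; ext z
      rw [Pi.sub_apply, mul_sub]
  have hle : ∀ x, CN κ (Pot μ Φ g) x ≤ liminf (fun i => CN κ (Pot μ Φ (f i)) x) atTop := by
    intro x
    refine CN_le _ _ _ _ fun y t ht hy => ?_
    have := (hpt y t ht).enorm
    rw [← this.liminf_eq]
    exact liminf_le_liminf (Eventually.of_forall fun i => le_CN κ _ x y t ht hy)
  have hle2 : ∀ x, (CN κ (Pot μ Φ g) x)^p ≤ liminf (fun i => (CN κ (Pot μ Φ (f i)) x)^p) atTop := by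
    intro x
    refine (ENNReal.rpow_le_rpow (hle x) hp0.le).trans (le_of_eq ?_)
    exact Monotone.map_liminf_of_continuousAt (ENNReal.monotone_rpow_of_nonneg hp0.le) _ (ENNReal.continuous_rpow_const.continuousAt)
  refine (lintegral_mono hle2).trans ((lintegral_liminf_le fun i => (CN_meas κ _).pow_const p).trans ?_)
  have hlim : Tendsto (fun i : ℕ => K * (eLpNorm g (oR p) μ + ((i:ℝ≥0∞)+1)⁻¹)^p) atTop (𝓝 (K * (eLpNorm g (oR p) μ + 0)^p)) := by
    refine ENNReal.Tendsto.const_mul ?_ (Or.inr hK)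
    exact (ENNReal.continuous_rpow_const.tendsto _).comp (tendsto_const_nhds.add h0)
  rw [add_zero] at hlim
  rw [← hlim.liminf_eq]
  refine liminf_le_liminf (Eventually.of_forall fun i => ?_)
  refine (h1 (f i) (hfc i) (hfs i)).trans ?_
  rw [← eLpNorm_rp μ p hp]
  refine mul_le_mul_right (ENNReal.rpow_le_rpow ?_ hp0.le) _
  have e : f i = g - (g - f i) := by abel
  calc eLpNorm (f i) (oR p) μ = eLpNorm (g - (g - f i)) (oR p) μ := by rw [← e]
    _ ≤ eLpNorm g (oR p) μ + eLpNorm (g - f i) (oR p) μ := eLpNorm_sub_le hg.1 (hg.1.sub (hfL i).1) hp1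
    _ ≤ _ := by gcongr; exact hfd i
end rot

section up
variable {n : ℕ}

lemma toUp_ap (x : ES (n-1)) (t : ℝ) (i : Fin n) : toUp x t i = if h : (i:ℕ) < n-1 then x ⟨i, h⟩ else t := rfl
lemma toUp_add (x y : ES (n-1)) (t s : ℝ) : toUp (x+y) (t+s) = toUp x t + toUp y s := by
  ext i; rw [PiLp.add_apply, toUp_ap, toUp_ap, toUp_ap]; split_ifs <;> simp
lemma toUp_smul (x : ES (n-1)) (t l : ℝ) : toUp (l • x) (l * t) = l • toUp x t := by
  ext i; rw [PiLp.smul_apply, toUp_ap, toUp_ap]; split_ifs <;> simp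

def toUpL (n : ℕ) : (ES (n-1) × ℝ) →ₗ[ℝ] ES n where
  toFun q := toUp q.1 q.2
  map_add' a b := toUp_add _ _ _ _
  map_smul' l a := by simp [toUp_smul]

lemma toUpL_ap (x : ES (n-1)) (t : ℝ) : toUp x t = LinearMap.toContinuousLinearMap (toUpL n) (x, t) := rfl

lemma toUp_cont : Continuous (fun q : ES (n-1) × ℝ => toUp q.1 q.2) :=
  (LinearMap.toContinuousLinearMap (toUpL n)).continuous

def toUp0 (n : ℕ) : ES (n-1) →L[ℝ] ES n :=
  (LinearMap.toContinuousLinearMap (toUpL n)).comp (ContinuousLinearMap.inl ℝ _ _)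

lemma toUp0_ap (x : ES (n-1)) : toUp0 n x = toUp x 0 := rfl

lemma toUp_norm (hn : 2 ≤ n) (x : ES (n-1)) (t : ℝ) : ‖toUp x t‖^2 = ‖x‖^2 + t^2 := by
  obtain ⟨m, rfl⟩ : ∃ m, n = m + 1 := ⟨n-1, by omega⟩
  rw [EuclideanSpace.norm_sq_eq, EuclideanSpace.norm_sq_eq, Fin.sum_univ_castSucc]
  congr 1
  · refine Finset.sum_congr rfl fun i _ => ?_
    rw [toUp_ap, dif_pos (by simp)]
    rfl
  · rw [toUp_ap, dif_neg (by simp)]; simp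

lemma xlast_eq (hn : 2 ≤ n) (x : ES n) : xlast x = x (lastIdx n (by omega)) := by
  unfold xlast; rw [dif_pos (by omega)]; rfl

lemma xlast_toUp (hn : 2 ≤ n) (x : ES (n-1)) (t : ℝ) : xlast (toUp x t) = t := by
  rw [xlast_eq hn, toUp_ap, dif_neg]; simp [lastIdx]
lemma xinit_toUp (x : ES (n-1)) (t : ℝ) : xinit (toUp x t) = x := by
  ext i
  change (toUp x t) ⟨i, _⟩ = _
  rw [toUp_ap, dif_pos]
lemma toUp_eta (hn : 2 ≤ n) (x : ES n) : toUp (xinit x) (xlast x) = x := by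
  ext i
  rw [toUp_ap]
  split_ifs with h
  · rfl
  · have hi : i = lastIdx n (by omega) := Fin.ext (by simp [lastIdx]; omega)
    rw [xlast_eq hn, ← hi]

lemma toUp_le (hn : 2 ≤ n) (x : ES (n-1)) (t : ℝ) : ‖x‖ ≤ ‖toUp x t‖ ∧ |t| ≤ ‖toUp x t‖ ∧ ‖toUp x t‖ ≤ ‖x‖ + |t| := by
  have := toUp_norm hn x t
  refine ⟨?_, ?_, ?_⟩
  · apply le_of_sq_le_sq _ (norm_nonneg _); nlinarith [sq_nonneg t]
  · apply abs_le_of_sq_le_sq _ (norm_nonneg _); nlinarith [sq_nonneg ‖x‖]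
  · apply le_of_sq_le_sq _ (by positivity); rw [this, ← sq_abs t]; nlinarith [mul_nonneg (norm_nonneg x) (abs_nonneg t)]

lemma sub_toUp (hn : 2 ≤ n) (x : ES n) (y : ES (n-1)) : x - toUp y 0 = toUp (xinit x - y) (xlast x) := by
  rw [sub_eq_iff_eq_add, ← toUp_add, sub_add_cancel, add_zero, toUp_eta hn]

lemma uhs_open (hn : 2 ≤ n) : IsOpen (upperHalfSpace n) := by
  have : upperHalfSpace n = {x | 0 < x (lastIdx n (by omega))} := by
    ext x; simp [upperHalfSpace, xlast_eq hn]
  rw [this]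
  exact isOpen_lt continuous_const (by fun_prop)

lemma sub_ne (hn : 2 ≤ n) (x : ES n) (hx : x ∈ upperHalfSpace n) (y : ES (n-1)) : x - toUp y 0 ≠ 0 := by
  intro h
  have := congrArg xlast h
  rw [sub_toUp hn, xlast_toUp hn, xlast_eq hn 0] at this
  have h2 : 0 < xlast x := hx
  simp at this; linarith
end up

section ker
variable {n : ℕ}
variable {F G : Type*} [NormedAddCommGroup F] [NormedSpace ℝ F] [NormedAddCommGroup G] [NormedSpace ℝ G]

structure Ker (a : ℕ) (Θ : ES n → F) : Prop where
  smooth : ContDiffOn ℝ (⊤ : ℕ∞) Θ {x | x ≠ 0}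
  hom : ∀ (l : ℝ) (x : ES n), 0 < l → x ≠ 0 → Θ (l • x) = (l^a)⁻¹ • Θ x

lemma ne_open : IsOpen {x : ES n | x ≠ 0} := isOpen_ne

lemma Ker.at {a : ℕ} {Θ : ES n → F} (h : Ker a Θ) {x : ES n} (hx : x ≠ 0) : ContDiffAt ℝ (⊤ : ℕ∞) Θ x :=
  h.smooth.contDiffAt (ne_open.mem_nhds hx)
lemma Ker.diff {a : ℕ} {Θ : ES n → F} (h : Ker a Θ) {x : ES n} (hx : x ≠ 0) : DifferentiableAt ℝ Θ x :=
  (h.at hx).differentiableAt (by simp)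

lemma Ker.clm {a : ℕ} {Θ : ES n → F} (h : Ker a Θ) (T : F →L[ℝ] G) : Ker a (fun x => T (Θ x)) where
  smooth := T.contDiff.comp_contDiffOn h.smooth
  hom l x hl hx := by rw [h.hom l x hl hx, map_smul]

lemma Ker.fderiv {a : ℕ} {Θ : ES n → F} (h : Ker a Θ) : Ker (a+1) (fderiv ℝ Θ) where
  smooth := h.smooth.fderiv_of_isOpen ne_open (by simp)
  hom l x hl hx := by
    have hlx : l • x ≠ 0 := smul_ne_zero hl.ne' hx
    have h1 : HasFDerivAt (fun y => Θ (l • y)) ((_root_.fderiv ℝ Θ (l • x)).comp (l • ContinuousLinearMap.id ℝ _)) x :=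
      (h.diff hlx).hasFDerivAt.comp x ((hasFDerivAt_id x).const_smul l)
    have h2 : HasFDerivAt (fun y => (l^a)⁻¹ • Θ y) ((l^a)⁻¹ • _root_.fderiv ℝ Θ x) x := (h.diff hx).hasFDerivAt.const_smul _
    have h3 : (fun y => Θ (l • y)) =ᶠ[𝓝 x] (fun y => (l^a)⁻¹ • Θ y) := by
      filter_upwards [ne_open.mem_nhds hx] with y hy using h.hom l y hl hy
    have h4 := h1.unique (h2.congr_of_eventuallyEq h3)
    ext v
    have h5 := congrArg (fun T => T v) h4
    simp only [ContinuousLinearMap.comp_apply, ContinuousLinearMap.smul_apply, ContinuousLinearMap.id_apply, map_smul] at h5 ⊢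
    rw [pow_succ, mul_inv, mul_comm, mul_smul, ← h5, smul_smul, inv_mul_cancel₀ hl.ne', one_smul]

lemma Ker.pd {a : ℕ} {Θ : ES n → F} (h : Ker a Θ) (r : Fin n) : Ker (a+1) (pd r Θ) :=
  h.fderiv.clm (ContinuousLinearMap.apply ℝ F (EuclideanSpace.single r 1))

lemma Ker.bound {a : ℕ} {Θ : ES n → F} (h : Ker a Θ) : ∃ C, 0 ≤ C ∧ ∀ x, x ≠ 0 → ‖Θ x‖ * ‖x‖^a ≤ C := by
  have hc : ContinuousOn Θ (sphere (0:ES n) 1) := h.smooth.continuousOn.mono fun x hx => by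
    rintro rfl; simp at hx
  obtain ⟨C, hC⟩ := (isCompact_sphere (0:ES n) 1).exists_bound_of_continuousOn hc
  refine ⟨|C|, abs_nonneg _, fun x hx => ?_⟩
  have hx' : 0 < ‖x‖ := norm_pos_iff.2 hx
  have h1 := hC (‖x‖⁻¹ • x) (by simp [norm_smul, hx'.ne'])
  rw [h.hom _ _ (by positivity) hx, norm_smul, norm_inv, norm_pow, norm_inv, norm_norm, inv_pow, inv_inv] at h1
  rw [mul_comm]; exact h1.trans (le_abs_self _)

lemma Ker.lip {a : ℕ} {Θ : ES n → F} (h : Ker a Θ) : ∃ C, 0 ≤ C ∧ ∀ x v, x ≠ 0 → 2 * ‖v‖ ≤ ‖x‖ → ‖Θ (x + v) - Θ x‖ * ‖x‖^(a+1) ≤ C * ‖v‖ := by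
  obtain ⟨C, hC, hb⟩ := h.fderiv.bound
  refine ⟨C * 2^(a+1), by positivity, fun x v hx hv => ?_⟩
  have hx' : 0 < ‖x‖ := norm_pos_iff.2 hx
  have hnear : ∀ z ∈ closedBall x ‖v‖, ‖x‖ ≤ 2 * ‖z‖ := by
    intro z hz
    rw [mem_closedBall, dist_eq_norm] at hz
    have := norm_sub_norm_le x (x - z)
    rw [sub_sub_cancel, norm_sub_rev] at this
    linarith
  have hne : ∀ z ∈ closedBall x ‖v‖, z ≠ 0 := by
    rintro z hz rfl
    have := hnear 0 hz
    simp at this; exact hx this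
  have := (convex_closedBall x ‖v‖).norm_image_sub_le_of_norm_fderiv_le (𝕜 := ℝ) (f := Θ) (C := C * 2^(a+1) / ‖x‖^(a+1)) (fun z hz => h.diff (hne z hz)) (fun z hz => ?_) (mem_closedBall_self (norm_nonneg v)) (show x + v ∈ _ by simp)
  · rw [add_sub_cancel_left, div_mul_eq_mul_div, le_div_iff₀ (by positivity)] at this
    exact this
  · rw [le_div_iff₀ (by positivity)]
    calc _ ≤ ‖_root_.fderiv ℝ Θ z‖ * (2 * ‖z‖)^(a+1) := by gcongr; exact hnear z hz
      _ = (‖_root_.fderiv ℝ Θ z‖ * ‖z‖^(a+1)) * 2^(a+1) := by rw [mul_pow]; ring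
      _ ≤ _ := by gcongr; exact hb z (hne z hz)

end ker

section ker
variable {n : ℕ}

open scoped Classical in
/-- the kernel with value 0 at 0 -/
def Kz (Θ : ES n → ℂ) (x : ES n) : ℂ := if x = 0 then 0 else Θ x

lemma Kz_ne (Θ : ES n → ℂ) {x : ES n} (hx : x ≠ 0) : Kz Θ x = Θ x := if_neg hx
lemma Kz_zero (Θ : ES n → ℂ) : Kz Θ 0 = 0 := if_pos rfl

lemma Kz_meas {a : ℕ} {Θ : ES n → ℂ} (h : Ker a Θ) : Measurable (Kz Θ) := by
  classical
  have := ContinuousOn.measurable_piecewise (f := Θ) (g := fun _ => 0) (s := {x | x ≠ 0}) h.smooth.continuousOn continuousOn_const ne_open.measurableSet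
  convert this using 1
  ext x
  unfold Kz Set.piecewise
  by_cases hx : x = 0 <;> simp [hx]

lemma Ker.czk (hn : 2 ≤ n) {Θ : ES n → ℂ} (h : Ker (n-1) Θ) (hodd : ∀ x, x ≠ 0 → Θ (-x) = - Θ x) :
    ∃ C, CZK (V := ES (n-1)) (fun y t => Kz Θ (toUp y t)) C := by
  obtain ⟨C1, hC1, hb⟩ := h.bound
  obtain ⟨C2, hC2, hl⟩ := h.lip
  have hd : Module.finrank ℝ (ES (n-1)) = n - 1 := by simp
  have hup := fun (y : ES (n-1)) t => toUp_le hn y t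
  have hmeas : ∀ t, Measurable fun y : ES (n-1) => Kz Θ (toUp y t) := fun t =>
    (Kz_meas h).comp (toUp_cont.comp (by fun_prop : Continuous fun y : ES (n-1) => (y, t))).measurable
  have h0 : ∀ y : ES (n-1), toUp y 0 = 0 ↔ y = 0 := by
    intro y
    constructor
    · intro hy
      have := (hup y 0).1
      rw [hy, norm_zero] at this
      exact norm_le_zero_iff.1 this
    · rintro rfl; exact (toUp0 n).map_zero
  refine ⟨C1 * 2^(n-1) + C2, hmeas, ?_, ?_, hmeas 0, ?_, ?_, ?_⟩
  · intro y t ht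
    have hne : toUp y t ≠ 0 := by
      intro h; have := (hup y t).2.1; rw [h, norm_zero, abs_of_pos ht] at this; linarith
    rw [Kz_ne _ hne, hd]
    obtain ⟨e1, e2, _⟩ := hup y t
    rw [abs_of_pos ht] at e2
    calc _ ≤ ‖Θ (toUp y t)‖ * (2 * ‖toUp y t‖)^(n-1) := by gcongr; linarith
      _ = (‖Θ (toUp y t)‖ * ‖toUp y t‖^(n-1)) * 2^(n-1) := by rw [mul_pow]; ring
      _ ≤ C1 * 2^(n-1) := by gcongr; exact hb _ hne
      _ ≤ _ := by linarith
  · intro y v t ht hy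
    have hypos : 0 < ‖y‖ := by linarith [norm_nonneg v]
    have hy0 : ‖toUp y 0‖ = ‖y‖ := by
      have := hup y 0; simp at this; exact le_antisymm this.2 this.1
    have hne : toUp y 0 ≠ 0 := by rw [Ne, h0]; exact norm_pos_iff.1 hypos
    have hvt := (hup v t).2.2
    rw [abs_of_pos ht] at hvt
    have e1 : toUp (y + v) t = toUp y 0 + toUp v t := by rw [← toUp_add, zero_add]
    have hne2 : toUp (y+v) t ≠ 0 := by
      intro h; have := (hup (y+v) t).2.1; rw [h, norm_zero, abs_of_pos ht] at this; linarith
    rw [Kz_ne _ hne, Kz_ne _ hne2, hd, e1]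
    have := hl (toUp y 0) (toUp v t) hne (by rw [hy0]; linarith)
    rw [hy0] at this
    refine this.trans ?_
    have : 0 ≤ C1 * 2^(n-1) := by positivity
    have : 0 ≤ ‖v‖ + t := by positivity
    nlinarith [norm_nonneg (toUp v t)]
  · intro z
    have e : toUp (-z) 0 = - toUp z 0 := (toUp0 n).map_neg z
    rw [e]
    by_cases hz : toUp z 0 = 0
    · rw [hz, neg_zero, Kz_zero, neg_zero]
    · rw [Kz_ne _ hz, Kz_ne _ (neg_ne_zero.2 hz), hodd _ hz]
  · intro l z hl
    have e : toUp (l • z) 0 = l • toUp z 0 := (toUp0 n).map_smul l z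
    rw [e, hd]
    by_cases hz : toUp z 0 = 0
    · rw [hz, smul_zero, Kz_zero, mul_zero]
    · rw [Kz_ne _ hz, Kz_ne _ (smul_ne_zero hl.ne' hz), h.hom l _ hl hz, Complex.real_smul]
  · intro z
    rw [hd]
    by_cases hz : toUp z 0 = 0
    · rw [hz, Kz_zero, norm_zero, zero_mul]; positivity
    · rw [Kz_ne _ hz]
      calc _ ≤ ‖Θ (toUp z 0)‖ * ‖toUp z 0‖^(n-1) := by gcongr; exact (hup z 0).1
        _ ≤ C1 := hb _ hz
        _ ≤ C1 * 2^(n-1) := le_mul_of_one_le_right hC1 (one_le_pow₀ (by norm_num))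
        _ ≤ _ := by linarith

/-- potential -/
def PT (Θ : ES n → ℂ) (f : ES (n-1) → ℂ) (x : ES n) : ℂ := ∫ y, Θ (x - toUp y 0) * f y

lemma PT_Pot (hn : 2 ≤ n) (Θ : ES n → ℂ) (f : ES (n-1) → ℂ) (y : ES (n-1)) (t : ℝ) (ht : 0 < t) :
    PT Θ f (toUp y t) = Pot volume (fun y t => Kz Θ (toUp y t)) f y t := by
  unfold PT Pot
  congr 1; ext z
  have : toUp y t - toUp z 0 ≠ 0 := sub_ne hn _ (by simp [upperHalfSpace, xlast_toUp hn, ht]) z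
  rw [← Kz_ne Θ this]
  rw [sub_toUp hn, xlast_toUp hn, xinit_toUp]

lemma ker_loc (hn : 2 ≤ n) {F : Type*} [NormedAddCommGroup F] [NormedSpace ℝ F] {a : ℕ} {Θ : ES n → F} (h : Ker a Θ) (ha : n - 1 ≤ a) (x0 : ES n) (hx0 : x0 ∈ upperHalfSpace n) :
    ∃ C, 0 ≤ C ∧ ∀ x ∈ ball x0 (xlast x0 / 2), x ∈ upperHalfSpace n ∧ ∀ y, ‖Θ (x - toUp y 0)‖ ≤ C * ((1 + ‖y‖)^(n-1))⁻¹ := by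
  obtain ⟨C, hC, hb⟩ := h.bound
  have ht : 0 < xlast x0 := hx0
  set t := xlast x0 with htd
  set L := 2 * ((1 + ‖xinit x0‖) / t + 1) with hL
  have hL0 : 0 ≤ L := by positivity
  refine ⟨C * L^a, by positivity, fun x hx => ?_⟩
  rw [mem_ball, dist_eq_norm] at hx
  have hxu : x ∈ upperHalfSpace n := by
    have h1 := (toUp_le hn (xinit (x - x0)) (xlast (x - x0))).2.1
    rw [toUp_eta hn] at h1
    have h2 : xlast (x - x0) = xlast x - t := by
      rw [htd, xlast_eq hn, xlast_eq hn, xlast_eq hn]; simp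
    rw [h2] at h1
    have := abs_le.1 (h1.trans hx.le)
    show 0 < xlast x
    linarith [this.1]
  refine ⟨hxu, fun y => ?_⟩
  have hne := sub_ne hn x hxu y
  have hpos : 0 < ‖x - toUp y 0‖ := norm_pos_iff.2 hne
  obtain ⟨e1, e2, _⟩ := toUp_le hn (xinit x0 - y) (xlast x0)
  rw [← sub_toUp hn, ← htd, abs_of_pos ht] at e2
  rw [← sub_toUp hn] at e1
  have e3 : ‖x0 - toUp y 0‖ ≤ 2 * ‖x - toUp y 0‖ := by
    have : ‖x0 - toUp y 0‖ ≤ ‖x - toUp y 0‖ + ‖x - x0‖ := by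
      have := norm_sub_le (x - toUp y 0) (x - x0)
      rwa [show x - toUp y 0 - (x - x0) = x0 - toUp y 0 by abel] at this
    linarith
  have e4 : 1 + ‖y‖ ≤ L * ‖x - toUp y 0‖ := by
    have e5 : ‖y‖ ≤ ‖xinit x0‖ + ‖xinit x0 - y‖ := by
      have := norm_sub_le (xinit x0) (xinit x0 - y); rwa [sub_sub_cancel] at this
    have e6 : (1 + ‖xinit x0‖) ≤ (1 + ‖xinit x0‖) / t * ‖x0 - toUp y 0‖ := by
      rw [div_mul_eq_mul_div, le_div_iff₀ ht]
      gcongr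
    have e7 : 0 ≤ (1 + ‖xinit x0‖) / t := by positivity
    rw [hL]
    nlinarith
  rw [← div_eq_mul_inv, le_div_iff₀ (by positivity)]
  calc _ ≤ ‖Θ (x - toUp y 0)‖ * (1 + ‖y‖)^a := by
        gcongr
        linarith [norm_nonneg y]
    _ ≤ ‖Θ (x - toUp y 0)‖ * (L * ‖x - toUp y 0‖)^a := by gcongr
    _ = (‖Θ (x - toUp y 0)‖ * ‖x - toUp y 0‖^a) * L^a := by rw [mul_pow]; ring
    _ ≤ _ := by gcongr; exact hb _ hne

/-- weight integrability -/
lemma wt_int (hn : 2 ≤ n) (p : ℝ) (hp : 1 < p) (f : ES (n-1) → ℂ) (hf : MemLp f (oR p)) :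
    Integrable (fun y => ((1 + ‖y‖)^(n-1))⁻¹ * ‖f y‖) := by
  have hd : Module.finrank ℝ (ES (n-1)) = n - 1 := by simp
  have := (Pot_int (V := ES (n-1)) volume p hp (fun z => ((((1 + ‖z‖)^(n-1))⁻¹ : ℝ) : ℂ)) (by fun_prop) 1 (fun z => ?_) (by rw [hd]; omega)).1 f hf 0
  · refine this.norm.congr (Eventually.of_forall fun y => ?_)
    simp only
    rw [norm_mul, Complex.norm_real, Real.norm_of_nonneg (by positivity), zero_sub, norm_neg]
  · skip
    rw [Complex.norm_real, Real.norm_of_nonneg (by positivity), hd, inv_mul_cancel₀ (by positivity)]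

lemma ker_sm (hn : 2 ≤ n) {F : Type*} [NormedAddCommGroup F] [NormedSpace ℝ F] {a : ℕ} {Θ : ES n → F} (h : Ker a Θ) (x : ES n) (hx : x ∈ upperHalfSpace n) :
    ContDiff ℝ (⊤ : ℕ∞) (fun y => Θ (x - toUp y 0)) := by
  rw [contDiff_iff_contDiffAt]
  intro y
  have : ContDiff ℝ (⊤ : ℕ∞) (fun y => x - toUp0 n y) := contDiff_const.sub (toUp0 n).contDiff
  exact ContDiffAt.comp y (g := Θ) (f := fun y => x - toUp0 n y) (h.at (sub_ne hn x hx y)) this.contDiffAt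

lemma PT_int (hn : 2 ≤ n) (p : ℝ) (hp : 1 < p) {a : ℕ} {Θ : ES n → ℂ} (h : Ker a Θ) (ha : n - 1 ≤ a) (f : ES (n-1) → ℂ) (hf : MemLp f (oR p)) (x : ES n) (hx : x ∈ upperHalfSpace n) :
    Integrable (fun y => Θ (x - toUp y 0) * f y) := by
  obtain ⟨C, hC, hb⟩ := ker_loc hn h ha x hx
  refine ((wt_int hn p hp f hf).const_mul C).mono' ((ker_sm hn h x hx).continuous.aestronglyMeasurable.mul hf.1) (Eventually.of_forall fun y => ?_)
  rw [norm_mul, ← mul_assoc]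
  gcongr
  have ht : 0 < xlast x := hx
  exact (hb x (mem_ball_self (by linarith))).2 y

lemma PT_fderiv (hn : 2 ≤ n) (p : ℝ) (hp : 1 < p) {a : ℕ} {Θ : ES n → ℂ} (h : Ker a Θ) (ha : n - 1 ≤ a) (f : ES (n-1) → ℂ) (hf : MemLp f (oR p)) (x : ES n) (hx : x ∈ upperHalfSpace n) :
    DifferentiableAt ℝ (PT Θ f) x ∧ ∀ r, pd r (PT Θ f) x = PT (pd r Θ) f x := by
  have ht : 0 < xlast x := hx
  obtain ⟨C, hC, hb⟩ := ker_loc hn h.fderiv (by omega) x hx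
  have hm : AEStronglyMeasurable (fun y => f y • fderiv ℝ Θ (x - toUp y 0)) volume := hf.1.smul (ker_sm hn h.fderiv x hx).continuous.aestronglyMeasurable
  have hbd : ∀ z ∈ ball x (xlast x / 2), ∀ y, ‖f y • fderiv ℝ Θ (z - toUp y 0)‖ ≤ C * (((1 + ‖y‖)^(n-1))⁻¹ * ‖f y‖) := by
    intro z hz y
    rw [norm_smul, mul_comm, ← mul_assoc]
    gcongr
    exact (hb z hz).2 y
  have key := hasFDerivAt_integral_of_dominated_of_fderiv_le (μ := volume) (F := fun z y => Θ (z - toUp y 0) * f y) (F' := fun z y => f y • fderiv ℝ Θ (z - toUp y 0)) (x₀ := x) (s := ball x (xlast x / 2)) (bound := fun y => C * (((1 + ‖y‖)^(n-1))⁻¹ * ‖f y‖))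
    (ball_mem_nhds x (by linarith)) ?_ (PT_int hn p hp h ha f hf x hx) hm (Eventually.of_forall fun y z hz => hbd z hz y) ((wt_int hn p hp f hf).const_mul C) (Eventually.of_forall fun y z hz => ?_)
  · refine ⟨key.differentiableAt, fun r => ?_⟩
    have hIn : Integrable (fun y => f y • fderiv ℝ Θ (x - toUp y 0)) :=
      ((wt_int hn p hp f hf).const_mul C).mono' hm (Eventually.of_forall fun y => hbd x (mem_ball_self (by linarith)) y)
    have := key.fderiv
    unfold pd
    rw [show PT Θ f = fun x => ∫ y, Θ (x - toUp y 0) * f y from rfl, this, ContinuousLinearMap.integral_apply hIn]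
    unfold PT
    congr 1; ext y
    rw [ContinuousLinearMap.smul_apply, smul_eq_mul, mul_comm]
  · filter_upwards [(uhs_open hn).mem_nhds hx] with z hz
    exact (PT_int hn p hp h ha f hf z hz).1
  · have h1 := (h.diff (sub_ne hn z (hb z hz).1 y)).hasFDerivAt
    have h2 : HasFDerivAt (fun z => z - toUp y 0) (ContinuousLinearMap.id ℝ (ES n)) z := (hasFDerivAt_id z).sub_const _
    have h3 := (HasFDerivAt.comp z h1 h2).mul_const (f y)
    simpa using h3

lemma PT_smooth (hn : 2 ≤ n) (p : ℝ) (hp : 1 < p) (f : ES (n-1) → ℂ) (hf : MemLp f (oR p)) (k : ℕ) :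
    ∀ {a : ℕ} {Θ : ES n → ℂ} (h : Ker a Θ) (ha : n - 1 ≤ a), ContDiffOn ℝ k (PT Θ f) (upperHalfSpace n) := by
  induction k with
  | zero =>
    intro a Θ h ha
    rw [Nat.cast_zero, contDiffOn_zero]
    exact fun x hx => (PT_fderiv hn p hp h ha f hf x hx).1.continuousAt.continuousWithinAt
  | succ k ih =>
    intro a Θ h ha
    have hd : DifferentiableOn ℝ (PT Θ f) (upperHalfSpace n) := fun x hx => (PT_fderiv hn p hp h ha f hf x hx).1.differentiableWithinAt
    rw [show ((k+1 : ℕ) : WithTop ℕ∞) = (k : WithTop ℕ∞) + 1 by push_cast; rfl, contDiffOn_succ_iff_fderiv_of_isOpen (uhs_open hn)]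
    refine ⟨hd, by simp, ?_⟩
    have : ContDiffOn ℝ k (fun x => ∑ r, (PT (pd r Θ) f x) • ((Complex.ofRealCLM.comp (EuclideanSpace.proj r : ES n →L[ℝ] ℝ)) : ES n →L[ℝ] ℂ)) (upperHalfSpace n) := by
      refine ContDiffOn.sum fun r _ => ?_
      exact (ih (h.pd r) (by omega)).smul contDiffOn_const
    refine this.congr fun x hx => ?_
    ext v
    have hv : v = ∑ r, v r • (EuclideanSpace.single r (1:ℝ)) := by
      ext i; simp [Finset.sum_apply, Pi.single_apply]
    conv_lhs => rw [hv]
    rw [map_sum, ContinuousLinearMap.sum_apply]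
    refine Finset.sum_congr rfl fun r _ => ?_
    rw [map_smul, ← (PT_fderiv hn p hp h ha f hf x hx).2 r]
    simp [pd, mul_comm]
end ker

section weak
variable {m : ℕ}

lemma Cc_int (p : ℝ) (hp : 1 < p) (φ h : ES m → ℂ) (hφ : Continuous φ) (hφs : HasCompactSupport φ) (hh : MemLp h (oR p)) : Integrable (fun y => φ y * h y) := by
  obtain ⟨q, hq, hpq⟩ := HC_of p hp
  exact (hφ.memLp_of_hasCompactSupport (p := oR q) hφs).integrable_mul hh

lemma pd_cont {F : Type*} [NormedAddCommGroup F] [NormedSpace ℝ F] (j : Fin m) (φ : ES m → F) (hφ : ContDiff ℝ (⊤ : ℕ∞) φ) : ContDiff ℝ (⊤ : ℕ∞) (pd j φ) := by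
  unfold pd
  exact (hφ.fderiv_right (by simp)).clm_apply contDiff_const

lemma pd_supp {F : Type*} [NormedAddCommGroup F] [NormedSpace ℝ F] (j : Fin m) (φ : ES m → F) (hφ : HasCompactSupport φ) : HasCompactSupport (pd j φ) :=
  hφ.fderiv_apply (𝕜 := ℝ) _

def WD (j : Fin m) (h hj : ES m → ℂ) : Prop :=
  ∀ φ : ES m → ℝ, ContDiff ℝ (⊤ : ℕ∞) φ → HasCompactSupport φ → ∫ x, ((pd j φ x : ℝ) : ℂ) * h x = - ∫ x, ((φ x : ℝ) : ℂ) * hj x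

lemma pd_clm {F G : Type*} [NormedAddCommGroup F] [NormedSpace ℝ F] [NormedAddCommGroup G] [NormedSpace ℝ G] (T : F →L[ℝ] G) (j : Fin m) (φ : ES m → F) (x) (hφ : DifferentiableAt ℝ φ x) :
    pd j (fun y => T (φ y)) x = T (pd j φ x) := by
  unfold pd
  have := (T.hasFDerivAt.comp x hφ.hasFDerivAt).fderiv
  change (fderiv ℝ (T ∘ φ) x) _ = _
  rw [this]; rfl

lemma WD_cplx (p : ℝ) (hp : 1 < p) (j : Fin m) (h hj : ES m → ℂ) (hh : MemLp h (oR p)) (hhj : MemLp hj (oR p)) (hw : WD j h hj)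
    (φ : ES m → ℂ) (hφ : ContDiff ℝ (⊤ : ℕ∞) φ) (hφs : HasCompactSupport φ) : ∫ x, pd j φ x * h x = - ∫ x, φ x * hj x := by
  have hd : ∀ x, DifferentiableAt ℝ φ x := fun x => hφ.contDiffAt.differentiableAt (by simp)
  have key : ∀ (T : ℂ →L[ℝ] ℝ), Integrable (fun x => ((pd j (fun y => T (φ y)) x : ℝ) : ℂ) * h x) ∧ Integrable (fun x => ((T (φ x) : ℝ) : ℂ) * hj x) ∧
     ∫ x, ((pd j (fun y => T (φ y)) x : ℝ) : ℂ) * h x = - ∫ x, ((T (φ x) : ℝ) : ℂ) * hj x := by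
    intro T
    have c1 : ContDiff ℝ (⊤ : ℕ∞) (fun y => T (φ y)) := T.contDiff.comp hφ
    have s1 : HasCompactSupport (fun y => T (φ y)) := hφs.comp_left (g := T) (map_zero T)
    refine ⟨?_, ?_, hw _ c1 s1⟩
    · exact Cc_int p hp (fun x => ((pd j (fun y => T (φ y)) x : ℝ) : ℂ)) h (Complex.continuous_ofReal.comp (pd_cont j _ c1).continuous) ((pd_supp j _ s1).comp_left (g := Complex.ofReal) rfl) hh
    · exact Cc_int p hp (fun x => ((T (φ x) : ℝ) : ℂ)) hj (Complex.continuous_ofReal.comp c1.continuous) (s1.comp_left (g := Complex.ofReal) rfl) hhj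
  obtain ⟨a1, a2, a3⟩ := key Complex.reCLM
  obtain ⟨b1, b2, b3⟩ := key Complex.imCLM
  have e1 : ∫ x, pd j φ x * h x = (∫ x, ((pd j (fun y => Complex.reCLM (φ y)) x : ℝ) : ℂ) * h x) + (∫ x, ((pd j (fun y => Complex.imCLM (φ y)) x : ℝ) : ℂ) * h x) * Complex.I := by
    rw [← integral_mul_const, ← integral_add a1 (b1.mul_const _)]
    congr 1; ext x
    rw [pd_clm _ _ _ _ (hd x), pd_clm _ _ _ _ (hd x)]
    have := Complex.re_add_im (pd j φ x)
    simp only [Complex.reCLM_apply, Complex.imCLM_apply]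
    linear_combination (- h x) * this
  have e2 : ∫ x, φ x * hj x = (∫ x, ((Complex.reCLM (φ x) : ℝ) : ℂ) * hj x) + (∫ x, ((Complex.imCLM (φ x) : ℝ) : ℂ) * hj x) * Complex.I := by
    rw [← integral_mul_const, ← integral_add a2 (b2.mul_const _)]
    congr 1; ext x
    have := Complex.re_add_im (φ x)
    simp only [Complex.reCLM_apply, Complex.imCLM_apply]
    linear_combination (- hj x) * this
  rw [e1, e2, a3, b3]; ring

lemma WD_wt (p : ℝ) (hp : 1 < p) (j : Fin m) (h hj : ES m → ℂ) (hh : MemLp h (oR p)) (hhj : MemLp hj (oR p)) (hw : WD j h hj)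
    (w : ES m → ℝ) (hi1 : Integrable (fun y => w y * ‖h y‖)) (hi2 : Integrable (fun y => w y * ‖hj y‖))
    (ψ : ES m → ℂ) (hψ : ContDiff ℝ (⊤ : ℕ∞) ψ) (hb1 : ∀ y, ‖ψ y‖ ≤ w y) (hb2 : ∀ y, ‖pd j ψ y‖ ≤ w y) :
    ∫ x, pd j ψ x * h x = - ∫ x, ψ x * hj x := by
  let χ : ContDiffBump (0 : ES m) := ⟨1, 2, one_pos, one_lt_two⟩
  have hχ : ContDiff ℝ (⊤ : ℕ∞) χ := χ.contDiff
  have hχs : HasCompactSupport χ := χ.hasCompactSupport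
  obtain ⟨B, hB⟩ := (pd_supp j χ hχs).exists_bound_of_continuous (pd_cont j χ hχ).continuous
  have hB0 : 0 ≤ B := (norm_nonneg _).trans (hB 0)
  have hχ1 : ∀ y, |χ y| ≤ 1 := fun y => abs_le.2 ⟨by linarith [χ.nonneg (x := y)], χ.le_one⟩
  let ε : ℕ → ℝ := fun k => 1 / ((k:ℝ) + 1)
  have hε : Tendsto ε atTop (𝓝 0) := tendsto_one_div_add_atTop_nhds_zero_nat
  have hεpos : ∀ k, 0 < ε k := fun k => by positivity
  have hε1 : ∀ k, ε k ≤ 1 := fun k => by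
    simp only [ε]; rw [div_le_one (by positivity)]; linarith [(Nat.cast_nonneg k : (0:ℝ) ≤ k)]
  let φ : ℕ → ES m → ℂ := fun k y => ((χ (ε k • y) : ℝ) : ℂ) * ψ y
  have hφ : ∀ k, ContDiff ℝ (⊤ : ℕ∞) (φ k) := by
    intro k
    have h1 : ContDiff ℝ (⊤ : ℕ∞) (fun y : ES m => χ (ε k • y)) := hχ.comp (contDiff_const_smul _)
    exact (Complex.ofRealCLM.contDiff.comp h1).mul hψ
  have hφs : ∀ k, HasCompactSupport (φ k) := by
    intro k
    have h1 : HasCompactSupport (fun y : ES m => χ (ε k • y)) := hχs.comp_smul (hεpos k).ne'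
    exact (h1.comp_left (g := Complex.ofReal) rfl).mul_right
  have hpd : ∀ k y, pd j (φ k) y = ((ε k * pd j χ (ε k • y) : ℝ) : ℂ) * ψ y + ((χ (ε k • y) : ℝ) : ℂ) * pd j ψ y := by
    intro k y
    have d1 : HasFDerivAt (fun y : ES m => ε k • y) (ε k • ContinuousLinearMap.id ℝ _) y :=
      (ε k • ContinuousLinearMap.id ℝ (ES m)).hasFDerivAt
    have d2 : HasFDerivAt χ (fderiv ℝ χ (ε k • y)) (ε k • y) := (hχ.contDiffAt.differentiableAt (by simp)).hasFDerivAt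
    have d3 := Complex.ofRealCLM.hasFDerivAt.comp y (d2.comp y d1)
    have d4 : HasFDerivAt ψ (fderiv ℝ ψ y) y := (hψ.contDiffAt.differentiableAt (by simp)).hasFDerivAt
    have d5 := (HasFDerivAt.fun_mul d3 d4).fderiv
    unfold pd
    change (fderiv ℝ (fun y => ((χ (ε k • y) : ℝ) : ℂ) * ψ y) y) _ = _
    simp only [Function.comp_def, Complex.ofRealCLM_apply] at d5
    rw [d5]
    simp
    ring
  have hχ0 : ∀ y, Tendsto (fun k => ((χ (ε k • y) : ℝ) : ℂ)) atTop (𝓝 1) := by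
    intro y
    have h1 : Tendsto (fun k => ε k • y) atTop (𝓝 ((0:ℝ) • y)) := hε.smul_const y
    rw [zero_smul] at h1
    have h2 := (hχ.continuous.tendsto 0).comp h1
    have h3 : χ (0 : ES m) = 1 := χ.one_of_mem_closedBall (by simp [χ])
    rw [h3] at h2
    have := (Complex.continuous_ofReal.tendsto 1).comp h2
    rw [Complex.ofReal_one] at this
    exact this
  have L1 : Tendsto (fun k => ∫ x, pd j (φ k) x * h x) atTop (𝓝 (∫ x, pd j ψ x * h x)) := by
    refine tendsto_integral_of_dominated_convergence (fun y => (B + 1) * (w y * ‖h y‖)) ?_ (hi1.const_mul _) ?_ ?_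
    · intro k
      exact (pd_cont j _ (hφ k)).continuous.aestronglyMeasurable.mul hh.1
    · intro k
      refine Eventually.of_forall fun y => ?_
      have hw0 : 0 ≤ w y := (norm_nonneg _).trans (hb1 y)
      rw [norm_mul, ← mul_assoc]
      refine mul_le_mul_of_nonneg_right ?_ (norm_nonneg _)
      rw [hpd]
      refine (norm_add_le _ _).trans ?_
      rw [norm_mul, norm_mul, Complex.norm_real, Complex.norm_real, add_mul, norm_mul, Real.norm_of_nonneg (hεpos k).le]
      refine add_le_add (mul_le_mul ?_ (hb1 y) (norm_nonneg _) hB0) (mul_le_mul (hχ1 _) (hb2 y) (norm_nonneg _) zero_le_one)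
      calc _ ≤ 1 * B := mul_le_mul (hε1 k) (hB _) (norm_nonneg _) zero_le_one
        _ = B := one_mul _
    · refine Eventually.of_forall fun y => ?_
      refine Tendsto.mul_const _ ?_
      simp_rw [hpd]
      rw [show 𝓝 (pd j ψ y) = 𝓝 (0 * ψ y + 1 * pd j ψ y) by simp]
      refine Tendsto.add (Tendsto.mul_const _ ?_) ((hχ0 y).mul_const _)
      rw [tendsto_zero_iff_norm_tendsto_zero]
      refine squeeze_zero (fun _ => norm_nonneg _) (g := fun k => ε k * B) (fun k => ?_) (by simpa using hε.mul_const B)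
      rw [Complex.norm_real, norm_mul, Real.norm_of_nonneg (hεpos k).le]
      exact mul_le_mul_of_nonneg_left (hB _) (hεpos k).le
  have L2 : Tendsto (fun k => ∫ x, φ k x * hj x) atTop (𝓝 (∫ x, ψ x * hj x)) := by
    refine tendsto_integral_of_dominated_convergence (fun y => w y * ‖hj y‖) ?_ hi2 ?_ ?_
    · intro k
      exact (hφ k).continuous.aestronglyMeasurable.mul hhj.1
    · intro k
      refine Eventually.of_forall fun y => ?_
      rw [norm_mul]
      refine mul_le_mul_of_nonneg_right ?_ (norm_nonneg _)
      simp only [φ]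
      rw [norm_mul, Complex.norm_real]
      calc _ ≤ 1 * w y := mul_le_mul (hχ1 _) (hb1 y) (norm_nonneg _) zero_le_one
        _ = w y := one_mul _
    · refine Eventually.of_forall fun y => ?_
      refine Tendsto.mul_const _ ?_
      simpa using (hχ0 y).mul_const (ψ y)
  have L3 : ∀ k, ∫ x, pd j (φ k) x * h x = - ∫ x, φ k x * hj x := fun k => WD_cplx p hp j h hj hh hhj hw _ (hφ k) (hφs k)
  simp_rw [L3] at L1
  exact tendsto_nhds_unique L1 L2.neg
end weak

section tr
variable {n : ℕ}

lemma toUp0_single (j : Fin (n-1)) : toUp (EuclideanSpace.single j (1:ℝ)) 0 = EuclideanSpace.single (finUp j) (1:ℝ) := by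
  ext i
  rw [toUp_ap]
  simp only [PiLp.single_apply]
  have e : i = finUp j ↔ (i : ℕ) = j := by rw [Fin.ext_iff]; rfl
  by_cases h1 : (i : ℕ) < n - 1
  · simp [h1, e, Fin.ext_iff]
  · have : ¬ ((i : ℕ) = j) := by have := j.isLt; omega
    simp [h1, e, this]

lemma PT_transfer (hn : 2 ≤ n) (p : ℝ) (hp : 1 < p) {a : ℕ} {Θ : ES n → ℂ} (h : Ker a Θ) (ha : n - 1 ≤ a) (j : Fin (n-1)) (f fj : ES (n-1) → ℂ) (hf : MemLp f (oR p)) (hfj : MemLp fj (oR p))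
    (hw : WD j f fj) (x : ES n) (hx : x ∈ upperHalfSpace n) :
    PT (pd (finUp j) Θ) f x = PT Θ fj x := by
  obtain ⟨C1, hC1, hb1⟩ := ker_loc hn h ha x hx
  obtain ⟨C2, hC2, hb2⟩ := ker_loc hn (h.pd (finUp j)) (by omega) x hx
  have ht : 0 < xlast x := hx
  have hxb := mem_ball_self (x := x) (ε := xlast x / 2) (by linarith)
  have hpd : ∀ y, pd j (fun y => Θ (x - toUp y 0)) y = - pd (finUp j) Θ (x - toUp y 0) := by
    intro y
    have d1 : HasFDerivAt (fun y => x - toUp0 n y) (- toUp0 n) y := (toUp0 n).hasFDerivAt.const_sub x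
    have d2 : HasFDerivAt Θ (fderiv ℝ Θ (x - toUp0 n y)) (x - toUp0 n y) := (h.diff (sub_ne hn x hx y)).hasFDerivAt
    have d3 := (d2.comp y d1).fderiv
    unfold pd
    change (fderiv ℝ (Θ ∘ (fun y => x - toUp0 n y)) y) _ = _
    rw [d3]
    simp only [ContinuousLinearMap.comp_apply, ContinuousLinearMap.neg_apply, map_neg]
    simp only [toUp0_ap, toUp0_single]
  have key := WD_wt p hp j f fj hf hfj hw (fun y => (C1 + C2) * ((1 + ‖y‖)^(n-1))⁻¹) ?_ ?_ (fun y => Θ (x - toUp y 0)) (ker_sm hn h x hx) ?_ ?_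
  · simp_rw [hpd, neg_mul, integral_neg] at key
    exact neg_injective key
  · simpa only [mul_assoc] using (wt_int hn p hp f hf).const_mul (C1 + C2)
  · simpa only [mul_assoc] using (wt_int hn p hp fj hfj).const_mul (C1 + C2)
  · intro y
    refine ((hb1 x hxb).2 y).trans ?_
    gcongr; linarith
  · intro y
    rw [hpd, norm_neg]
    refine ((hb2 x hxb).2 y).trans ?_
    gcongr; linarith
end tr

section pde
variable {n : ℕ}

lemma mul_cs (F χ : ES n → ℂ) (hF : ContinuousOn F {x | x ≠ 0}) (hχ : Continuous χ) (hc : HasCompactSupport χ) (hs : tsupport χ ⊆ {x | x ≠ 0}) :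
    Integrable (fun x => F x * χ x) := by
  refine Continuous.integrable_of_hasCompactSupport ?_ hc.mul_left
  refine continuous_of_tsupport fun x hx => ?_
  have : x ≠ 0 := hs (tsupport_mul_subset_right hx)
  exact (hF.continuousAt (ne_open.mem_nhds this)).mul hχ.continuousAt

lemma pd_on (r : Fin n) (F : ES n → ℂ) (hF : ContDiffOn ℝ (⊤ : ℕ∞) F {x | x ≠ 0}) : ContDiffOn ℝ (⊤ : ℕ∞) (pd r F) {x | x ≠ 0} :=
  (hF.fderiv_of_isOpen ne_open (by simp)).clm_apply contDiffOn_const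

lemma pd_ts (r : Fin n) (χ : ES n → ℂ) : tsupport (pd r χ) ⊆ tsupport χ :=
  tsupport_fderiv_apply_subset ℝ _

lemma ibp (r : Fin n) (F ψ : ES n → ℂ) (hF : ContDiffOn ℝ (⊤ : ℕ∞) F {x | x ≠ 0}) (hψ : ContDiff ℝ (⊤ : ℕ∞) ψ) (hc : HasCompactSupport ψ) (hs : tsupport ψ ⊆ {x | x ≠ 0}) :
    ∫ x, F x * pd r ψ x = - ∫ x, pd r F x * ψ x := by
  refine integral_mul_fderiv_eq_neg_fderiv_mul_of_integrable (𝕜 := ℂ) ?_ ?_ ?_ ?_ ?_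
  · exact mul_cs (pd r F) ψ (pd_on r F hF).continuousOn hψ.continuous hc hs
  · exact mul_cs F (pd r ψ) hF.continuousOn (pd_cont r ψ hψ).continuous (pd_supp r ψ hc) ((pd_ts r ψ).trans hs)
  · exact mul_cs F ψ hF.continuousOn hψ.continuous hc hs
  · exact fun x hx => (hF.contDiffAt (ne_open.mem_nhds (hs hx))).differentiableAt (by simp)
  · exact fun x _ => hψ.contDiffAt.differentiableAt (by simp)

variable {M : ℕ} (A : Fin n → Fin n → Fin M → Fin M → ℂ) (E : ES n → Matrix (Fin M) (Fin M) ℂ)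

lemma pde0 (hEs : ∀ γ β : Fin M,
      ContDiffOn ℝ (⊤ : ℕ∞) (fun x => E x γ β) {x : ES n | x ≠ 0})
    (hEfund : ∀ φ : ES n → EuclideanSpace ℂ (Fin M),
      ContDiff ℝ (⊤ : ℕ∞) φ → HasCompactSupport φ → ∀ β : Fin M,
        (∫ x : ES n,
            ∑ γ, E x γ β * ∑ α, ∑ r, ∑ s, A r s α γ * pd r (pd s (fun y => φ y α)) x)
          = φ 0 β) (α β : Fin M) (x : ES n) (hx : x ≠ 0) :
    ∑ γ, ∑ r, ∑ s, A r s α γ * pd s (pd r (fun y => E y γ β)) x = 0 := by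
  have hc2 : ∀ γ r s, ContDiffOn ℝ (⊤ : ℕ∞) (pd s (pd r (fun y => E y γ β))) {x | x ≠ 0} := fun γ r s => pd_on s _ (pd_on r _ (hEs γ β))
  have hcont : ContinuousOn (fun x => ∑ γ, ∑ r, ∑ s, A r s α γ * pd s (pd r (fun y => E y γ β)) x) {x | x ≠ 0} := by
    refine continuousOn_finsetSum _ fun γ _ => continuousOn_finsetSum _ fun r _ => continuousOn_finsetSum _ fun s _ => ?_
    exact continuousOn_const.mul (hc2 γ r s).continuousOn
  have hae := ne_open.ae_eq_zero_of_integral_contDiff_smul_eq_zero (μ := volume) (hcont.locallyIntegrableOn ne_open.measurableSet) ?_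
  · have := Measure.eqOn_open_of_ae_eq (μ := volume) (f := fun x => ∑ γ, ∑ r, ∑ s, A r s α γ * pd s (pd r (fun y => E y γ β)) x) (g := fun _ => 0) ((ae_restrict_iff' ne_open.measurableSet).2 hae) ne_open hcont continuousOn_const
    exact this hx
  intro g hg hgc hgs
  set ψ : ES n → ℂ := fun y => ((g y : ℝ) : ℂ) with hψd
  have hψ : ContDiff ℝ (⊤ : ℕ∞) ψ := Complex.ofRealCLM.contDiff.comp hg
  have hψc : HasCompactSupport ψ := hgc.comp_left (g := Complex.ofReal) rfl
  have hψs : tsupport ψ ⊆ {x | x ≠ 0} := (closure_mono (Function.support_comp_subset (g := Complex.ofReal) rfl g)).trans hgs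
  have h1 := hEfund (fun y => ψ y • EuclideanSpace.single α (1:ℂ)) (hψ.smul contDiff_const) hψc.smul_right β
  have hψ0 : ψ 0 = 0 := by
    by_contra h
    exact hψs (subset_tsupport _ h) rfl
  rw [hψ0] at h1
  simp only [zero_smul, PiLp.zero_apply] at h1
  have h2 : ∀ x γ, ∑ α', ∑ r, ∑ s, A r s α' γ * pd r (pd s (fun y => (ψ y • EuclideanSpace.single α (1:ℂ)) α')) x = ∑ r, ∑ s, A r s α γ * pd r (pd s ψ) x := by
    intro x γ
    rw [Finset.sum_eq_single α]
    · simp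
    · intro a _ ha
      refine Finset.sum_eq_zero fun r _ => Finset.sum_eq_zero fun s _ => ?_
      have z : ∀ s, pd s (fun _ : ES n => (0:ℂ)) = fun _ => 0 := by intro s; ext; simp [pd]
      simp [ha, z]
    · simp
  simp_rw [h2, Finset.mul_sum] at h1
  have i1 : ∀ γ r s, Integrable (fun x => E x γ β * (A r s α γ * pd r (pd s ψ) x)) := by
    intro γ r s
    have := (mul_cs (fun x => E x γ β) (pd r (pd s ψ)) (hEs γ β).continuousOn (pd_cont r _ (pd_cont s ψ hψ)).continuous (pd_supp r _ (pd_supp s ψ hψc)) ((pd_ts r _).trans ((pd_ts s ψ).trans hψs))).const_mul (A r s α γ)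
    refine this.congr (Eventually.of_forall fun x => ?_)
    ring
  have i2 : ∀ γ r s, Integrable (fun x => A r s α γ * (pd s (pd r (fun y => E y γ β)) x * ψ x)) := by
    intro γ r s
    exact (mul_cs _ ψ (hc2 γ r s).continuousOn hψ.continuous hψc hψs).const_mul (A r s α γ)
  have i3 : ∀ γ r s, ∫ x, E x γ β * (A r s α γ * pd r (pd s ψ) x) = ∫ x, A r s α γ * (pd s (pd r (fun y => E y γ β)) x * ψ x) := by
    intro γ r s
    have e1 := ibp r (fun x => E x γ β) (pd s ψ) (hEs γ β) (pd_cont s ψ hψ) (pd_supp s ψ hψc) ((pd_ts s ψ).trans hψs)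
    have e2 := ibp s (pd r (fun x => E x γ β)) ψ (pd_on r _ (hEs γ β)) hψ hψc hψs
    rw [e2, neg_neg] at e1
    rw [integral_const_mul, ← e1, ← integral_const_mul]
    congr 1; ext x; ring
  have h3 : ∫ x, g x • (∑ γ, ∑ r, ∑ s, A r s α γ * pd s (pd r (fun y => E y γ β)) x) = ∫ x, ∑ γ, ∑ r, ∑ s, A r s α γ * (pd s (pd r (fun y => E y γ β)) x * ψ x) := by
    congr 1; ext x
    simp only [Complex.real_smul, Finset.mul_sum, hψd]
    refine Finset.sum_congr rfl fun γ _ => Finset.sum_congr rfl fun r _ => Finset.sum_congr rfl fun s _ => ?_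
    ring
  rw [h3, ← h1]
  rw [integral_finsetSum _ fun γ _ => integrable_finsetSum _ fun r _ => integrable_finsetSum _ fun s _ => i2 γ r s,
    integral_finsetSum _ fun γ _ => integrable_finsetSum _ fun r _ => integrable_finsetSum _ fun s _ => i1 γ r s]
  refine Finset.sum_congr rfl fun γ _ => ?_
  rw [integral_finsetSum _ fun r _ => integrable_finsetSum _ fun s _ => i2 γ r s,
    integral_finsetSum _ fun r _ => integrable_finsetSum _ fun s _ => i1 γ r s]
  refine Finset.sum_congr rfl fun r _ => ?_
  rw [integral_finsetSum _ fun s _ => i2 γ r s, integral_finsetSum _ fun s _ => i1 γ r s]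
  exact Finset.sum_congr rfl fun s _ => (i3 γ r s).symm
end pde

section red
variable {n M : ℕ} (A : Fin n → Fin n → Fin M → Fin M → ℂ) (E : ES n → Matrix (Fin M) (Fin M) ℂ)

def Dk (i : Fin n × Fin M × Fin M) : ES n → ℂ := pd i.1 (fun y => E y i.2.1 i.2.2)

lemma pd_comm {F : ES n → ℂ} (hF : ContDiffOn ℝ (⊤ : ℕ∞) F {x | x ≠ 0}) (r s : Fin n) {x : ES n} (hx : x ≠ 0) :
    pd r (pd s F) x = pd s (pd r F) x := by
  have h := hF.contDiffAt (ne_open.mem_nhds hx)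
  have h2 : ContDiffAt ℝ 2 F x := h.of_le ((WithTop.coe_le_coe (a := ⊤)).2 (le_top : (2:ℕ∞) ≤ ⊤) : ((2:ℕ∞) : WithTop ℕ∞) ≤ ((⊤:ℕ∞) : WithTop ℕ∞))
  have hs := h2.isSymmSndFDerivAt (by simp)
  have hd : DifferentiableAt ℝ (fderiv ℝ F) x :=
    (h2.fderiv_right (m := 1) (by norm_num)).differentiableAt (by simp)
  have key : ∀ a b, pd a (pd b F) x = fderiv ℝ (fderiv ℝ F) x (EuclideanSpace.single a 1) (EuclideanSpace.single b 1) := by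
    intro a b
    unfold pd
    rw [fderiv_clm_apply hd (by fun_prop)]
    simp
  rw [key, key]; exact hs _ _

lemma pd_congr {F : Type*} [NormedAddCommGroup F] [NormedSpace ℝ F] {s : Set (ES n)} (hs : IsOpen s) {f g : ES n → F} (h : ∀ x ∈ s, f x = g x) (r : Fin n) {x} (hx : x ∈ s) : pd r f x = pd r g x := by
  have : f =ᶠ[𝓝 x] g := by filter_upwards [hs.mem_nhds hx] with y hy using h y hy
  unfold pd; rw [this.fderiv_eq]

variable {E}

lemma Dk_ker (hEs : ∀ γ β : Fin M,
      ContDiffOn ℝ (⊤ : ℕ∞) (fun x => E x γ β) {x : ES n | x ≠ 0}) (hn : 2 ≤ n) (hEhom : ∀ (γ β : Fin M) (r : Fin n) (l : ℝ), 0 < l →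
      ∀ x : ES n, x ≠ 0 →
        pd r (fun y => E y γ β) (l • x)
          = ((l : ℂ) ^ ((1 : ℤ) - (n : ℤ))) * pd r (fun y => E y γ β) x) (i) : Ker (n-1) (Dk E i) where
  smooth := pd_on _ _ (hEs _ _)
  hom l x hl hx := by
    unfold Dk
    rw [hEhom _ _ _ l hl x hx, Complex.real_smul]
    congr 1
    rw [show (1:ℤ) - n = - ((n-1 : ℕ) : ℤ) by omega, zpow_neg, zpow_natCast]
    push_cast; rfl

lemma Dk_odd (hEeven : ∀ x : ES n, x ≠ 0 → E (-x) = E x) (i) (x) (hx : x ≠ 0) : Dk E i (-x) = - Dk E i x := by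
  have h1 : pd i.1 (fun y => (fun y => E y i.2.1 i.2.2) (-y)) x = pd i.1 (fun y => E y i.2.1 i.2.2) x :=
    pd_congr ne_open (fun y hy => by simp only [hEeven y hy]) _ hx
  unfold Dk
  rw [← h1]
  unfold pd
  have e := fderiv_comp_smul (𝕜 := ℝ) (f := fun y => E y i.2.1 i.2.2) (-1 : ℝ) (x := x)
  simp only [neg_smul, one_smul] at e
  rw [e]; simp

lemma LH_inv (hn : 2 ≤ n) (hA : LegendreHadamard A) (l : Fin n) : ∃ B : Matrix (Fin M) (Fin M) ℂ, B * (Matrix.of fun α γ => A l l α γ) = 1 := by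
  set N : Matrix (Fin M) (Fin M) ℂ := Matrix.of fun α γ => A l l α γ with hN
  refine ⟨N⁻¹, Matrix.nonsing_inv_mul N ?_⟩
  rw [isUnit_iff_ne_zero]
  intro h0
  obtain ⟨v, hv, hv0⟩ := Matrix.exists_mulVec_eq_zero_iff.2 h0
  obtain ⟨κ, hκ, h⟩ := hA
  have h1 := h (Pi.single l 1) v
  have e1 : ∑ r, (Pi.single l (1:ℝ) : Fin n → ℝ) r ^ 2 = 1 := by
    rw [Finset.sum_eq_single l] <;> simp +contextual
  have e2 : (∑ r, ∑ s, ∑ a, ∑ b, A r s a b * ((Pi.single l (1:ℝ) : Fin n → ℝ) r : ℂ) * ((Pi.single l (1:ℝ) : Fin n → ℝ) s : ℂ) * (starRingEnd ℂ) (v a) * v b) = 0 := by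
    rw [Finset.sum_eq_single l, Finset.sum_eq_single l]
    · refine Finset.sum_eq_zero fun a _ => ?_
      have := congrFun hv0 a
      simp only [Matrix.mulVec, dotProduct, hN, Matrix.of_apply, Pi.zero_apply] at this
      calc _ = (starRingEnd ℂ) (v a) * ∑ b, A l l a b * v b := by
            rw [Finset.mul_sum]; refine Finset.sum_congr rfl fun b _ => ?_
            simp; ring
        _ = 0 := by rw [this, mul_zero]
    · intro s _ hs; simp [hs]
    · simp
    · intro s _ hs; simp [hs]
    · simp
  rw [e1, e2] at h1
  simp only [mul_one, Complex.zero_re] at h1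
  have h2 : 0 < ∑ a, ‖v a‖^2 := by
    obtain ⟨a, ha⟩ := Function.ne_iff.1 hv
    refine Finset.sum_pos' (fun _ _ => by positivity) ⟨a, Finset.mem_univ _, ?_⟩
    have : v a ≠ 0 := ha
    positivity
  nlinarith

lemma fin_cases' (hn : 2 ≤ n) (r : Fin n) : (∃ j, r = finUp j) ∨ r = lastIdx n (by omega) := by
  by_cases h : (r:ℕ) < n - 1
  · exact Or.inl ⟨⟨r, h⟩, rfl⟩
  · right; ext; simp [lastIdx]; omega

lemma red (hEs : ∀ γ β : Fin M,
      ContDiffOn ℝ (⊤ : ℕ∞) (fun x => E x γ β) {x : ES n | x ≠ 0}) (hn : 2 ≤ n) (hA : LegendreHadamard A) (hpde : ∀ α β : Fin M, ∀ x : ES n, x ≠ 0 →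
    ∑ γ, ∑ r, ∑ s, A r s α γ * pd s (pd r (fun y => E y γ β)) x = 0) (r : Fin n) (i : Fin n × Fin M × Fin M) :
    ∃ b : Fin (n-1) × (Fin n × Fin M × Fin M) → ℂ, ∀ x, x ≠ 0 → pd r (Dk E i) x = ∑ J, b J * pd (finUp J.1) (Dk E J.2) x := by
  set v : Fin (n-1) × (Fin n × Fin M × Fin M) → {x : ES n // x ≠ 0} → ℂ := fun J x => pd (finUp J.1) (Dk E J.2) x with hv
  set S := Submodule.span ℂ (Set.range v) with hS
  suffices h : (fun x : {x : ES n // x ≠ 0} => pd r (Dk E i) x.1) ∈ S by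
    obtain ⟨b, hb⟩ := (Submodule.mem_span_range_iff_exists_fun ℂ).1 h
    refine ⟨b, fun x hx => ?_⟩
    have := congrFun hb ⟨x, hx⟩
    simp only [Finset.sum_apply, Pi.smul_apply, smul_eq_mul] at this
    rw [← this]
  have hmem : ∀ j i, (fun x : {x : ES n // x ≠ 0} => pd (finUp j) (Dk E i) x.1) ∈ S := fun j i => Submodule.subset_span ⟨(j, i), rfl⟩
  have h1 : ∀ r q γ β, ¬ (r = lastIdx n (by omega) ∧ q = lastIdx n (by omega)) → (fun x : {x : ES n // x ≠ 0} => pd r (Dk E (q, γ, β)) x.1) ∈ S := by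
    intro r q γ β h
    rcases fin_cases' hn r with ⟨j, rfl⟩ | hr
    · exact hmem j _
    rcases fin_cases' hn q with ⟨j, rfl⟩ | hq
    · convert hmem j (r, γ, β) using 1
      ext x
      exact pd_comm (hEs γ β) _ _ x.2
    · exact absurd ⟨hr, hq⟩ h
  obtain ⟨q, γ, β⟩ := i
  by_cases h : ¬ (r = lastIdx n (by omega) ∧ q = lastIdx n (by omega))
  · exact h1 r q γ β h
  push Not at h
  obtain ⟨hr, hq⟩ := h
  subst hr hq
  set l := lastIdx n (by omega)
  obtain ⟨B, hB⟩ := LH_inv A hn hA l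
  have key : ∀ α, (fun x : {x : ES n // x ≠ 0} => ∑ γ, A l l α γ * pd l (Dk E (l, γ, β)) x.1) =
     - ∑ γ, ∑ r, ∑ s, (if r = l ∧ s = l then 0 else A r s α γ • (fun x : {x : ES n // x ≠ 0} => pd s (Dk E (r, γ, β)) x.1)) := by
    intro α
    ext x
    have h0 := hpde α β x.1 x.2
    rw [eq_comm, Pi.neg_apply, neg_eq_iff_add_eq_zero, ← h0]
    simp only [Finset.sum_apply]
    rw [← Finset.sum_add_distrib]
    refine Finset.sum_congr rfl fun γ' _ => ?_
    have e1 : A l l α γ' * pd l (Dk E (l, γ', β)) x.1 = ∑ r, ∑ s, if r = l ∧ s = l then A r s α γ' * pd s (Dk E (r, γ', β)) x.1 else 0 := by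
      rw [Finset.sum_eq_single l, Finset.sum_eq_single l]
      · simp
      · intro s _ hs; simp [hs]
      · simp
      · intro s _ hs; simp [hs]
      · simp
    rw [e1, ← Finset.sum_add_distrib]
    refine Finset.sum_congr rfl fun r _ => ?_
    rw [← Finset.sum_add_distrib]
    refine Finset.sum_congr rfl fun s _ => ?_
    split_ifs <;> simp [Dk]
  have key2 : ∀ α, (fun x : {x : ES n // x ≠ 0} => ∑ γ, A l l α γ * pd l (Dk E (l, γ, β)) x.1) ∈ S := by
    intro α
    rw [key α]
    refine S.neg_mem (S.sum_mem fun γ _ => S.sum_mem fun r _ => S.sum_mem fun s _ => ?_)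
    split_ifs with h
    · exact S.zero_mem
    · exact S.smul_mem _ (h1 s r γ β (by tauto))
  have key3 : (fun x : {x : ES n // x ≠ 0} => pd l (Dk E (l, γ, β)) x.1) =
     ∑ α, B γ α • (fun x : {x : ES n // x ≠ 0} => ∑ γ, A l l α γ * pd l (Dk E (l, γ, β)) x.1) := by
    ext x
    have := congrFun (congrArg (fun T => Matrix.mulVec T (fun γ => pd l (Dk E (l, γ, β)) x.1)) hB) γ
    simp only [← Matrix.mulVec_mulVec, Matrix.one_mulVec] at this
    rw [← this]
    simp [Matrix.mulVec, dotProduct]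
  rw [key3]
  exact S.sum_mem fun α _ => S.smul_mem _ (key2 α)
end red

section rep
variable {n M : ℕ}

lemma comp_memLp {m : ℕ} {p : ℝ≥0∞} {f : ES m → EuclideanSpace ℂ (Fin M)} (hf : MemLp f p) (α : Fin M) : MemLp (fun y => f y α) p :=
  hf.of_le ((EuclideanSpace.proj α : EuclideanSpace ℂ (Fin M) →L[ℂ] ℂ).continuous.comp_aestronglyMeasurable hf.1) (Eventually.of_forall fun y => PiLp.norm_apply_le (f y) α)

def uF (k : ES n → Matrix (Fin M) (Fin M) ℂ) (f : ES (n-1) → EuclideanSpace ℂ (Fin M)) : ES n → EuclideanSpace ℂ (Fin M) := fun x =>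
          (WithLp.equiv 2 (Fin M → ℂ)).symm (fun γ =>
            ∫ y' : ES (n-1), ∑ α,
              (((xlast x : ℂ) ^ ((1 : ℤ) - (n : ℤ))) *
                (2 * k (toUp ((xlast x)⁻¹ • (xinit x - y')) 1) γ α)) * f y' α)

lemma pd_LC (hn : 2 ≤ n) (p : ℝ) (hp : 1 < p) {ι : Type*} [Fintype ι] {a : ℕ} (ha : n - 1 ≤ a) (c : ι → ℂ) (Θ : ι → ES n → ℂ) (hΘ : ∀ j, Ker a (Θ j)) (h : ι → ES (n-1) → ℂ) (hh : ∀ j, MemLp (h j) (oR p))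
    (v : ES n → ℂ) (hv : ∀ x ∈ upperHalfSpace n, v x = ∑ j, c j * PT (Θ j) (h j) x) (r : Fin n) (x) (hx : x ∈ upperHalfSpace n) : pd r v x = ∑ j, c j * PT (pd r (Θ j)) (h j) x := by
  rw [pd_congr (uhs_open hn) hv r hx]
  have h1 : ∀ j, HasFDerivAt (fun y => c j * PT (Θ j) (h j) y) (c j • fderiv ℝ (PT (Θ j) (h j)) x) x := fun j =>
    (PT_fderiv hn p hp (hΘ j) ha (h j) (hh j) x hx).1.hasFDerivAt.const_mul (c j)
  have h2 := HasFDerivAt.fun_sum (u := Finset.univ) fun j _ => h1 j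
  have h3 := h2.fderiv
  change (fderiv ℝ (fun y => ∑ j, c j * PT (Θ j) (h j) y) x) _ = _
  rw [h3, ContinuousLinearMap.sum_apply]
  refine Finset.sum_congr rfl fun j _ => ?_
  rw [← (PT_fderiv hn p hp (hΘ j) ha (h j) (hh j) x hx).2 r]
  rfl

variable (A : Fin n → Fin n → Fin M → Fin M → ℂ) (E k : ES n → Matrix (Fin M) (Fin M) ℂ)

lemma u_rep (hn : 2 ≤ n) (p : ℝ) (hp : 1 < p) (hker : ∀ i, Ker (n-1) (Dk E i)) (hk : ∀ x : ES n, x ≠ 0 → ∀ (s : Fin n) (γ α : Fin M),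
      (∑ r, ∑ β, A r s β α * pd r (fun y => E y γ β) x) = ((x s : ℝ) : ℂ) * k x γ α)
    (f : ES (n-1) → EuclideanSpace ℂ (Fin M)) (hf : MemLp f (oR p)) (γ : Fin M) (x) (hx : x ∈ upperHalfSpace n) :
    uF k f x γ = ∑ J : Fin M × Fin n × Fin M, (2 * A J.2.1 (lastIdx n (by omega)) J.2.2 J.1) * PT (Dk E (J.2.1, γ, J.2.2)) (fun y => f y J.1) x := by
  have ht : 0 < xlast x := hx
  have key : ∀ y α, ((xlast x : ℂ) ^ ((1 : ℤ) - (n : ℤ))) * (2 * k (toUp ((xlast x)⁻¹ • (xinit x - y)) 1) γ α) =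
     ∑ r, ∑ β, (2 * A r (lastIdx n (by omega)) β α) * Dk E (r, γ, β) (x - toUp y 0) := by
    intro y α
    have e1 : x - toUp y 0 = xlast x • toUp ((xlast x)⁻¹ • (xinit x - y)) 1 := by
      rw [← toUp_smul, smul_smul, mul_inv_cancel₀ ht.ne', one_smul, mul_one, sub_toUp hn]
    set X := toUp ((xlast x)⁻¹ • (xinit x - y)) 1 with hX
    have hXl : X (lastIdx n (by omega)) = 1 := by rw [← xlast_eq hn, hX, xlast_toUp hn]
    have hX0 : X ≠ 0 := by rintro h; rw [h] at hXl; simp at hXl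
    have h1 := hk X hX0 (lastIdx n (by omega)) γ α
    rw [hXl, Complex.ofReal_one, one_mul] at h1
    rw [← h1, e1]
    simp_rw [(hker _).hom _ _ ht hX0, Finset.mul_sum]
    refine Finset.sum_congr rfl fun r _ => Finset.sum_congr rfl fun β _ => ?_
    rw [Complex.real_smul, show (1:ℤ) - n = - ((n-1 : ℕ) : ℤ) by omega, zpow_neg, zpow_natCast]
    push_cast
    unfold Dk
    ring
  change ∫ y' : ES (n-1), ∑ α, _ * f y' α = _
  simp_rw [key]
  have e2 : ∀ y : ES (n-1), (∑ α, (∑ r, ∑ β, (2 * A r (lastIdx n (by omega)) β α) * Dk E (r, γ, β) (x - toUp y 0)) * f y α) =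
     ∑ J : Fin M × Fin n × Fin M, (2 * A J.2.1 (lastIdx n (by omega)) J.2.2 J.1) * (Dk E (J.2.1, γ, J.2.2) (x - toUp y 0) * f y J.1) := by
    intro y
    simp_rw [Fintype.sum_prod_type, Finset.sum_mul, mul_assoc]
  simp_rw [e2]
  rw [integral_finsetSum]
  · simp_rw [integral_const_mul]; rfl
  · intro J _
    exact (PT_int hn p hp (hker _) le_rfl _ (comp_memLp hf J.1) x hx).const_mul _

lemma pde3 (hEs : ∀ γ β : Fin M,
      ContDiffOn ℝ (⊤ : ℕ∞) (fun x => E x γ β) {x : ES n | x ≠ 0})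
    (hpde : ∀ α β : Fin M, ∀ x : ES n, x ≠ 0 →
    ∑ γ, ∑ r, ∑ s, A r s α γ * pd s (pd r (fun y => E y γ β)) x = 0) (α : Fin M) (q : Fin n) (β' : Fin M) (z : ES n) (hz : z ≠ 0) :
    ∑ r, ∑ s, ∑ γ, A r s α γ * pd r (pd s (Dk E (q, γ, β'))) z = 0 := by
  have h3 : pd q (fun x => ∑ γ, ∑ r, ∑ s, A r s α γ * pd s (pd r (fun y => E y γ β')) x) z = pd q (fun _ => (0:ℂ)) z :=
    pd_congr ne_open (hpde α β') q hz
  have h4 : HasFDerivAt (fun x => ∑ γ, ∑ r, ∑ s, A r s α γ * pd s (pd r (fun y => E y γ β')) x) (∑ γ, ∑ r, ∑ s, A r s α γ • fderiv ℝ (pd s (pd r (fun y => E y γ β'))) z) z :=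
    HasFDerivAt.fun_sum fun γ _ => HasFDerivAt.fun_sum fun r _ => HasFDerivAt.fun_sum fun s _ =>
      (((pd_on s _ (pd_on r _ (hEs γ β'))).contDiffAt (ne_open.mem_nhds hz)).differentiableAt (by simp)).hasFDerivAt.const_mul _
  have h5 : pd q (fun x => ∑ γ, ∑ r, ∑ s, A r s α γ * pd s (pd r (fun y => E y γ β')) x) z = ∑ γ, ∑ r, ∑ s, A r s α γ * pd q (pd s (pd r (fun y => E y γ β'))) z := by
    change (fderiv ℝ _ z) _ = _
    rw [h4.fderiv]
    simp only [ContinuousLinearMap.sum_apply, ContinuousLinearMap.smul_apply, smul_eq_mul]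
    rfl
  have h6 : pd q (fun _ => (0:ℂ)) z = 0 := by simp [pd]
  rw [← h6, ← h3, h5]
  conv_rhs => rw [Finset.sum_comm]; enter [2, r]; rw [Finset.sum_comm]
  refine Finset.sum_congr rfl fun r _ => Finset.sum_congr rfl fun s _ => Finset.sum_congr rfl fun γ _ => ?_
  congr 1
  have c1 : pd r (pd s (Dk E (q, γ, β'))) z = pd r (pd q (pd s (fun y => E y γ β'))) z :=
    pd_congr ne_open (fun w hw => pd_comm (hEs γ β') s q hw) r hz
  have c2 := pd_comm (pd_on s _ (hEs γ β')) r q hz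
  have c3 : pd q (pd r (pd s (fun y => E y γ β'))) z = pd q (pd s (pd r (fun y => E y γ β'))) z :=
    pd_congr ne_open (fun w hw => pd_comm (hEs γ β') r s hw) q hz
  rw [c1, c2, c3]

lemma pde4 (hn : 2 ≤ n) (p : ℝ) (hp : 1 < p) (c : Fin n → Fin n → Fin M → ℂ) (Θ : Fin n → Fin n → Fin M → ES n → ℂ) {a : ℕ} (ha : n - 1 ≤ a) (hΘ : ∀ r s γ, Ker a (Θ r s γ))
   (h0 : ∀ z, z ≠ 0 → ∑ r, ∑ s, ∑ γ, c r s γ * Θ r s γ z = 0) (f : ES (n-1) → ℂ) (hf : MemLp f (oR p)) (x) (hx : x ∈ upperHalfSpace n) :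
    ∑ r, ∑ s, ∑ γ, c r s γ * PT (Θ r s γ) f x = 0 := by
  have i1 : ∀ r s γ, Integrable (fun y => c r s γ * (Θ r s γ (x - toUp y 0) * f y)) := fun r s γ =>
    (PT_int hn p hp (hΘ r s γ) ha _ hf x hx).const_mul _
  have e : ∀ r s γ, c r s γ * PT (Θ r s γ) f x = ∫ y, c r s γ * (Θ r s γ (x - toUp y 0) * f y) := fun r s γ => by
    rw [integral_const_mul]; rfl
  simp_rw [e]
  simp_rw [← integral_finsetSum _ fun γ _ => i1 _ _ γ]
  simp_rw [← integral_finsetSum _ fun s _ => integrable_finsetSum _ fun γ _ => i1 _ s γ]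
  rw [← integral_finsetSum _ fun r _ => integrable_finsetSum _ fun s _ => integrable_finsetSum _ fun γ _ => i1 r s γ]
  rw [← integral_zero (ES (n-1)) ℂ]
  congr 1; ext y
  have := h0 _ (sub_ne hn x hx y)
  simp_rw [← mul_assoc, ← Finset.sum_mul]
  rw [this, zero_mul]

lemma u_pd2 (hn : 2 ≤ n) (p : ℝ) (hp : 1 < p) (hker : ∀ i, Ker (n-1) (Dk E i))
    (hk : ∀ x : ES n, x ≠ 0 → ∀ (s : Fin n) (γ α : Fin M),
      (∑ r, ∑ β, A r s β α * pd r (fun y => E y γ β) x) = ((x s : ℝ) : ℂ) * k x γ α)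
    (f : ES (n-1) → EuclideanSpace ℂ (Fin M)) (hf : MemLp f (oR p)) (x) (hx : x ∈ upperHalfSpace n) (r s γ) :
    pd r (pd s (fun y => uF k f y γ)) x = ∑ J : Fin M × Fin n × Fin M, (2 * A J.2.1 (lastIdx n (by omega)) J.2.2 J.1) * PT (pd r (pd s (Dk E (J.2.1, γ, J.2.2)))) (fun y => f y J.1) x := by
  have a1 : ∀ z ∈ upperHalfSpace n, pd s (fun y => uF k f y γ) z = ∑ J : Fin M × Fin n × Fin M, (2 * A J.2.1 (lastIdx n (by omega)) J.2.2 J.1) * PT (pd s (Dk E (J.2.1, γ, J.2.2))) (fun y => f y J.1) z :=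
    fun z hz => pd_LC hn p hp le_rfl (fun J : Fin M × Fin n × Fin M => 2 * A J.2.1 (lastIdx n (by omega)) J.2.2 J.1) (fun J => Dk E (J.2.1, γ, J.2.2)) (fun J => hker _) (fun J y => f y J.1) (fun J => comp_memLp hf J.1) (fun y => uF k f y γ) (u_rep A E k hn p hp hker hk f hf γ) s z hz
  exact pd_LC hn p hp (by omega : n - 1 ≤ n - 1 + 1) (fun J : Fin M × Fin n × Fin M => 2 * A J.2.1 (lastIdx n (by omega)) J.2.2 J.1) (fun J => pd s (Dk E (J.2.1, γ, J.2.2))) (fun J => (hker _).pd s) (fun J y => f y J.1) (fun J => comp_memLp hf J.1) (pd s (fun y => uF k f y γ)) a1 r x hx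

lemma u_pde (hn : 2 ≤ n) (p : ℝ) (hp : 1 < p) (hker : ∀ i, Ker (n-1) (Dk E i)) (hEs : ∀ γ β : Fin M,
      ContDiffOn ℝ (⊤ : ℕ∞) (fun x => E x γ β) {x : ES n | x ≠ 0})
    (hpde : ∀ α β : Fin M, ∀ x : ES n, x ≠ 0 →
    ∑ γ, ∑ r, ∑ s, A r s α γ * pd s (pd r (fun y => E y γ β)) x = 0)
    (hk : ∀ x : ES n, x ≠ 0 → ∀ (s : Fin n) (γ α : Fin M),
      (∑ r, ∑ β, A r s β α * pd r (fun y => E y γ β) x) = ((x s : ℝ) : ℂ) * k x γ α)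
    (f : ES (n-1) → EuclideanSpace ℂ (Fin M)) (hf : MemLp f (oR p)) (x) (hx : x ∈ upperHalfSpace n) (α : Fin M) :
    (∑ r, ∑ s, ∑ β, A r s α β * pd r (pd s (fun y => uF k f y β)) x) = 0 := by
  simp_rw [u_pd2 A E k hn p hp hker hk f hf x hx, Finset.mul_sum]
  calc _ = ∑ J : Fin M × Fin n × Fin M, (2 * A J.2.1 (lastIdx n (by omega)) J.2.2 J.1) * ∑ r, ∑ s, ∑ γ, A r s α γ * PT (pd r (pd s (Dk E (J.2.1, γ, J.2.2)))) (fun y => f y J.1) x := by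
        simp_rw [Finset.mul_sum]
        conv_rhs => rw [Finset.sum_comm]; enter [2, r]; rw [Finset.sum_comm]; enter [2, s]; rw [Finset.sum_comm]
        refine Finset.sum_congr rfl fun r _ => Finset.sum_congr rfl fun s _ => Finset.sum_congr rfl fun γ _ => Finset.sum_congr rfl fun J _ => ?_
        ring
    _ = 0 := Finset.sum_eq_zero fun J _ => by
        rw [pde4 hn p hp (fun r s γ => A r s α γ) (fun r s γ => pd r (pd s (Dk E (J.2.1, γ, J.2.2)))) (by omega : n - 1 ≤ n - 1 + 1 + 1) (fun r s γ => ((hker _).pd s).pd r) (pde3 A E hEs hpde α J.2.1 J.2.2) _ (comp_memLp hf J.1) x hx, mul_zero]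
end rep

section ind
variable {n M m : ℕ}

lemma mpd_snoc (k : ℕ) (d : Fin k → Fin m) (j : Fin m) (φ : ES m → ℝ) (hφ : ContDiff ℝ (⊤ : ℕ∞) φ) (x) :
    mpd (k+1) (Fin.snoc d j : Fin (k+1) → Fin m) φ x = mpd k d (pd j φ) x := by
  unfold mpd
  rw [iteratedFDeriv_succ_apply_right]
  have h1 : ContDiff ℝ (⊤ : ℕ∞) (fderiv ℝ φ) := hφ.fderiv_right (by simp)
  have h2 := (ContinuousLinearMap.apply ℝ ℝ (EuclideanSpace.single j (1:ℝ) : ES m)).iteratedFDeriv_comp_left (h1.contDiffAt (x := x)) (i := k) (by exact_mod_cast (WithTop.coe_le_coe.2 le_top))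
  have h3 : (⇑(ContinuousLinearMap.apply ℝ ℝ (EuclideanSpace.single j (1:ℝ) : ES m))) ∘ (fderiv ℝ φ) = pd j φ := rfl
  rw [h3] at h2
  rw [h2]
  have h4 : (Fin.init fun i => (EuclideanSpace.single ((Fin.snoc d j : Fin (k+1) → Fin m) i) (1:ℝ) : ES m)) = fun i => EuclideanSpace.single (d i) 1 := by
    funext i; simp [Fin.init]
  rw [h4]
  simp

lemma mpd_cons (k : ℕ) (d : Fin (k+1) → Fin n) (v : ES n → ℂ) (x) (hv : ContDiffAt ℝ (k+1 : ℕ) v x) :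
    mpd (k+1) d v x = pd (d 0) (mpd k (Fin.tail d) v) x := by
  unfold mpd pd
  rw [iteratedFDeriv_succ_apply_left]
  have hd : DifferentiableAt ℝ (iteratedFDeriv ℝ k v) x := hv.differentiableAt_iteratedFDeriv (by exact_mod_cast Nat.lt_succ_self k)
  let T : (ContinuousMultilinearMap ℝ (fun _ : Fin k => ES n) ℂ) →L[ℝ] ℂ := ContinuousMultilinearMap.apply ℝ (fun _ : Fin k => ES n) ℂ (fun i => EuclideanSpace.single (Fin.tail d i) 1)
  have := (T.hasFDerivAt.comp x hd.hasFDerivAt).fderiv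
  change _ = (fderiv ℝ (T ∘ (iteratedFDeriv ℝ k v)) x) _
  rw [this]
  rfl

lemma smul_int (p : ℝ) (hp : 1 < p) (φ : ES m → ℝ) (hφ : Continuous φ) (hφs : HasCompactSupport φ) (G : ES m → EuclideanSpace ℂ (Fin M)) (hG : MemLp G (oR p)) (α : Fin M) :
    (∫ x, φ x • G x) α = ∫ x, (φ x : ℂ) * G x α := by
  rw [eval_integral_piLp]
  · simp
  · intro i
    have := Cc_int p hp (fun x => (φ x : ℂ)) (fun x => G x i) (Complex.continuous_ofReal.comp hφ) (hφs.comp_left (g := Complex.ofReal) rfl) (comp_memLp hG i)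
    simpa using this

lemma WD_of (p : ℝ) (hp : 1 < p) (k : ℕ) (d : Fin k → Fin m) (j : Fin m) (f G0 G1 : ES m → EuclideanSpace ℂ (Fin M)) (hG0 : MemLp G0 (oR p)) (hG1 : MemLp G1 (oR p))
    (h0 : IsWeakDeriv k d f G0) (h1 : IsWeakDeriv (k+1) (Fin.snoc d j : Fin (k+1) → Fin m) f G1) (α : Fin M) : WD j (fun y => G0 y α) (fun y => G1 y α) := by
  intro φ hφ hφs
  have e0 := h0 (pd j φ) (pd_cont j φ hφ) (pd_supp j φ hφs)
  have e1 := h1 φ hφ hφs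
  simp_rw [mpd_snoc k d j φ hφ] at e1
  rw [e0, pow_succ, mul_neg_one, neg_smul, ← smul_neg] at e1
  have e2 : ∫ x', pd j φ x' • G0 x' = - ∫ x', φ x' • G1 x' := by
    have h3 : ((-1:ℝ)^k) ≠ 0 := by positivity
    exact smul_right_injective _ h3 e1
  have e3 := congrArg (fun v : EuclideanSpace ℂ (Fin M) => v α) e2
  simp only [PiLp.neg_apply] at e3
  rwa [smul_int p hp _ (pd_cont j φ hφ).continuous (pd_supp j φ hφs) G0 hG0, smul_int p hp _ hφ.continuous hφs G1 hG1] at e3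

lemma weak0 (p : ℝ) (hp : 1 < p) (d : Fin 0 → Fin m) (f G : ES m → EuclideanSpace ℂ (Fin M)) (hf : MemLp f (oR p)) (hG : MemLp G (oR p)) (h : IsWeakDeriv 0 d f G) : f =ᵐ[volume] G := by
  have h1 : (1:ℝ≥0∞) ≤ oR p := by simpa using hp.le
  refine ae_eq_of_integral_contDiff_smul_eq (hf.locallyIntegrable h1) (hG.locallyIntegrable h1) fun φ hφ hφs => ?_
  have := h φ hφ hφs
  simpa [mpd] using this

structure Val (p : ℝ) (ℓ : ℕ) (f : ES (n-1) → EuclideanSpace ℂ (Fin M))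
        (g : (k' : ℕ) → (Fin k' → Fin (n - 1)) →
          ES (n-1) → EuclideanSpace ℂ (Fin M)) : Prop where
  hf : MemLp f (oR p) volume
  hg : ∀ k' : ℕ, k' ≤ ℓ → ∀ d' : Fin k' → Fin (n - 1),
          MemLp (g k' d') (oR p) volume ∧ IsWeakDeriv k' d' f (g k' d')

structure WT (n M : ℕ) (p : ℝ) (ℓ : ℕ) where
  f : ES (n-1) → EuclideanSpace ℂ (Fin M)
  g : (k' : ℕ) → (Fin k' → Fin (n - 1)) →
          ES (n-1) → EuclideanSpace ℂ (Fin M)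
  x : ES n
  val : Val p ℓ f g
  hx : x ∈ upperHalfSpace n

variable (A : Fin n → Fin n → Fin M → Fin M → ℂ) (E k : ES n → Matrix (Fin M) (Fin M) ℂ)

lemma u_smooth (hn : 2 ≤ n) (p : ℝ) (hp : 1 < p) (hker : ∀ i, Ker (n-1) (Dk E i)) (hk : ∀ x : ES n, x ≠ 0 → ∀ (s : Fin n) (γ α : Fin M),
      (∑ r, ∑ β, A r s β α * pd r (fun y => E y γ β) x) = ((x s : ℝ) : ℂ) * k x γ α)
    (f : ES (n-1) → EuclideanSpace ℂ (Fin M)) (hf : MemLp f (oR p)) (γ : Fin M) (N : ℕ) (x) (hx : x ∈ upperHalfSpace n) : ContDiffAt ℝ N (fun y => uF k f y γ) x := by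
  have : ContDiffOn ℝ N (fun y => uF k f y γ) (upperHalfSpace n) := by
    refine ContDiffOn.congr ?_ (u_rep A E k hn p hp hker hk f hf γ)
    exact ContDiffOn.sum fun J _ => contDiffOn_const.mul (PT_smooth hn p hp _ (comp_memLp hf J.1) N (hker _) le_rfl)
  exact this.contDiffAt ((uhs_open hn).mem_nhds hx)

abbrev Idx (n M k : ℕ) := Fin M × (Fin n × Fin M × Fin M) × (Fin k → Fin (n-1))

def gen (p : ℝ) (ℓ q : ℕ) (J : Idx n M q) (w : WT n M p ℓ) : ℂ := PT (Dk E J.2.1) (fun y => w.g q J.2.2 y J.1) w.x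

lemma mpd_span (hn : 2 ≤ n) (p : ℝ) (hp : 1 < p) (ℓ : ℕ) (hker : ∀ i, Ker (n-1) (Dk E i)) (hk : ∀ x : ES n, x ≠ 0 → ∀ (s : Fin n) (γ α : Fin M),
      (∑ r, ∑ β, A r s β α * pd r (fun y => E y γ β) x) = ((x s : ℝ) : ℂ) * k x γ α)
    (hred : ∀ (r : Fin n) (i : Fin n × Fin M × Fin M),
    ∃ b : Fin (n-1) × (Fin n × Fin M × Fin M) → ℂ, ∀ x, x ≠ 0 → pd r (Dk E i) x = ∑ J, b J * pd (finUp J.1) (Dk E J.2) x)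
    (γ : Fin M) (q : ℕ) (hq : q ≤ ℓ) (dd : Fin q → Fin n) :
    (fun w : WT n M p ℓ => mpd q dd (fun y => uF k w.f y γ) w.x) ∈ Submodule.span ℂ (Set.range (gen E p ℓ q)) := by
  induction q with
  | zero =>
    have e : (fun w : WT n M p ℓ => mpd 0 dd (fun y => uF k w.f y γ) w.x) = ∑ J : Fin M × Fin n × Fin M, (2 * A J.2.1 (lastIdx n (by omega)) J.2.2 J.1) • gen E p ℓ 0 (J.1, (J.2.1, γ, J.2.2), Fin.elim0) := by
      ext w
      simp only [mpd, iteratedFDeriv_zero_apply, Finset.sum_apply, Pi.smul_apply, smul_eq_mul]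
      rw [u_rep A E k hn p hp hker hk w.f w.val.hf γ w.x w.hx]
      refine Finset.sum_congr rfl fun J _ => ?_
      congr 1
      have h0 := w.val.hg 0 hq Fin.elim0
      refine integral_congr_ae ?_
      filter_upwards [weak0 p hp Fin.elim0 w.f _ w.val.hf h0.1 h0.2] with y hy
      rw [hy]
    rw [e]
    exact Submodule.sum_mem _ fun J _ => Submodule.smul_mem _ _ (Submodule.subset_span ⟨_, rfl⟩)
  | succ q ih =>
    obtain ⟨c, hc⟩ := (Submodule.mem_span_range_iff_exists_fun ℂ).1 (ih (by omega) (Fin.tail dd))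
    have e : (fun w : WT n M p ℓ => mpd (q+1) dd (fun y => uF k w.f y γ) w.x) = ∑ J : Idx n M q, c J • (fun w : WT n M p ℓ => PT (pd (dd 0) (Dk E J.2.1)) (fun y => w.g q J.2.2 y J.1) w.x) := by
      ext w
      rw [mpd_cons q dd _ _ (u_smooth A E k hn p hp hker hk w.f w.val.hf γ _ w.x w.hx)]
      simp only [Finset.sum_apply, Pi.smul_apply, smul_eq_mul]
      refine pd_LC hn p hp le_rfl c (fun J => Dk E J.2.1) (fun J => hker _) (fun J y => w.g q J.2.2 y J.1) (fun J => comp_memLp (w.val.hg q (by omega) _).1 _) _ (fun x hx => ?_) (dd 0) w.x w.hx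
      have := congrFun hc ⟨w.f, w.g, x, w.val, hx⟩
      simp only [Finset.sum_apply, Pi.smul_apply, smul_eq_mul] at this
      rw [← this]; rfl
    rw [e]
    refine Submodule.sum_mem _ fun J _ => Submodule.smul_mem _ _ ?_
    obtain ⟨b, hb⟩ := hred (dd 0) J.2.1
    have e2 : (fun w : WT n M p ℓ => PT (pd (dd 0) (Dk E J.2.1)) (fun y => w.g q J.2.2 y J.1) w.x) = ∑ L, b L • gen E p ℓ (q+1) (J.1, L.2, (Fin.snoc J.2.2 L.1 : Fin (q+1) → Fin (n-1))) := by
      ext w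
      have hm := comp_memLp (w.val.hg q (by omega) J.2.2).1 J.1
      simp only [Finset.sum_apply, Pi.smul_apply, smul_eq_mul]
      have e3 : ∀ L : Fin (n-1) × (Fin n × Fin M × Fin M), gen E p ℓ (q+1) (J.1, L.2, (Fin.snoc J.2.2 L.1 : Fin (q+1) → Fin (n-1))) w = PT (pd (finUp L.1) (Dk E L.2)) (fun y => w.g q J.2.2 y J.1) w.x := by
        intro L
        have g0 := w.val.hg q (by omega) J.2.2
        have g1 := w.val.hg (q+1) hq (Fin.snoc J.2.2 L.1 : Fin (q+1) → Fin (n-1))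
        exact (PT_transfer hn p hp (hker L.2) le_rfl L.1 _ _ hm (comp_memLp g1.1 J.1) (WD_of p hp q J.2.2 L.1 w.f _ _ g0.1 g1.1 g0.2 g1.2 J.1) w.x w.hx).symm
      simp_rw [e3]
      unfold PT
      simp_rw [← integral_const_mul]
      rw [← integral_finsetSum]
      · congr 1; ext y
        rw [hb _ (sub_ne hn w.x w.hx y), Finset.sum_mul]
        simp_rw [mul_assoc]
      · intro L _
        exact (PT_int hn p hp ((hker L.2).pd (finUp L.1)) (by omega) _ hm w.x w.hx).const_mul _
    rw [e2]
    exact Submodule.sum_mem _ fun L _ => Submodule.smul_mem _ _ (Submodule.subset_span ⟨_, rfl⟩)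
end ind

section est
variable {n M : ℕ}

lemma mink {X : Type*} [MeasurableSpace X] (μ : Measure X) (p : ℝ) (hp : 1 < p) {ι : Type*} (s : Finset ι) (c : ι → ℝ≥0∞) (F : ι → X → ℝ≥0∞) (hF : ∀ i, Measurable (F i)) :
    (∫⁻ x, (∑ i ∈ s, c i * F i x)^p ∂μ)^(1/p) ≤ ∑ i ∈ s, c i * (∫⁻ x, (F i x)^p ∂μ)^(1/p) := by
  classical
  have hp0 : 0 < p := by linarith
  induction s using Finset.induction_on with
  | empty => simp [ENNReal.zero_rpow_of_pos hp0, hp0]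
  | insert a s ha ih =>
    simp_rw [Finset.sum_insert ha]
    refine (ENNReal.lintegral_Lp_add_le (f := fun x => c a * F a x) (g := fun x => ∑ i ∈ s, c i * F i x) ((hF a).const_mul _).aemeasurable (Finset.measurable_fun_sum _ fun i _ => (hF i).const_mul _).aemeasurable hp.le).trans ?_
    refine add_le_add (le_of_eq ?_) ih
    simp_rw [ENNReal.mul_rpow_of_nonneg _ _ hp0.le]
    rw [lintegral_const_mul _ ((hF a).pow_const p), ENNReal.mul_rpow_of_nonneg _ _ (by positivity), ← ENNReal.rpow_mul, mul_one_div_cancel hp0.ne', ENNReal.rpow_one]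

lemma enorm_le_sum (v : EuclideanSpace ℂ (Fin M)) : ‖v‖ₑ ≤ ∑ γ, ‖v γ‖ₑ := by
  have h : v = ∑ γ, EuclideanSpace.single γ (v γ) := by
    ext i; simp [Finset.sum_apply]
  calc ‖v‖ₑ = ‖∑ γ, EuclideanSpace.single γ (v γ)‖ₑ := by rw [← h]
    _ ≤ ∑ γ, ‖(EuclideanSpace.single γ (v γ) : EuclideanSpace ℂ (Fin M))‖ₑ := enorm_sum_le _ _
    _ = _ := Finset.sum_congr rfl fun γ _ => by simp [enorm_eq_nnnorm]

variable (A : Fin n → Fin n → Fin M → Fin M → ℂ) (E k : ES n → Matrix (Fin M) (Fin M) ℂ)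

lemma est (hn : 2 ≤ n) (p : ℝ) (hp : 1 < p) (ℓ : ℕ) (κ : ℝ) (hκ : 0 < κ) (hker : ∀ i, Ker (n-1) (Dk E i)) (hodd : ∀ i x, x ≠ 0 → Dk E i (-x) = - Dk E i x) (hk : ∀ x : ES n, x ≠ 0 → ∀ (s : Fin n) (γ α : Fin M),
      (∑ r, ∑ β, A r s β α * pd r (fun y => E y γ β) x) = ((x s : ℝ) : ℂ) * k x γ α)
    (hred : ∀ (r : Fin n) (i : Fin n × Fin M × Fin M),
    ∃ b : Fin (n-1) × (Fin n × Fin M × Fin M) → ℂ, ∀ x, x ≠ 0 → pd r (Dk E i) x = ∑ J, b J * pd (finUp J.1) (Dk E J.2) x)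
    (q : ℕ) (hq : q ≤ ℓ) (dd : Fin q → Fin n) :
    ∃ K : ℝ≥0∞, K ≠ ∞ ∧ ∀ f g, Val p ℓ f g → (∫⁻ x' : ES (n-1), (ntMax κ (mpd q dd (uF k f)) x') ^ p) ^ (1/p) ≤ K * ∑ d, eLpNorm (g q d) (oR p) volume := by
  have hp0 : 0 < p := by linarith
  have hspan := fun γ => mpd_span A E k hn p hp ℓ hker hk hred γ q hq dd
  have hc : ∀ γ, ∃ c : Idx n M q → ℂ, ∀ w : WT n M p ℓ, mpd q dd (fun y => uF k w.f y γ) w.x = ∑ J, c J * gen E p ℓ q J w := by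
    intro γ
    obtain ⟨c, hc⟩ := (Submodule.mem_span_range_iff_exists_fun ℂ).1 (hspan γ)
    refine ⟨c, fun w => ?_⟩
    have := congrFun hc w
    simp only [Finset.sum_apply, Pi.smul_apply, smul_eq_mul] at this
    rw [← this]
  choose c hc using hc
  have hCZ : ∀ i, ∃ K : ℝ≥0∞, K ≠ ∞ ∧ ∀ h : ES (n-1) → ℂ, MemLp h (oR p) volume →
     (∫⁻ x, (CN κ (Pot volume (fun y t => Kz (Dk E i) (toUp y t)) h) x)^p)^(1/p) ≤ K * eLpNorm h (oR p) volume := by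
    intro i
    obtain ⟨C, hC⟩ := (hker i).czk hn (hodd i)
    obtain ⟨K, hK, hb⟩ := CZ_Lp (V := ES (n-1)) volume (by simp; omega) p hp _ C hC κ hκ
    refine ⟨K^(1/p), ENNReal.rpow_ne_top_of_nonneg (by positivity) hK, fun h hh => ?_⟩
    refine (ENNReal.rpow_le_rpow (hb h hh) (by positivity)).trans (le_of_eq ?_)
    rw [ENNReal.mul_rpow_of_nonneg _ _ (by positivity), ← ENNReal.rpow_mul, mul_one_div_cancel hp0.ne', ENNReal.rpow_one]
  choose K hK hKb using hCZ
  refine ⟨∑ L : Fin M × Idx n M q, ‖c L.1 L.2‖ₑ * K L.2.2.1, ENNReal.sum_ne_top.2 fun L _ => ENNReal.mul_ne_top enorm_ne_top (hK _), fun f g hv => ?_⟩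
  set F : Fin M × Idx n M q → ES (n-1) → ℝ≥0∞ := fun L => CN κ (Pot volume (fun y t => Kz (Dk E L.2.2.1) (toUp y t)) (fun y => g q L.2.2.2 y L.2.1)) with hF
  have hpt : ∀ x', ntMax κ (mpd q dd (uF k f)) x' ≤ ∑ L, ‖c L.1 L.2‖ₑ * F L x' := by
    intro x'
    refine iSup_le fun y => iSup_le fun t => iSup_le fun hyt => ?_
    have hX : toUp y t ∈ upperHalfSpace n := by simp [upperHalfSpace, xlast_toUp hn, hyt.1]
    have hcomp : ∀ γ, (mpd q dd (uF k f) (toUp y t)) γ = mpd q dd (fun z => uF k f z γ) (toUp y t) := by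
      intro γ
      have h1 : ContDiffAt ℝ q (uF k f) (toUp y t) := (contDiffAt_piLp 2).2 fun γ => u_smooth A E k hn p hp hker hk f hv.hf γ q _ hX
      have h2 := ((EuclideanSpace.proj γ : EuclideanSpace ℂ (Fin M) →L[ℂ] ℂ).restrictScalars ℝ).iteratedFDeriv_comp_left h1 (i := q) le_rfl
      have h3 : ((EuclideanSpace.proj γ : EuclideanSpace ℂ (Fin M) →L[ℂ] ℂ).restrictScalars ℝ) ∘ (uF k f) = fun z => uF k f z γ := rfl
      rw [h3] at h2
      unfold mpd
      rw [h2]; rfl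
    change ‖mpd q dd (uF k f) (toUp y t)‖ₑ ≤ _
    refine (enorm_le_sum _).trans ?_
    rw [Fintype.sum_prod_type]
    refine Finset.sum_le_sum fun γ _ => ?_
    rw [hcomp, hc γ ⟨f, g, toUp y t, hv, hX⟩]
    refine (enorm_sum_le _ _).trans (Finset.sum_le_sum fun J _ => ?_)
    rw [enorm_mul]
    gcongr
    unfold gen
    simp only
    rw [PT_Pot hn _ _ _ _ hyt.1]
    exact le_CN κ _ x' y t hyt.1 hyt.2
  calc _ ≤ (∫⁻ x', (∑ L, ‖c L.1 L.2‖ₑ * F L x')^p)^(1/p) := by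
        gcongr with x'; exact hpt x'
    _ ≤ ∑ L, ‖c L.1 L.2‖ₑ * (∫⁻ x', (F L x')^p)^(1/p) := mink _ p hp _ _ _ fun L => CN_meas κ _
    _ ≤ ∑ L : Fin M × Idx n M q, ‖c L.1 L.2‖ₑ * K L.2.2.1 * ∑ d, eLpNorm (g q d) (oR p) volume := by
        refine Finset.sum_le_sum fun L _ => ?_
        rw [mul_assoc]
        gcongr
        have hm := (hv.hg q hq L.2.2.2).1
        refine (hKb _ _ (comp_memLp hm _)).trans ?_
        gcongr
        refine (eLpNorm_mono (g := g q L.2.2.2) fun y => PiLp.norm_apply_le _ _).trans ?_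
        exact Finset.single_le_sum (f := fun d => eLpNorm (g q d) (oR p) volume) (fun _ _ => bot_le) (Finset.mem_univ L.2.2.2)
    _ = _ := by rw [Finset.sum_mul]
end est

section leb
variable {V : Type*} [NormedAddCommGroup V] [InnerProductSpace ℝ V] [FiniteDimensional ℝ V] [MeasurableSpace V] [BorelSpace V]

lemma leb (hnt : Nontrivial V) (p : ℝ) (hp : 1 < p) (f : V → ℂ) (hf : MemLp f (oR p)) : ∀ᵐ x, ∃ B : ℝ≥0∞, B ≠ ∞ ∧ (∀ r > 0, (volume (ball x r))⁻¹ * ∫⁻ y in ball x r, ‖f y - f x‖ₑ ≤ B) ∧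
    Tendsto (fun r : ℝ => (volume (ball x r))⁻¹ * ∫⁻ y in ball x r, ‖f y - f x‖ₑ) (𝓝[>] 0) (𝓝 0) := by
  obtain ⟨C, hC, hH⟩ := HM_strong (E := V) volume p hp
  have hp1 : (1 : ℝ≥0∞) ≤ oR p := by rw [ENNReal.one_le_ofReal]; exact hp.le
  have h1 := (Besicovitch.vitaliFamily (volume : Measure V)).ae_tendsto_lintegral_enorm_sub_div (hf.locallyIntegrable hp1)
  have h2 : ∀ᵐ x : V, HM (fun y => ‖f y‖ₑ) x volume < ∞ := by
    have : ∫⁻ x, (HM (fun y => ‖f y‖ₑ) x volume)^p < ∞ := by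
      refine (hH _ hf.1.enorm).trans_lt (ENNReal.mul_lt_top hC.lt_top ?_)
      have := lintegral_rpow_enorm_lt_top_of_eLpNorm_lt_top (by simp; linarith) ENNReal.ofReal_ne_top hf.2
      rwa [ENNReal.toReal_ofReal (by linarith)] at this
    have h3 := ae_lt_top ((HM_meas (volume : Measure V) _).pow_const p) this.ne
    filter_upwards [h3] with x hx
    by_contra h
    rw [not_lt_top_iff] at h
    rw [h, ENNReal.top_rpow_of_pos (by linarith)] at hx
    exact lt_irrefl _ hx
  filter_upwards [h1, h2] with x hx hx2
  refine ⟨HM (fun y => ‖f y‖ₑ) x volume + ‖f x‖ₑ, by simp [hx2.ne], fun r hr => ?_, ?_⟩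
  · have hv0 := vol_ball_pos (volume : Measure V) x hr
    have hv1 : volume (ball x r) ≠ ∞ := measure_ball_lt_top.ne
    calc _ ≤ (volume (ball x r))⁻¹ * ∫⁻ y in ball x r, (‖f y‖ₑ + ‖f x‖ₑ) := by
          gcongr with y; exact enorm_sub_le
      _ = (volume (ball x r))⁻¹ * (∫⁻ y in ball x r, ‖f y‖ₑ) + ((volume (ball x r))⁻¹ * volume (ball x r)) * ‖f x‖ₑ := by
          rw [lintegral_add_right _ measurable_const, mul_add, setLIntegral_const]; ring
      _ ≤ _ := by
          rw [ENNReal.inv_mul_cancel hv0 hv1, one_mul]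
          gcongr
          exact le_iSup₂ (f := fun r (_ : 0 < r) => (volume (ball x r))⁻¹ * ∫⁻ y in ball x r, ‖f y‖ₑ) r hr
  · refine tendsto_of_tendsto_of_tendsto_of_le_of_le tendsto_const_nhds (hx.comp (Besicovitch.tendsto_filterAt volume x)) (fun _ => bot_le) fun r => ?_
    simp only [Function.comp]
    rw [ENNReal.div_eq_inv_mul, Measure.addHaar_closedBall_eq_addHaar_ball]
    gcongr
    exact ball_subset_closedBall

lemma leb_tsum {x : V} {G : ℝ → ℝ≥0∞} {B : ℝ≥0∞} (c : ℝ≥0∞) (hc : c ≠ ∞) (hB : B ≠ ∞) (h1 : ∀ r > 0, G r ≤ B) (h2 : Tendsto G (𝓝[>] 0) (𝓝 0)) :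
    Tendsto (fun t : ℝ => ∑' j : ℕ, c * (2⁻¹)^j * G (2^j * t)) (𝓝[>] 0) (𝓝 0) := by
  simp_rw [← lintegral_count]
  have hz : (0:ℝ≥0∞) = ∫⁻ j : ℕ, 0 ∂Measure.count := by simp
  rw [hz]
  refine tendsto_lintegral_filter_of_dominated_convergence (fun j : ℕ => c * (2⁻¹)^j * B) (Eventually.of_forall fun t => by fun_prop) ?_ ?_ ?_
  · filter_upwards [self_mem_nhdsWithin] with t ht
    refine Eventually.of_forall fun j => ?_
    gcongr
    exact h1 _ (by have : 0 < t := ht; positivity)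
  · rw [lintegral_count, ENNReal.tsum_mul_right, ENNReal.tsum_mul_left, ENNReal.tsum_geometric]
    refine ENNReal.mul_ne_top (ENNReal.mul_ne_top hc ?_) hB
    rw [ENNReal.one_sub_inv_two]; simp
  · refine Eventually.of_forall fun j => ?_
    have h3 : Tendsto (fun t : ℝ => 2^j * t) (𝓝[>] 0) (𝓝[>] 0) := by
      refine tendsto_nhdsWithin_iff.2 ⟨?_, ?_⟩
      · refine (tendsto_nhdsWithin_of_tendsto_nhds ?_)
        have : Tendsto (fun t : ℝ => 2^j * t) (𝓝 0) (𝓝 (2^j * 0)) := (continuous_const.mul continuous_id).tendsto 0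
        simpa using this
      · filter_upwards [self_mem_nhdsWithin] with t ht
        have : 0 < t := ht
        exact Set.mem_Ioi.2 (by positivity)
    have := ENNReal.Tendsto.const_mul (a := c * (2⁻¹)^j) (h2.comp h3) (Or.inr (ENNReal.mul_ne_top hc (ENNReal.pow_ne_top (by simp))))
    simpa using this

lemma nt_scalar (hnt : Nontrivial V) (p : ℝ) (hp : 1 < p) (d : ℕ) (hd : d = Module.finrank ℝ V) (Φ : V → ℂ) (hΦ : Continuous Φ) (C : ℝ) (hC : 0 ≤ C) (hb : ∀ z, ‖Φ z‖ ≤ C * pk d 1 ‖z‖) (κ : ℝ) (hκ : 0 < κ) (f : V → ℂ) (hf : MemLp f (oR p)) :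
    ∀ᵐ x, (∀ y t, 0 < t → dist x y < κ * t → Integrable (fun z => (((t^d)⁻¹ : ℝ) : ℂ) * Φ (t⁻¹ • (y - z)) * f z)) ∧ Tendsto (fun q : V × ℝ => ∫ z, (((q.2^d)⁻¹ : ℝ) : ℂ) * Φ (q.2⁻¹ • (q.1 - z)) * f z) (𝓝 (x, (0:ℝ)) ⊓ 𝓟 {q | 0 < q.2 ∧ dist x q.1 < κ * q.2}) (𝓝 ((∫ z, Φ z) * f x)) := by
  filter_upwards [leb hnt p hp f hf] with x ⟨B, hB, hB1, hB2⟩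
  have hΦi : Integrable Φ := by
    have h1 : Integrable (fun z : V => C * (1 + ‖z‖)^(-((d:ℝ)+1))) := (integrable_one_add_norm (by rw [hd]; linarith)).const_mul C
    refine h1.mono' hΦ.aestronglyMeasurable (Eventually.of_forall fun z => (hb z).trans_eq ?_)
    unfold pk
    rw [Real.rpow_neg (by positivity), show (d:ℝ)+1 = ((d+1 : ℕ) : ℝ) by push_cast; rfl, Real.rpow_natCast, one_div]
  set G : ℝ → ℝ≥0∞ := fun r => (volume (ball x r))⁻¹ * ∫⁻ y in ball x r, ‖f y - f x‖ₑ with hG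
  set c0 : ℝ≥0∞ := 2^(d+1) * volume (ball (0:V) 1) with hc0
  have hc0t : c0 ≠ ∞ := ENNReal.mul_ne_top (by simp) measure_ball_lt_top.ne
  set C1 := oR (C * (1+κ)^(d+1)) with hC1
  set T : ℝ → ℝ≥0∞ := fun t => ∑' j : ℕ, c0 * (2⁻¹)^j * G (2^j * t) with hT
  have hTb : ∀ t > 0, T t < ∞ := fun t ht => by
    calc T t ≤ ∑' j : ℕ, c0 * (2⁻¹)^j * B := ENNReal.tsum_le_tsum fun j => by gcongr; exact hB1 _ (by positivity)
      _ < ∞ := by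
        rw [ENNReal.tsum_mul_right, ENNReal.tsum_mul_left, ENNReal.tsum_geometric, ENNReal.one_sub_inv_two]
        exact (ENNReal.mul_ne_top (ENNReal.mul_ne_top hc0t (by simp)) hB).lt_top
  have hker : ∀ y t, 0 < t → dist x y < κ * t → ∀ z, ‖(((t^d)⁻¹ : ℝ) : ℂ) * Φ (t⁻¹ • (y - z))‖ ≤ C * (1+κ)^(d+1) * pk d t ‖x - z‖ := by
    intro y t ht hy z
    rw [norm_mul, Complex.norm_real, Real.norm_of_nonneg (by positivity)]
    have e : (t^d)⁻¹ * pk d 1 ‖t⁻¹ • (y - z)‖ = t / (t + ‖y - z‖)^(d+1) := by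
      unfold pk
      rw [norm_smul, Real.norm_of_nonneg (by positivity)]
      have : 1 + t⁻¹ * ‖y - z‖ = t⁻¹ * (t + ‖y - z‖) := by field_simp
      rw [this, mul_pow, inv_pow]
      have : 0 < t + ‖y - z‖ := by positivity
      field_simp
      ring
    have h3 : t + ‖x - z‖ ≤ (1+κ) * (t + ‖y - z‖) := by
      have := norm_sub_le_norm_sub_add_norm_sub x y z
      rw [dist_eq_norm] at hy
      nlinarith [mul_nonneg hκ.le (norm_nonneg (y - z))]
    calc (t^d)⁻¹ * ‖Φ (t⁻¹ • (y - z))‖ ≤ (t^d)⁻¹ * (C * pk d 1 ‖t⁻¹ • (y - z)‖) := by gcongr; exact hb _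
      _ = C * (t / (t + ‖y - z‖)^(d+1)) := by rw [← e]; ring
      _ ≤ C * ((1+κ)^(d+1) * pk d t ‖x - z‖) := by
          gcongr
          unfold pk
          rw [← mul_div_assoc, div_le_div_iff₀ (by positivity) (by positivity)]
          calc _ ≤ t * ((1+κ) * (t + ‖y - z‖))^(d+1) := by gcongr
            _ = _ := by rw [mul_pow]; ring
      _ = _ := by ring
  have hlin : ∀ y t, 0 < t → dist x y < κ * t → ∫⁻ z, ‖(((t^d)⁻¹ : ℝ) : ℂ) * Φ (t⁻¹ • (y - z)) * (f z - f x)‖ₑ ≤ C1 * T t := by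
    intro y t ht hy
    calc _ ≤ ∫⁻ z, C1 * (oR (pk d t ‖x - z‖) * ‖f z - f x‖ₑ) := by
          gcongr with z
          rw [enorm_mul, ← mul_assoc, hC1, ← ENNReal.ofReal_mul (by positivity)]
          gcongr
          rw [← ofReal_norm]
          exact ENNReal.ofReal_le_ofReal (hker y t ht hy z)
      _ = C1 * ∫⁻ z, (oR (pk d t ‖x - z‖) * ‖f z - f x‖ₑ) := lintegral_const_mul' _ _ ENNReal.ofReal_ne_top
      _ ≤ _ := by
          gcongr
          exact pk_tsum_le volume hd ht x _ (hf.1.sub aestronglyMeasurable_const).enorm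
  have hKc : ∀ (y : V) (t : ℝ), Continuous fun z => (((t^d)⁻¹ : ℝ) : ℂ) * Φ (t⁻¹ • (y - z)) := fun y t => by fun_prop
  have hi1 : ∀ y t, 0 < t → dist x y < κ * t → Integrable (fun z => (((t^d)⁻¹ : ℝ) : ℂ) * Φ (t⁻¹ • (y - z)) * (f z - f x)) := fun y t ht hy =>
    ⟨(hKc y t).aestronglyMeasurable.mul (hf.1.sub aestronglyMeasurable_const), (hlin y t ht hy).trans_lt (ENNReal.mul_lt_top ENNReal.ofReal_lt_top (hTb t ht))⟩
  have hi2 : ∀ y t, 0 < t → Integrable (fun z => (((t^d)⁻¹ : ℝ) : ℂ) * Φ (t⁻¹ • (y - z))) := fun y t ht => by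
    refine Integrable.const_mul ?_ _
    exact (hΦi.comp_smul (inv_ne_zero ht.ne')).comp_sub_left y
  have hv : ∀ y t, 0 < t → ∫ z, (((t^d)⁻¹ : ℝ) : ℂ) * Φ (t⁻¹ • (y - z)) = ∫ z, Φ z := fun y t ht => by
    rw [integral_const_mul, integral_sub_left_eq_self (fun z => Φ (t⁻¹ • z)) volume y, Measure.integral_comp_inv_smul_of_nonneg volume Φ ht.le, ← hd, Complex.real_smul, ← mul_assoc, ← Complex.ofReal_mul, inv_mul_cancel₀ (by positivity), Complex.ofReal_one, one_mul]
  have hi3 : ∀ y t, 0 < t → dist x y < κ * t → Integrable (fun z => (((t^d)⁻¹ : ℝ) : ℂ) * Φ (t⁻¹ • (y - z)) * f z) := fun y t ht hy => by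
    refine ((hi1 y t ht hy).add ((hi2 y t ht).mul_const (f x))).congr (Eventually.of_forall fun z => ?_)
    simp only [Pi.add_apply]
    ring
  refine ⟨hi3, ?_⟩
  have hmain : ∀ y t, 0 < t → dist x y < κ * t → ‖(∫ z, (((t^d)⁻¹ : ℝ) : ℂ) * Φ (t⁻¹ • (y - z)) * f z) - (∫ z, Φ z) * f x‖ₑ ≤ C1 * T t := by
    intro y t ht hy
    rw [← hv y t ht, ← integral_mul_const, ← integral_sub (hi3 y t ht hy) ((hi2 y t ht).mul_const _)]
    refine (enorm_integral_le_lintegral_enorm _).trans (le_trans (le_of_eq ?_) (hlin y t ht hy))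
    congr 1; ext z; rw [mul_sub]
  have hT0 : Tendsto (fun q : V × ℝ => C1 * T q.2) (𝓝 (x, (0:ℝ)) ⊓ 𝓟 {q | 0 < q.2 ∧ dist x q.1 < κ * q.2}) (𝓝 0) := by
    have h1 : Tendsto (fun q : V × ℝ => q.2) (𝓝 (x, (0:ℝ)) ⊓ 𝓟 {q | 0 < q.2 ∧ dist x q.1 < κ * q.2}) (𝓝[>] 0) :=
      tendsto_nhdsWithin_iff.2 ⟨(continuous_snd.tendsto (x, (0:ℝ))).mono_left inf_le_left,
        mem_inf_of_right (fun q hq => hq.1)⟩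
    have h2 := (leb_tsum (x := x) c0 hc0t hB hB1 hB2).comp h1
    have := ENNReal.Tendsto.const_mul (a := C1) h2 (Or.inr ENNReal.ofReal_ne_top)
    rw [mul_zero] at this
    exact this
  rw [tendsto_iff_edist_tendsto_0]
  refine tendsto_of_tendsto_of_tendsto_of_le_of_le' tendsto_const_nhds hT0 (Eventually.of_forall fun _ => bot_le) ?_
  refine mem_inf_of_right (fun q hq => ?_)
  change edist _ _ ≤ _
  rw [edist_eq_enorm_sub]
  exact hmain q.1 q.2 hq.1 hq.2
end leb

section fin
variable {n M : ℕ} (A : Fin n → Fin n → Fin M → Fin M → ℂ) (E k : ES n → Matrix (Fin M) (Fin M) ℂ)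

lemma u_nt (hn : 2 ≤ n) (p : ℝ) (hp : 1 < p) (κ : ℝ) (hκ : 0 < κ) (hker : ∀ i, Ker (n-1) (Dk E i)) (hk : ∀ x : ES n, x ≠ 0 → ∀ (s : Fin n) (γ α : Fin M),
      (∑ r, ∑ β, A r s β α * pd r (fun y => E y γ β) x) = ((x s : ℝ) : ℂ) * k x γ α)
    (c : ℝ) (hc : 0 < c)
    (hPbound : ∀ x' : ES (n-1), ∀ γ α : Fin M,
      ‖2 * k (toUp x' 1) γ α‖ ≤ c * (1 + ‖x'‖ ^ 2) ^ (-(n : ℝ) / 2))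
    (hPint : ∀ γ α : Fin M,
      (∫ x' : ES (n-1), 2 * k (toUp x' 1) γ α)
        = if γ = α then 1 else 0)
    (f : ES (n-1) → EuclideanSpace ℂ (Fin M)) (hf : MemLp f (oR p)) :
    ∀ᵐ x' : ES (n-1),
          Filter.Tendsto (fun q : (ES (n-1)) × ℝ => uF k f (toUp q.1 q.2))
            (ntFilter κ x') (nhds (f x')) := by
  have hnt : Nontrivial (ES (n-1)) := by
    refine Module.nontrivial_of_finrank_pos (R := ℝ) ?_
    simp; omega
  have hX0 : ∀ z : ES (n-1), (toUp z 1 : ES n) (lastIdx n (by omega)) = 1 ∧ (toUp z 1 : ES n) ≠ 0 := fun z => by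
    have hXl : (toUp z 1 : ES n) (lastIdx n (by omega)) = 1 := by rw [← xlast_eq hn, xlast_toUp hn]
    refine ⟨hXl, fun h => ?_⟩
    rw [h] at hXl; simp at hXl
  have hcont : ∀ γ α, Continuous fun z : ES (n-1) => 2 * k (toUp z 1) γ α := fun γ α => by
    have e : (fun z : ES (n-1) => 2 * k (toUp z 1) γ α) = fun z => 2 * ∑ r, ∑ β, A r (lastIdx n (by omega)) β α * Dk E (r, γ, β) (toUp z 1) := by
      ext z
      have h1 := hk (toUp z 1) (hX0 z).2 (lastIdx n (by omega)) γ α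
      rw [(hX0 z).1, Complex.ofReal_one, one_mul] at h1
      rw [← h1]; rfl
    rw [e]
    refine continuous_const.mul (continuous_finsetSum _ fun r _ => continuous_finsetSum _ fun β _ => continuous_const.mul ?_)
    exact (hker (r, γ, β)).smooth.continuousOn.comp_continuous (toUp_cont.comp (by fun_prop : Continuous fun y : ES (n-1) => (y, (1:ℝ)))) fun z => (hX0 z).2
  have hbd : ∀ γ α z, ‖2 * k (toUp z 1) γ α‖ ≤ (c * 2^((n:ℝ)/2)) * pk (n-1) 1 ‖z‖ := fun γ α z => by
    refine (hPbound z γ α).trans ?_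
    rw [mul_assoc]
    gcongr
    unfold pk
    rw [Nat.sub_add_cancel (by omega : 1 ≤ n), neg_div, Real.rpow_neg (by positivity), ← div_eq_mul_one_div, inv_eq_one_div, div_le_div_iff₀ (by positivity) (by positivity), one_mul, ← Real.mul_rpow (by positivity) (by positivity)]
    calc (1 + ‖z‖)^n = ((1 + ‖z‖)^2)^((n:ℝ)/2) := by
          rw [← Real.rpow_natCast (1 + ‖z‖) 2, ← Real.rpow_mul (by positivity), ← Real.rpow_natCast]
          congr 1; push_cast; ring
      _ ≤ _ := by
          gcongr
          nlinarith [sq_nonneg (1 - ‖z‖)]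
  have hall : ∀ γ α : Fin M, _ := fun γ α => nt_scalar hnt p hp (n-1) (by simp) (fun z => 2 * k (toUp z 1) γ α) (hcont γ α) (c * 2^((n:ℝ)/2)) (by positivity) (hbd γ α) κ hκ (fun y => f y α) (comp_memLp hf α)
  have hall2 := ae_all_iff.2 fun γ => ae_all_iff.2 fun α => hall γ α
  filter_upwards [hall2] with x hx
  unfold ntFilter
  have hcomp : ∀ γ, Tendsto (fun q : (ES (n-1)) × ℝ => uF k f (toUp q.1 q.2) γ) (𝓝 (x, (0:ℝ)) ⊓ 𝓟 {q | 0 < q.2 ∧ dist x q.1 < κ * q.2}) (𝓝 (f x γ)) := by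
    intro γ
    have h1 := tendsto_finsetSum (Finset.univ : Finset (Fin M)) fun α _ => (hx γ α).2
    have e1 : ∑ α, (∫ z : ES (n-1), 2 * k (toUp z 1) γ α) * f x α = f x γ := by
      simp [hPint]
    rw [e1] at h1
    refine h1.congr' (mem_inf_of_right fun q hq => ?_)
    change _ = ∫ y' : ES (n-1), ∑ α, (((xlast (toUp q.1 q.2 : ES n) : ℂ) ^ ((1 : ℤ) - (n : ℤ))) * (2 * k (toUp ((xlast (toUp q.1 q.2 : ES n))⁻¹ • (xinit (toUp q.1 q.2 : ES n) - y')) 1) γ α)) * f y' α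
    rw [xlast_toUp hn, xinit_toUp]
    have e2 : ((q.2 : ℂ) ^ ((1 : ℤ) - (n : ℤ))) = (((q.2^(n-1))⁻¹ : ℝ) : ℂ) := by
      rw [show (1:ℤ) - n = - ((n-1 : ℕ) : ℤ) by omega, zpow_neg, zpow_natCast]
      push_cast; rfl
    rw [e2]
    exact (integral_finsetSum _ fun α _ => (hx γ α).1 q.1 q.2 hq.1 hq.2).symm
  have h2 : Tendsto (fun q : (ES (n-1)) × ℝ => (WithLp.ofLp (uF k f (toUp q.1 q.2)))) (𝓝 (x, (0:ℝ)) ⊓ 𝓟 {q | 0 < q.2 ∧ dist x q.1 < κ * q.2}) (𝓝 (WithLp.ofLp (f x))) := tendsto_pi_nhds.2 hcomp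
  exact ((PiLp.continuous_toLp 2 (fun _ : Fin M => ℂ)).tendsto (WithLp.ofLp (f x))).comp h2

lemma fin_bound (hn : 2 ≤ n) (p : ℝ) (hp : 1 < p) (ℓ : ℕ) (κ : ℝ) (hκ : 0 < κ)
    (hest : ∀ (q : ℕ) (hq : q ≤ ℓ) (dd : Fin q → Fin n),
    ∃ K : ℝ≥0∞, K ≠ ∞ ∧ ∀ (f : ES (n-1) → EuclideanSpace ℂ (Fin M)) g, Val p ℓ f g → (∫⁻ x' : ES (n-1), (ntMax κ (mpd q dd (uF k f)) x') ^ p) ^ (1/p) ≤ K * ∑ d, eLpNorm (g q d) (oR p) volume) :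
   ∃ C : ℝ, 0 < C ∧ ∀ (f : ES (n-1) → EuclideanSpace ℂ (Fin M)) g, Val p ℓ f g →
    (∀ k' : ℕ, k' ≤ ℓ → ∀ dd : Fin k' → Fin n,
          ∫⁻ x' : ES (n-1), (ntMax κ (mpd k' dd (uF k f)) x') ^ p < ∞) ∧
        (∑ k' ∈ Finset.range (ℓ + 1), ∑ dd : Fin k' → Fin n,
            (∫⁻ x' : ES (n-1), (ntMax κ (mpd k' dd (uF k f)) x') ^ p)
              ^ (1 / p))
          ≤ oR C *
            (eLpNorm f (oR p) volume +
              ∑ k' ∈ Finset.range (ℓ + 1), ∑ d' : Fin k' → Fin (n - 1),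
                eLpNorm (g k' d') (oR p) volume) := by
  choose! K hK hKb using hest
  set S := ∑ q ∈ Finset.range (ℓ + 1), ∑ dd : Fin q → Fin n, K q dd with hS
  have hSt : S ≠ ∞ := ENNReal.sum_ne_top.2 fun q hq => ENNReal.sum_ne_top.2 fun dd _ => hK q (by simpa [Nat.lt_succ_iff] using hq) dd
  refine ⟨S.toReal + 1, by positivity, fun f g hv => ⟨fun q hq dd => ?_, ?_⟩⟩
  · have h1 := hKb q hq dd f g hv
    have h2 : (∫⁻ x' : ES (n-1), (ntMax κ (mpd q dd (uF k f)) x') ^ p) ^ (1/p) < ∞ :=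
      h1.trans_lt (ENNReal.mul_lt_top (hK q hq dd).lt_top (ENNReal.sum_lt_top.2 fun d _ => (hv.hg q hq d).1.2))
    by_contra h
    rw [not_lt_top_iff] at h
    rw [h, ENNReal.top_rpow_of_pos (by positivity)] at h2
    exact lt_irrefl _ h2
  · set R := ∑ k' ∈ Finset.range (ℓ + 1), ∑ d' : Fin k' → Fin (n - 1), eLpNorm (g k' d') (oR p) volume with hR
    calc _ ≤ ∑ q ∈ Finset.range (ℓ + 1), ∑ dd : Fin q → Fin n, K q dd * R := by
          refine Finset.sum_le_sum fun q hq => Finset.sum_le_sum fun dd _ => (hKb q (by simpa [Nat.lt_succ_iff] using hq) dd f g hv).trans ?_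
          gcongr
          exact Finset.single_le_sum (f := fun q => ∑ d' : Fin q → Fin (n - 1), eLpNorm (g q d') (oR p) volume) (fun _ _ => bot_le) hq
      _ = S * R := by simp_rw [← Finset.sum_mul]; rfl
      _ ≤ _ := by
          gcongr
          · rw [ENNReal.ofReal_add ENNReal.toReal_nonneg zero_le_one, ENNReal.ofReal_toReal hSt]; exact le_self_add
          · exact le_add_self
end fin
/-- The main theorem (Theorem 4.1 of the paper), for an elliptic system
`L_A` (`A r s α β` = `a^{αβ}_{rs}`) possessing a distinguished coefficient tensor, encoded
through: a fundamental solution `E` which is smooth away from `0`, even, with first-order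
derivatives positively homogeneous of degree `1-n`; a kernel `k` with
`Σ_{r,β} a^{βα}_{rs} ∂_r E_{γβ}(x) = x_s k_{γα}(x)`; and the normalization and decay of
`P := 2k(·,1)`. Conclusion: well-posedness of the `ℓ`-th order regularity Dirichlet
problem, solved by `u = P_t * f`, with nontangential maximal estimates of all orders
up to `ℓ`. -/
theorem statement10
    (n M : ℕ) (hn : 2 ≤ n) (hM : 1 ≤ M)
    (A : Fin n → Fin n → Fin M → Fin M → ℂ)
    (hA : LegendreHadamard A)
    (E : EuclideanSpace ℝ (Fin n) → Matrix (Fin M) (Fin M) ℂ)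
    (hEsmooth : ∀ γ β : Fin M,
      ContDiffOn ℝ (⊤ : ℕ∞) (fun x => E x γ β) {x : EuclideanSpace ℝ (Fin n) | x ≠ 0})
    (hEeven : ∀ x : EuclideanSpace ℝ (Fin n), x ≠ 0 → E (-x) = E x)
    (hEhom : ∀ (γ β : Fin M) (r : Fin n) (l : ℝ), 0 < l →
      ∀ x : EuclideanSpace ℝ (Fin n), x ≠ 0 →
        pd r (fun y => E y γ β) (l • x)
          = ((l : ℂ) ^ ((1 : ℤ) - (n : ℤ))) * pd r (fun y => E y γ β) x)
    (hEfund : ∀ φ : EuclideanSpace ℝ (Fin n) → EuclideanSpace ℂ (Fin M),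
      ContDiff ℝ (⊤ : ℕ∞) φ → HasCompactSupport φ → ∀ β : Fin M,
        (∫ x : EuclideanSpace ℝ (Fin n),
            ∑ γ, E x γ β * ∑ α, ∑ r, ∑ s, A r s α γ * pd r (pd s (fun y => φ y α)) x)
          = φ 0 β)
    (k : EuclideanSpace ℝ (Fin n) → Matrix (Fin M) (Fin M) ℂ)
    (hk : ∀ x : EuclideanSpace ℝ (Fin n), x ≠ 0 → ∀ (s : Fin n) (γ α : Fin M),
      (∑ r, ∑ β, A r s β α * pd r (fun y => E y γ β) x) = ((x s : ℝ) : ℂ) * k x γ α)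
    (c : ℝ) (hc : 0 < c)
    (hPbound : ∀ x' : EuclideanSpace ℝ (Fin (n - 1)), ∀ γ α : Fin M,
      ‖2 * k (toUp x' 1) γ α‖ ≤ c * (1 + ‖x'‖ ^ 2) ^ (-(n : ℝ) / 2))
    (hPint : ∀ γ α : Fin M,
      (∫ x' : EuclideanSpace ℝ (Fin (n - 1)), 2 * k (toUp x' 1) γ α)
        = if γ = α then 1 else 0)
    (p : ℝ) (hp : 1 < p) (ℓ : ℕ) (κ : ℝ) (hκ : 0 < κ) :
    ∃ C : ℝ, 0 < C ∧
      ∀ (f : EuclideanSpace ℝ (Fin (n - 1)) → EuclideanSpace ℂ (Fin M))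
        (g : (k' : ℕ) → (Fin k' → Fin (n - 1)) →
          EuclideanSpace ℝ (Fin (n - 1)) → EuclideanSpace ℂ (Fin M)),
        MemLp f (ENNReal.ofReal p) volume →
        (∀ k' : ℕ, k' ≤ ℓ → ∀ d' : Fin k' → Fin (n - 1),
          MemLp (g k' d') (ENNReal.ofReal p) volume ∧ IsWeakDeriv k' d' f (g k' d')) →
        (let u : EuclideanSpace ℝ (Fin n) → EuclideanSpace ℂ (Fin M) := fun x =>
          (WithLp.equiv 2 (Fin M → ℂ)).symm (fun γ =>
            ∫ y' : EuclideanSpace ℝ (Fin (n - 1)), ∑ α,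
              (((xlast x : ℂ) ^ ((1 : ℤ) - (n : ℤ))) *
                (2 * k (toUp ((xlast x)⁻¹ • (xinit x - y')) 1) γ α)) * f y' α)
        (∀ x ∈ upperHalfSpace n, ∀ α : Fin M,
          (∑ r, ∑ s, ∑ β, A r s α β * pd r (pd s (fun y => u y β)) x) = 0) ∧
        (∀ᵐ x' : EuclideanSpace ℝ (Fin (n - 1)),
          Filter.Tendsto (fun q : (EuclideanSpace ℝ (Fin (n - 1))) × ℝ => u (toUp q.1 q.2))
            (ntFilter κ x') (nhds (f x'))) ∧
        (∀ k' : ℕ, k' ≤ ℓ → ∀ dd : Fin k' → Fin n,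
          ∫⁻ x' : EuclideanSpace ℝ (Fin (n - 1)), (ntMax κ (mpd k' dd u) x') ^ p < ∞) ∧
        (∑ k' ∈ Finset.range (ℓ + 1), ∑ dd : Fin k' → Fin n,
            (∫⁻ x' : EuclideanSpace ℝ (Fin (n - 1)), (ntMax κ (mpd k' dd u) x') ^ p)
              ^ (1 / p))
          ≤ ENNReal.ofReal C *
            (eLpNorm f (ENNReal.ofReal p) volume +
              ∑ k' ∈ Finset.range (ℓ + 1), ∑ d' : Fin k' → Fin (n - 1),
                eLpNorm (g k' d') (ENNReal.ofReal p) volume)) := by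
  have hker := Dk_ker hEsmooth hn hEhom
  have hpde := pde0 A E hEsmooth hEfund
  obtain ⟨C, hC, hb⟩ := fin_bound k hn p hp ℓ κ hκ (est A E k hn p hp ℓ κ hκ hker (Dk_odd hEeven) hk (red A hEsmooth hn hA hpde))
  refine ⟨C, hC, fun f g hf hg => ?_⟩
  exact ⟨u_pde A E k hn p hp hker hEsmooth hpde hk f hf, u_nt A E k hn p hp κ hκ hker hk c hc hPbound hPint f hf, hb f g ⟨hf, hg⟩⟩

end
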